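/- Let α be an ordinal and let ℳ be practical for κ. Then, in ℳ, a witness collection 𝒰 of Ramsey measures on κ satisfies o_Ram(𝒰) ≥ α if and only if N_U ⊨ o_Ram(κ) ≥ α for every U ∈ 𝒰. -/

import Mathlib

noncomputable section

namespace MPaper

open ZFSet

attribute [local instance] Classical.propDecidable

/-! ### Basic set-theoretic vocabulary over `ZFSet` -/

/-- The (external) cardinality of a ZFC set. -/
def zcard (x : ZFSet) : Cardinal := Cardinal.mk x.toSet

/-- `x` is a von Neumann ordinal: a transitive set of transitive sets. -/
def IsOrd (x : ZFSet) : Prop := x.IsTransitive ∧ ∀ y ∈ x, ZFSet.IsTransitive y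

/-- `κ` is a cardinal: an ordinal not equinumerous with any of its members. -/
def IsCard (κ : ZFSet) : Prop := IsOrd κ ∧ ∀ α ∈ κ, zcard α < zcard κ

/-- The ordinal `κ⁺`, the cardinal successor of `κ`. -/
def cardSuccOrd (κ : ZFSet) : Ordinal := (Order.succ (zcard κ)).ord

/-- `f` is a set-coded function with domain `d` (a set of Kuratowski pairs). -/
def IsZFunc (d f : ZFSet) : Prop :=
  (∀ p ∈ f, ∃ a ∈ d, ∃ b, p = ZFSet.pair a b) ∧ ∀ a ∈ d, ∃! b, ZFSet.pair a b ∈ f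

/-- Application of a set-coded function. -/
def fapp (f a : ZFSet) : ZFSet :=
  ⋃₀ (ZFSet.sep (fun b => ZFSet.pair a b ∈ f) (⋃₀ (⋃₀ f)))

/-- `f` maps `d` into `y`. -/
def MapsInto (f d y : ZFSet) : Prop := ∀ a ∈ d, fapp f a ∈ y

/-- `f` maps `d` onto `y`. -/
def SurjOnto (f d y : ZFSet) : Prop := MapsInto f d y ∧ ∀ b ∈ y, ∃ a ∈ d, fapp f a = b

/-- `f` is injective on `d`. -/
def InjOnZ (f d : ZFSet) : Prop := ∀ a ∈ d, ∀ b ∈ d, fapp f a = fapp f b → a = b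

/-- `f` is a bijection from `d` onto `y`. -/
def IsBij (f d y : ZFSet) : Prop := IsZFunc d f ∧ SurjOnto f d y ∧ InjOnZ f d

/-- The tail `κ ∖ α = {ξ ∈ κ | α ≤ ξ}` (for ordinals `α ∈ κ`). -/
def tailSet (κ α : ZFSet) : ZFSet := ZFSet.sep (fun ξ => ξ ∉ α) κ

/-- The relative complement `κ ∖ A`. -/
def compl (κ A : ZFSet) : ZFSet := ZFSet.sep (fun ξ => ξ ∉ A) κ

/-! ### First-order satisfaction in ∈-structures -/

/-- First order formulas in the language of set theory, with variables indexed by `ℕ`. -/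
inductive Fml : Type
  | mem : ℕ → ℕ → Fml
  | eq : ℕ → ℕ → Fml
  | impl : Fml → Fml → Fml
  | neg : Fml → Fml
  | all : ℕ → Fml → Fml

/-- Tarskian satisfaction of a formula in the ∈-structure with domain `D`. -/
def Sat (D : Set ZFSet) : Fml → (ℕ → ZFSet) → Prop
  | .mem i j, v => v i ∈ v j
  | .eq i j, v => v i = v j
  | .impl φ ψ, v => Sat D φ v → Sat D ψ v
  | .neg φ, v => ¬ Sat D φ v
  | .all n φ, v => ∀ x ∈ D, Sat D φ (Function.update v n x)

/-- `D` is an elementary substructure of `E` (as ∈-structures). -/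
def ElemSub (D E : Set ZFSet) : Prop :=
  D ⊆ E ∧ ∀ (φ : Fml) (v : ℕ → ZFSet), (∀ n, v n ∈ D) → (Sat D φ v ↔ Sat E φ v)

/-- `r` is a well-ordering of `x` (coded as a set of Kuratowski pairs). -/
def IsWellOrderOn (x r : ZFSet) : Prop :=
  (∀ p ∈ r, ∃ a ∈ x, ∃ b ∈ x, p = ZFSet.pair a b) ∧
  (∀ a ∈ x, ∀ b ∈ x, a = b ∨ ZFSet.pair a b ∈ r ∨ ZFSet.pair b a ∈ r) ∧
  (∀ a ∈ x, ∀ b ∈ x, ∀ c ∈ x,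
    ZFSet.pair a b ∈ r → ZFSet.pair b c ∈ r → ZFSet.pair a c ∈ r) ∧
  (∀ a ∈ x, ZFSet.pair a a ∉ r) ∧
  (∀ S : Set ZFSet, S ⊆ x.toSet → S.Nonempty → ∃ a ∈ S, ∀ b ∈ S, ZFSet.pair b a ∉ r)

/-- A transitive model of `ZFC⁻` (ZFC minus power set): a transitive set closed under
pairing and union, containing `ω`, satisfying the separation and collection schemes for
first-order formulas, and choice in the guise of the well-ordering principle.
(Extensionality and foundation hold automatically in transitive sets.) -/
def IsTransModel (M : ZFSet) : Prop :=
  M.IsTransitive ∧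
  ZFSet.omega ∈ M ∧
  (∀ x ∈ M, ∀ y ∈ M, ({x, y} : ZFSet) ∈ M) ∧
  (∀ x ∈ M, (⋃₀ x : ZFSet) ∈ M) ∧
  (∀ (φ : Fml) (v : ℕ → ZFSet), (∀ n, v n ∈ M) → ∀ a ∈ M,
    ∃ b ∈ M, ∀ x, x ∈ b ↔ x ∈ a ∧ Sat M.toSet φ (Function.update v 0 x)) ∧
  (∀ (φ : Fml) (v : ℕ → ZFSet), (∀ n, v n ∈ M) → ∀ a ∈ M,
    (∀ x ∈ a, ∃ y ∈ M, Sat M.toSet φ (Function.update (Function.update v 0 x) 1 y)) →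
    ∃ b ∈ M, ∀ x ∈ a, ∃ y ∈ b, Sat M.toSet φ (Function.update (Function.update v 0 x) 1 y)) ∧
  (∀ x ∈ M, ∃ r ∈ M, IsWellOrderOn x r)

/-! ### Weak κ-models, κ-models, M-ultrafilters -/

/-- A weak `κ`-model: a transitive model of ZFC⁻ of size `κ` with `κ ∈ M`. -/
def IsWeakModel (κ M : ZFSet) : Prop :=
  IsTransModel M ∧ κ ∈ M ∧ zcard M = zcard κ

/-- `M` is closed under `<κ`-sequences (of its elements). -/
def SeqClosed (κ M : ZFSet) : Prop :=
  ∀ γ ∈ κ, ∀ f : ZFSet, IsZFunc γ f → (∀ a ∈ γ, fapp f a ∈ M) → f ∈ M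

/-- A `κ`-model: a weak `κ`-model closed under `<κ`-sequences. -/
def IsKappaModel (κ M : ZFSet) : Prop := IsWeakModel κ M ∧ SeqClosed κ M

/-- `U` is an `M`-ultrafilter on `κ`: `⟨M, ∈, U⟩` thinks `U` is a normal ultrafilter on `κ`
containing all tail sets. -/
def IsMUltrafilter (κ M U : ZFSet) : Prop :=
  (∀ A ∈ U, A ∈ M ∧ A ⊆ κ) ∧
  (∀ α ∈ κ, tailSet κ α ∈ U) ∧
  (∅ : ZFSet) ∉ U ∧
  (∀ A ∈ U, ∀ B ∈ U, A ∩ B ∈ U) ∧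
  (∀ A ∈ U, ∀ B, B ∈ M → B ⊆ κ → A ⊆ B → B ∈ U) ∧
  (∀ B, B ∈ M → B ⊆ κ → B ∈ U ∨ compl κ B ∈ U) ∧
  (∀ f ∈ M, IsZFunc κ f → ZFSet.sep (fun ξ => fapp f ξ ∈ ξ) κ ∈ U →
    ∃ γ ∈ κ, ZFSet.sep (fun ξ => fapp f ξ = γ) κ ∈ U)

/-- `U` is weakly amenable for `M`: for every `X ∈ M` of size at most `κ` in `M`,
the intersection `X ∩ U` belongs to `M`. -/
def WeaklyAmenable (κ M U : ZFSet) : Prop :=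
  ∀ X ∈ M, (∃ f ∈ M.toSet, IsZFunc κ f ∧ ∀ y ∈ X, ∃ ξ ∈ κ, fapp f ξ = y) →
    X ∩ U ∈ M

/-- `U` is `ω₁`-intersecting: every countable collection of its members has a common element. -/
def OmegaOneIntersecting (U : ZFSet) : Prop :=
  ∀ s : ℕ → ZFSet, (∀ n, s n ∈ U) → ∃ x, ∀ n, x ∈ s n

/-- `M` contains (its version of) `V_κ`, i.e. the set of all sets of rank `< κ`. -/
def HasVkappa (κ M : ZFSet) : Prop :=
  ∃ v ∈ M.toSet, ∀ x, x ∈ v ↔ ZFSet.rank x < ZFSet.rank κ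

/-! ### Small universe measures and the associated models `M_U`, `N_U` -/

/-- `M` is the minimal model associated to `U` (the collection of Mostowski collapses of
well-founded relations on `κ` coded by sets in `U` and their complements): a weak `κ`-model
with `V_κ ∈ M` for which `U` is an `M`-ultrafilter, contained in every transitive
ZFC⁻-model `M'` with `κ ∈ M'` for which `U` is an `M'`-ultrafilter. -/
def IsMUModel (κ U M : ZFSet) : Prop :=
  IsWeakModel κ M ∧ HasVkappa κ M ∧ IsMUltrafilter κ M U ∧
  ∀ M', IsTransModel M' → κ ∈ M' → IsMUltrafilter κ M' U → M ⊆ M'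

/-- A small universe measure on `κ`: a set `U` of subsets of `κ` of size `κ` whose associated
minimal model `M_U` exists (is a weak `κ`-model with `V_κ ∈ M_U` and `U` an `M_U`-ultrafilter). -/
def IsSUMeasure (κ U : ZFSet) : Prop :=
  zcard U = zcard κ ∧ (∀ A ∈ U, A ⊆ κ) ∧ ∃ M, IsMUModel κ U M

/-- The minimal model `M_U` associated to a small universe measure `U`. -/
def MU (κ U : ZFSet) : ZFSet :=
  if h : ∃ M, IsMUModel κ U M then h.choose else ∅

/-- `j : M → N` is (up to isomorphism) the ultrapower embedding of `M` by the
`M`-ultrafilter `U` on `κ`, with `N` transitive (so the ultrapower is well-founded):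
`j` is elementary, every element of `N` has the form `j(f)(κ)` for `f : κ → M` in `M`,
and `U` is the `M`-ultrafilter derived from `j` with seed `κ`. -/
def IsUltrapowerEmb (κ M U N : ZFSet) (j : ZFSet → ZFSet) : Prop :=
  N.IsTransitive ∧
  (∀ x ∈ M, j x ∈ N) ∧
  (∀ (φ : Fml) (v : ℕ → ZFSet), (∀ n, v n ∈ M) →
    (Sat M.toSet φ v ↔ Sat N.toSet φ (fun n => j (v n)))) ∧
  (∀ a ∈ N, ∃ f ∈ M.toSet, IsZFunc κ f ∧ MapsInto f κ M ∧ fapp (j f) κ = a) ∧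
  (∀ A ∈ M, A ⊆ κ → (A ∈ U ↔ κ ∈ j A))

/-- The ultrapower of `M_U` by `U` is well-founded. -/
def UltrapowerWF (κ U : ZFSet) : Prop :=
  ∃ (N : ZFSet) (j : ZFSet → ZFSet), IsUltrapowerEmb κ (MU κ U) U N j

/-- A choice of transitive collapse of the ultrapower of `M_U` by `U`, with its embedding. -/
def upData (κ U : ZFSet) : ZFSet × (ZFSet → ZFSet) :=
  if h : ∃ p : ZFSet × (ZFSet → ZFSet), IsUltrapowerEmb κ (MU κ U) U p.1 p.2
  then h.choose else (∅, id)

/-- `N_U`: the transitive collapse of the ultrapower of `M_U` by `U` (when well-founded). -/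
def NU (κ U : ZFSet) : ZFSet := (upData κ U).1

/-- The ultrapower embedding `j_U : M_U → N_U`. -/
def jU (κ U : ZFSet) : ZFSet → ZFSet := (upData κ U).2

/-- `M_U⋆ = V_{j(κ)}^{N_U}`, the rank-initial segment of `N_U` below `j_U(κ)`. -/
def MUstar (κ U : ZFSet) : ZFSet :=
  ZFSet.sep (fun x => ZFSet.rank x < ZFSet.rank (jU κ U κ)) (NU κ U)

/-! ### Hereditary size, `H_{κ⁺}`, elementarity -/

/-- `x` has hereditary size at most `κ`. -/
def HeredLE (κ : ZFSet) : ZFSet → Prop :=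
  WellFounded.fix ZFSet.mem_wf
    (fun x ih => zcard x ≤ zcard κ ∧ ∀ y, ∀ h : y ∈ x, ih y h)

/-- The class `H_{κ⁺}` of sets of hereditary size at most `κ`. -/
def Hclass (κ : ZFSet) : Set ZFSet := { x | HeredLE κ x }

/-! ### The measures witnessing Ramsey and Ramsey-like cardinals -/

/-- A Ramsey measure on `κ`: a weakly amenable `ω₁`-intersecting small universe measure. -/
def IsRamseyMeasure (κ U : ZFSet) : Prop :=
  IsSUMeasure κ U ∧ WeaklyAmenable κ (MU κ U) U ∧ OmegaOneIntersecting U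

/-- A strong Ramsey measure on `κ`: a weakly amenable small universe measure whose
minimal model `M_U` is a `κ`-model. -/
def IsStrongRamseyMeasure (κ U : ZFSet) : Prop :=
  IsSUMeasure κ U ∧ WeaklyAmenable κ (MU κ U) U ∧ SeqClosed κ (MU κ U)

/-- A super Ramsey measure on `κ`: a strong Ramsey measure with `M_U ≺ H_{κ⁺}`. -/
def IsSuperRamseyMeasure (κ U : ZFSet) : Prop :=
  IsStrongRamseyMeasure κ U ∧ ElemSub (MU κ U).toSet (Hclass κ)

/-- `I` certifies `U`: `I` is an unbounded subset of `κ` and the sets in `U` are exactly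
the subsets of `κ` in `M_U` containing a tail of `I`. -/
def Certifies (κ U : ZFSet) (I : Set ZFSet) : Prop :=
  (∀ ξ ∈ I, ξ ∈ κ) ∧ (∀ α ∈ κ, ∃ ξ ∈ I, ξ ∉ α) ∧
  ∀ X ∈ (MU κ U).toSet, X ⊆ κ →
    (X ∈ U ↔ ∃ α ∈ κ.toSet, ∀ ξ ∈ I, ξ ∉ α → ξ ∈ X)

/-- A certified Ramsey measure on `κ`: a weakly amenable small universe measure which is
certified by some unbounded `I ⊆ κ`. -/
def IsCertifiedRamseyMeasure (κ U : ZFSet) : Prop :=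
  IsSUMeasure κ U ∧ WeaklyAmenable κ (MU κ U) U ∧ ∃ I : Set ZFSet, Certifies κ U I

/-! ### Relativized (internal) versions of the measure predicates -/

/-- `ω₁`-intersecting from the point of view of the transitive model `N`: every
`ω`-sequence of members of `U` lying in `N` has a common element. -/
def OmegaOneIntersectingIn (N U : ZFSet) : Prop :=
  ∀ f ∈ N.toSet, IsZFunc ZFSet.omega f → (∀ n ∈ ZFSet.omega, fapp f n ∈ U) →
    ∃ x, ∀ n ∈ ZFSet.omega, x ∈ fapp f n

/-- `N ⊨ U is a Ramsey measure on κ`, for a transitive ZFC⁻-model `N`: all components are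
absolute except `ω₁`-intersectingness, which is evaluated using sequences in `N`. -/
def RamseyMeasureIn (N κ U : ZFSet) : Prop :=
  U ∈ N ∧ IsSUMeasure κ U ∧ WeaklyAmenable κ (MU κ U) U ∧ OmegaOneIntersectingIn N U

/-- `N ⊨ U is a strong Ramsey measure on κ`: closure of `M_U` under `<κ`-sequences is
evaluated using the sequences lying in `N`. -/
def StrongRamseyMeasureIn (N κ U : ZFSet) : Prop :=
  U ∈ N ∧ IsSUMeasure κ U ∧ WeaklyAmenable κ (MU κ U) U ∧
  ∀ f ∈ N.toSet, ∀ γ ∈ κ, IsZFunc γ f → (∀ a ∈ γ, fapp f a ∈ MU κ U) → f ∈ MU κ U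

/-- The class `H_{κ⁺}` as computed in `N`. -/
def HclassIn (N κ : ZFSet) : Set ZFSet := { x | x ∈ N ∧ HeredLE κ x }

/-- `N ⊨ U is a super Ramsey measure on κ`. -/
def SuperRamseyMeasureIn (N κ U : ZFSet) : Prop :=
  StrongRamseyMeasureIn N κ U ∧ ElemSub (MU κ U).toSet (HclassIn N κ)

/-- `N ⊨ U is a certified Ramsey measure on κ` (the certifying set is required to lie in `N`). -/
def CertifiedRamseyMeasureIn (N κ U : ZFSet) : Prop :=
  U ∈ N ∧ IsSUMeasure κ U ∧ WeaklyAmenable κ (MU κ U) U ∧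
  ∃ I ∈ N.toSet, Certifies κ U I.toSet

/-! ### Goodness, witness collections, and the M-order -/

/-- `U` is `A`-good: `A ∈ M_U`. -/
def AGood (κ A U : ZFSet) : Prop := A ∈ MU κ U

/-- A witness collection of `Pm`-measures on `κ`: a collection of `Pm`-measures containing
an `A`-good one for every `A ⊆ κ`. -/
def IsWitness (Pm : ZFSet → ZFSet → Prop) (κ : ZFSet) (𝒰 : Set ZFSet) : Prop :=
  (∀ U ∈ 𝒰, Pm κ U) ∧ ∀ A : ZFSet, A ⊆ κ → ∃ U ∈ 𝒰, AGood κ A U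

/-- The M-order on witness collections of `Pm`-measures on `κ`; `PmIn N κ U` is the
relativization `N ⊨ U is a Pm-measure on κ`.  `MOrder Pm PmIn κ 𝒰 𝒲` says `𝒰 ◁ 𝒲`. -/
def MOrder (Pm : ZFSet → ZFSet → Prop) (PmIn : ZFSet → ZFSet → ZFSet → Prop)
    (κ : ZFSet) (𝒰 𝒲 : Set ZFSet) : Prop :=
  IsWitness Pm κ 𝒰 ∧ IsWitness Pm κ 𝒲 ∧
  (∀ W ∈ 𝒲, ∀ A ∈ (NU κ W).toSet, A ⊆ κ →
    ∃ U ∈ 𝒰, U ∈ NU κ W ∧ AGood κ A U ∧ PmIn (NU κ W) κ U) ∧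
  (∀ U ∈ 𝒰, ∃ W ∈ 𝒲, U ∈ NU κ W)

/-! ### Ranks -/

/-- The rank of a point in an arbitrary binary relation (`0` at non-accessible points). -/
def relRank {X : Type*} (r : X → X → Prop) (x : X) : Ordinal :=
  if h : Acc r x then h.rank else 0

/-- The M-rank `o_Pm(κ)`: the strict supremum of the M-ranks of all witness collections of
`Pm`-measures on `κ` (and `0` if there are none). -/
def oRank (Pm : ZFSet → ZFSet → Prop) (PmIn : ZFSet → ZFSet → ZFSet → Prop)
    (κ : ZFSet) : Ordinal :=
  sSup { o : Ordinal |
    ∃ 𝒰 : Set ZFSet, IsWitness Pm κ 𝒰 ∧ o = relRank (MOrder Pm PmIn κ) 𝒰 + 1 }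

/-- `N ⊨ o_Pm(κ) ≥ α`, defined by the recursion: for every `A ⊆ κ` in `N` and every `β < α`
there is an `A`-good `Pm`-measure `W` in `N` (in the sense of `N`) whose ultrapower satisfies
`o_Pm(κ) ≥ β`. -/
def oGEin (PmIn : ZFSet → ZFSet → ZFSet → Prop) (κ : ZFSet) : Ordinal → ZFSet → Prop :=
  WellFounded.fix wellFounded_lt fun α ih N =>
    ∀ A ∈ N.toSet, A ⊆ κ → ∀ β, ∀ h : β < α,
      ∃ W ∈ N.toSet, PmIn N κ W ∧ AGood κ A W ∧ ih β h (NU κ W)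

/-- `N ⊨ o_Pm(κ) = α`. -/
def oEQin (PmIn : ZFSet → ZFSet → ZFSet → Prop) (κ : ZFSet) (α : Ordinal) (N : ZFSet) : Prop :=
  oGEin PmIn κ α N ∧ ¬ oGEin PmIn κ (α + 1) N

/-! ### The M-order and M-rank relativized to a model `ℳ` -/

/-- A witness collection (coded as a set) of `Pm`-measures in the sense of the model `ℳ`. -/
def IsWitnessIn (PmIn : ZFSet → ZFSet → ZFSet → Prop) (ℳ κ 𝒰 : ZFSet) : Prop :=
  𝒰 ∈ ℳ ∧ (∀ U ∈ 𝒰, PmIn ℳ κ U) ∧ ∀ A ∈ ℳ.toSet, A ⊆ κ → ∃ U ∈ 𝒰.toSet, AGood κ A U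

/-- The M-order on witness collections as computed in `ℳ`. -/
def MOrderIn (PmIn : ZFSet → ZFSet → ZFSet → Prop) (ℳ κ : ZFSet) (𝒰 𝒲 : ZFSet) : Prop :=
  IsWitnessIn PmIn ℳ κ 𝒰 ∧ IsWitnessIn PmIn ℳ κ 𝒲 ∧
  (∀ W ∈ 𝒲, ∀ A ∈ (NU κ W).toSet, A ⊆ κ →
    ∃ U ∈ 𝒰.toSet, U ∈ NU κ W ∧ AGood κ A U ∧ PmIn (NU κ W) κ U) ∧
  (∀ U ∈ 𝒰, ∃ W ∈ 𝒲.toSet, U ∈ NU κ W)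

/-- The M-rank `o_Pm(κ)` as computed in `ℳ`. -/
def oRankIn (PmIn : ZFSet → ZFSet → ZFSet → Prop) (ℳ κ : ZFSet) : Ordinal :=
  sSup { o : Ordinal |
    ∃ 𝒰 : ZFSet, IsWitnessIn PmIn ℳ κ 𝒰 ∧ o = relRank (MOrderIn PmIn ℳ κ) 𝒰 + 1 }

/-! ### Practical models, cover and approximation properties -/

/-- `ℳ` is practical for `κ`: a transitive ZFC⁻-model containing `κ` in which
`V_{κ+3}` exists. -/
def Practical (κ ℳ : ZFSet) : Prop :=
  IsTransModel ℳ ∧ κ ∈ ℳ ∧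
  ∃ v ∈ ℳ.toSet, ∀ x, x ∈ v ↔ (x ∈ ℳ ∧ ZFSet.rank x < ZFSet.rank κ + 3)

/-- `x` has size less than `δ` as witnessed inside the class `D`:
some `f ∈ D` injects `x` into an ordinal `γ ∈ δ`. -/
def SizeLTin (D : Set ZFSet) (x δ : ZFSet) : Prop :=
  ∃ γ ∈ δ.toSet, ∃ f ∈ D, IsZFunc x f ∧ MapsInto f x γ ∧ InjOnZ f x

/-- The pair `D ⊆ D'` has the `δ`-cover property. -/
def CoverProperty (δ : ZFSet) (D D' : Set ZFSet) : Prop :=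
  ∀ X ∈ D', X.toSet ⊆ D → SizeLTin D' X δ →
    ∃ Y ∈ D, X ⊆ Y ∧ SizeLTin D Y δ

/-- The pair `D ⊆ D'` has the `δ`-approximation property. -/
def ApproxProperty (δ : ZFSet) (D D' : Set ZFSet) : Prop :=
  ∀ X ∈ D', X.toSet ⊆ D → (∀ x ∈ D, SizeLTin D x δ → X ∩ x ∈ D) → X ∈ D

/-- `δ` is a cardinal from the point of view of the class `D`. -/
def IsCardIn (D : Set ZFSet) (δ : ZFSet) : Prop :=
  IsOrd δ ∧ δ ∈ D ∧ ∀ γ ∈ δ, ¬ ∃ f ∈ D, IsZFunc γ f ∧ SurjOnto f γ δ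

/-- `δ` is a regular (infinite) cardinal from the point of view of the class `D`. -/
def IsRegularIn (D : Set ZFSet) (δ : ZFSet) : Prop :=
  IsCardIn D δ ∧ ZFSet.omega ⊆ δ ∧
  ∀ γ ∈ δ, ∀ f ∈ D, IsZFunc γ f → MapsInto f γ δ →
    ∃ β ∈ δ, ∀ a ∈ γ, fapp f a ∈ β

/-- `H_λ` as computed in the model `V`: the members of `V` having, in `V`,
a transitive superset of size `< λ`. -/
def HIn (V lam : ZFSet) : Set ZFSet :=
  { x | x ∈ V ∧ ∃ t ∈ V.toSet, x ⊆ t ∧ t.IsTransitive ∧ SizeLTin V.toSet t lam }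

/-- `V` and `V'` have the same ordinals. -/
def SameOrdinals (D D' : Set ZFSet) : Prop :=
  ∀ α, IsOrd α → (α ∈ D ↔ α ∈ D')

/-- Every `ω`-sequence of elements of `ℳ` lying in `ℳ'` is an element of `ℳ`. -/
def OmegaSeqClosedPair (ℳ ℳ' : ZFSet) : Prop :=
  ∀ f ∈ ℳ'.toSet, IsZFunc ZFSet.omega f → (∀ n ∈ ZFSet.omega, fapp f n ∈ ℳ) → f ∈ ℳ

/-! ### Large cardinal properties -/

/-- `κ` is Ramsey: every `A ⊆ κ` belongs to a weak `κ`-model `M` carrying a weakly amenable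
`ω₁`-intersecting `M`-ultrafilter on `κ`. -/
def IsRamseyCard (κ : ZFSet) : Prop :=
  IsCard κ ∧ ∀ A : ZFSet, A ⊆ κ →
    ∃ M, IsWeakModel κ M ∧ A ∈ M ∧
      ∃ U, IsMUltrafilter κ M U ∧ WeaklyAmenable κ M U ∧ OmegaOneIntersecting U

/-- `κ` is strongly Ramsey: the model `M` can moreover be taken to be a `κ`-model. -/
def IsStronglyRamseyCard (κ : ZFSet) : Prop :=
  IsCard κ ∧ ∀ A : ZFSet, A ⊆ κ →
    ∃ M, IsKappaModel κ M ∧ A ∈ M ∧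
      ∃ U, IsMUltrafilter κ M U ∧ WeaklyAmenable κ M U ∧ OmegaOneIntersecting U

/-- `κ` is super Ramsey: the model `M` can moreover be taken to be a `κ`-model
elementary in `H_{κ⁺}`. -/
def IsSuperRamseyCard (κ : ZFSet) : Prop :=
  IsCard κ ∧ ∀ A : ZFSet, A ⊆ κ →
    ∃ M, IsKappaModel κ M ∧ ElemSub M.toSet (Hclass κ) ∧ A ∈ M ∧
      ∃ U, IsMUltrafilter κ M U ∧ WeaklyAmenable κ M U ∧ OmegaOneIntersecting U

/-- `κ` is weakly super Ramsey: the model `M` is a weak `κ`-model elementary in `H_{κ⁺}`. -/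
def IsWeaklySuperRamseyCard (κ : ZFSet) : Prop :=
  IsCard κ ∧ ∀ A : ZFSet, A ⊆ κ →
    ∃ M, IsWeakModel κ M ∧ ElemSub M.toSet (Hclass κ) ∧ A ∈ M ∧
      ∃ U, IsMUltrafilter κ M U ∧ WeaklyAmenable κ M U ∧ OmegaOneIntersecting U

/-- `κ` is measurable: there is a `κ`-complete nonprincipal ultrafilter on (all) subsets
of `κ`. -/
def IsMeasurableCard (κ : ZFSet) : Prop :=
  IsCard κ ∧ ZFSet.omega ∈ κ ∧
  ∃ 𝒰 : Set ZFSet,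
    (∀ A ∈ 𝒰, A ⊆ κ) ∧ (∅ : ZFSet) ∉ 𝒰 ∧ κ ∈ 𝒰 ∧
    (∀ A ∈ 𝒰, ∀ B : ZFSet, B ⊆ κ → A ⊆ B → B ∈ 𝒰) ∧
    (∀ A : ZFSet, A ⊆ κ → (A ∈ 𝒰 ∨ compl κ A ∈ 𝒰)) ∧
    (∀ γ ∈ κ.toSet, ∀ s : ZFSet → ZFSet, (∀ i ∈ γ, s i ∈ 𝒰) →
      ZFSet.sep (fun ξ => ∀ i ∈ γ, ξ ∈ s i) κ ∈ 𝒰)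

/-! ### Relativized large-cardinal properties -/

/-- `N ⊨ κ is Ramsey` (for a transitive model `N`): the witnessing models and ultrafilters
lie in `N`, smallness of the models is witnessed in `N`, and `ω₁`-intersectingness is
evaluated using the sequences in `N`. -/
def RamseyCardIn (N κ : ZFSet) : Prop :=
  ∀ A ∈ N.toSet, A ⊆ κ →
    ∃ M ∈ N.toSet, A ∈ M ∧ IsTransModel M ∧ κ ∈ M ∧
      (∃ f ∈ N.toSet, IsZFunc κ f ∧ SurjOnto f κ M) ∧
      ∃ U ∈ N.toSet, IsMUltrafilter κ M U ∧ WeaklyAmenable κ M U ∧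
        OmegaOneIntersectingIn N U

/-- `N ⊨ κ is strongly Ramsey`. -/
def StronglyRamseyCardIn (N κ : ZFSet) : Prop :=
  ∀ A ∈ N.toSet, A ⊆ κ →
    ∃ M ∈ N.toSet, A ∈ M ∧ IsTransModel M ∧ κ ∈ M ∧
      (∃ f ∈ N.toSet, IsZFunc κ f ∧ SurjOnto f κ M) ∧
      (∀ f ∈ N.toSet, ∀ γ ∈ κ, IsZFunc γ f → (∀ a ∈ γ, fapp f a ∈ M) → f ∈ M) ∧
      ∃ U ∈ N.toSet, IsMUltrafilter κ M U ∧ WeaklyAmenable κ M U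

/-- `N ⊨ κ is super Ramsey`. -/
def SuperRamseyCardIn (N κ : ZFSet) : Prop :=
  ∀ A ∈ N.toSet, A ⊆ κ →
    ∃ M ∈ N.toSet, A ∈ M ∧ IsTransModel M ∧ κ ∈ M ∧
      (∃ f ∈ N.toSet, IsZFunc κ f ∧ SurjOnto f κ M) ∧
      (∀ f ∈ N.toSet, ∀ γ ∈ κ, IsZFunc γ f → (∀ a ∈ γ, fapp f a ∈ M) → f ∈ M) ∧
      ElemSub M.toSet (HclassIn N κ) ∧
      ∃ U ∈ N.toSet, IsMUltrafilter κ M U ∧ WeaklyAmenable κ M U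

/-! ### ω-special models -/

/-- A weak `κ`-model `M` is `ω`-special: it is the union of a chain
`M₀ ≺ M₁ ≺ ⋯` of elementary substructures of `M` with each `Mₙ ∈ M` and `|Mₙ|^M = κ`. -/
def OmegaSpecial (κ M : ZFSet) : Prop :=
  ∃ s : ℕ → ZFSet,
    (∀ n, s n ∈ M) ∧
    (∀ n, (s n).toSet ⊆ (s (n + 1)).toSet) ∧
    (∀ n, ElemSub (s n).toSet M.toSet) ∧
    (∀ n, ∃ f ∈ M.toSet, IsBij f κ (s n)) ∧
    (∀ x, x ∈ M ↔ ∃ n, x ∈ s n)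

/-! ### Iterated ultrapowers and α-iterability -/

/-- `U` is an `α`-iterable `M`-ultrafilter on `κ`: there is a coherent system of transitive
models `Mod β` (`β ≤ α`), with commuting elementary embeddings `e β γ : Mod β → Mod γ`,
critical sequence `cr β` and ultrafilter sequence `Us β`, starting at `(M, κ, U)`, where each
successor step is given by an ultrapower and each limit step is a (collapsed) direct limit. -/
def IsAlphaIterable (κ M U : ZFSet) (α : Ordinal) : Prop :=
  ∃ (Mod : Ordinal → ZFSet) (cr : Ordinal → ZFSet) (Us : Ordinal → ZFSet)
    (e : Ordinal → Ordinal → ZFSet → ZFSet),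
    Mod 0 = M ∧ cr 0 = κ ∧ Us 0 = U ∧
    (∀ β ≤ α, (Mod β).IsTransitive) ∧
    (∀ β ≤ α, ∀ x ∈ Mod β, e β β x = x) ∧
    (∀ β γ ρ : Ordinal, β ≤ γ → γ ≤ ρ → ρ ≤ α →
      ∀ x ∈ Mod β, e γ ρ (e β γ x) = e β ρ x) ∧
    (∀ β γ : Ordinal, β ≤ γ → γ ≤ α →
      (∀ x ∈ Mod β, e β γ x ∈ Mod γ) ∧
      ∀ (φ : Fml) (v : ℕ → ZFSet), (∀ n, v n ∈ Mod β) →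
        (Sat (Mod β).toSet φ v ↔ Sat (Mod γ).toSet φ (fun n => e β γ (v n)))) ∧
    (∀ β : Ordinal, β + 1 ≤ α →
      IsUltrapowerEmb (cr β) (Mod β) (Us β) (Mod (β + 1)) (e β (β + 1)) ∧
      cr (β + 1) = e β (β + 1) (cr β) ∧
      (∀ A, A ∈ Us (β + 1) ↔
        ∃ X ∈ (Mod β).toSet, X ∩ Us β ∈ Mod β ∧ A ∈ e β (β + 1) (X ∩ Us β))) ∧
    (∀ lam : Ordinal, lam ≤ α → lam ≠ 0 → (∀ β < lam, β + 1 < lam) →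
      (∀ x ∈ Mod lam, ∃ β < lam, ∃ y ∈ (Mod β).toSet, e β lam y = x) ∧
      cr lam = e 0 lam κ ∧
      (∀ A, A ∈ Us lam ↔ ∃ β < lam, ∃ B, B ∈ Us β ∧ e β lam B = A))

/-- `N ⊨ κ is α-iterable`: every `A ⊆ κ` in `N` belongs to a weak `κ`-model `M ∈ N` for
which there is a weakly amenable `α`-iterable `M`-ultrafilter `U ∈ N` on `κ`. -/
def AlphaIterableCardIn (N κ : ZFSet) (α : Ordinal) : Prop :=
  ∀ A ∈ N.toSet, A ⊆ κ →
    ∃ M ∈ N.toSet, A ∈ M ∧ IsTransModel M ∧ κ ∈ M ∧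
      (∃ f ∈ N.toSet, IsZFunc κ f ∧ SurjOnto f κ M) ∧
      ∃ U ∈ N.toSet, IsMUltrafilter κ M U ∧ WeaklyAmenable κ M U ∧
        IsAlphaIterable κ M U α

/-! ### Forcing -/

/-- `R` codes a partial order (of forcing conditions) on `P`: `pair p q ∈ R` means `p ≤ q`. -/
def IsPoset (P R : ZFSet) : Prop :=
  (∀ p ∈ R, ∃ a ∈ P, ∃ b ∈ P, p = ZFSet.pair a b) ∧
  (∀ p ∈ P, ZFSet.pair p p ∈ R) ∧
  (∀ p ∈ P, ∀ q ∈ P, ∀ r ∈ P,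
    ZFSet.pair p q ∈ R → ZFSet.pair q r ∈ R → ZFSet.pair p r ∈ R)

/-- `G` is an `ℳ`-generic filter on the poset `(P, R)`. -/
def IsGenericFilter (ℳ P R : ZFSet) (G : Set ZFSet) : Prop :=
  G ⊆ P.toSet ∧ G.Nonempty ∧
  (∀ p ∈ G, ∀ q ∈ G, ∃ r ∈ G, ZFSet.pair r p ∈ R ∧ ZFSet.pair r q ∈ R) ∧
  (∀ p ∈ G, ∀ q ∈ P.toSet, ZFSet.pair p q ∈ R → q ∈ G) ∧
  ∀ Dset ∈ ℳ.toSet, Dset ⊆ P →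
    (∀ p ∈ P.toSet, ∃ q ∈ Dset.toSet, ZFSet.pair q p ∈ R) →
    ∃ q ∈ G, q ∈ Dset

/-- `ℳ'` is the generic extension `ℳ[G]`: the least transitive ZFC⁻-model containing `ℳ`
and (a set coding) `G`, with the same ordinals as `ℳ`. -/
def IsGenericExt (ℳ ℳ' : ZFSet) (G : Set ZFSet) : Prop :=
  IsTransModel ℳ' ∧ ℳ ⊆ ℳ' ∧ (∃ g ∈ ℳ'.toSet, g.toSet = G) ∧
  SameOrdinals ℳ.toSet ℳ'.toSet ∧
  ∀ N', IsTransModel N' → ℳ ⊆ N' → (∃ g ∈ N'.toSet, g.toSet = G) → ℳ' ⊆ N'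

/-- `f ∈ D` is a cofinal map from `γ` into the ordinal `α`. -/
def CofinalMapIn (D : Set ZFSet) (γ α f : ZFSet) : Prop :=
  f ∈ D ∧ IsZFunc γ f ∧ MapsInto f γ α ∧
  ∀ b ∈ α, ∃ a ∈ γ, b ∈ fapp f a ∨ b = fapp f a

/-- `γ` is the cofinality of the ordinal `α` as computed in `D`. -/
def IsCofIn (D : Set ZFSet) (α γ : ZFSet) : Prop :=
  IsOrd γ ∧ (∃ f, CofinalMapIn D γ α f) ∧ ∀ γ' ∈ γ, ¬ ∃ f, CofinalMapIn D γ' α f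

/-- The pair `ℳ ⊆ ℳ'` preserves all cofinalities. -/
def PreservesCofinalities (ℳ ℳ' : ZFSet) : Prop :=
  ∀ α ∈ ℳ.toSet, IsOrd α → ∀ γ, (IsCofIn ℳ.toSet α γ ↔ IsCofIn ℳ'.toSet α γ)

/-! ### Toolkit: renaming of formulas -/

universe u

set_option linter.unusedVariables false

/-- Extend an assignment by a new value at `0`. -/
def scons (x : ZFSet.{u}) (v : ℕ → ZFSet.{u}) : ℕ → ZFSet.{u}
  | 0 => x
  | n + 1 => v n

@[simp] theorem scons_zero (x : ZFSet.{u}) (v) : scons x v 0 = x := rfl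
@[simp] theorem scons_succ (x : ZFSet.{u}) (v) (n) : scons x v (n + 1) = v n := rfl

/-- a bound for the variables of a formula -/
def Fml.bd : Fml → ℕ
  | .mem i j => max i j + 1
  | .eq i j => max i j + 1
  | .impl φ ψ => max φ.bd ψ.bd
  | .neg φ => φ.bd
  | .all n φ => max (n + 1) φ.bd

theorem Sat_congr (D : Set ZFSet.{u}) (φ : Fml) : ∀ (v w : ℕ → ZFSet.{u}),
    (∀ i < φ.bd, v i = w i) → (Sat D φ v ↔ Sat D φ w) := by
  induction φ with
  | mem i j =>
    intro v w h
    simp only [Sat, Fml.bd] at *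
    rw [h i (by omega), h j (by omega)]
  | eq i j =>
    intro v w h
    simp only [Sat, Fml.bd] at *
    rw [h i (by omega), h j (by omega)]
  | impl φ ψ h1 h2 =>
    intro v w h
    simp only [Sat, Fml.bd] at *
    rw [h1 v w (fun i hi => h i (by omega)), h2 v w (fun i hi => h i (by omega))]
  | neg φ h1 =>
    intro v w h
    simp only [Sat, Fml.bd] at *
    rw [h1 v w h]
  | all n φ h1 =>
    intro v w h
    simp only [Sat, Fml.bd] at *
    refine forall_congr' fun x => forall_congr' fun _ => h1 _ _ ?_
    intro i hi
    by_cases hin : i = n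
    · subst hin; simp
    · simp [Function.update_of_ne hin, h i (by omega)]

/-- capture avoiding renaming -/
def Fml.tr : Fml → (ℕ → ℕ) → ℕ → Fml
  | .mem i j, g, _ => .mem (g i) (g j)
  | .eq i j, g, _ => .eq (g i) (g j)
  | .impl φ ψ, g, k => .impl (φ.tr g k) (ψ.tr g k)
  | .neg φ, g, k => .neg (φ.tr g k)
  | .all n φ, g, k => .all k (φ.tr (Function.update g n k) (k + 1))

theorem Sat_tr (D : Set ZFSet.{u}) (φ : Fml) : ∀ (g : ℕ → ℕ) (k : ℕ) (v : ℕ → ZFSet.{u}),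
    (∀ i < φ.bd, g i < k) → (Sat D (φ.tr g k) v ↔ Sat D φ (fun i => v (g i))) := by
  induction φ with
  | mem i j => intro g k v h; simp [Sat, Fml.tr]
  | eq i j => intro g k v h; simp [Sat, Fml.tr]
  | impl φ ψ h1 h2 =>
    intro g k v h
    simp only [Sat, Fml.tr, Fml.bd] at *
    rw [h1 g k v (fun i hi => h i (by omega)), h2 g k v (fun i hi => h i (by omega))]
  | neg φ h1 =>
    intro g k v h
    simp only [Sat, Fml.tr, Fml.bd] at *
    rw [h1 g k v h]
  | all n φ h1 =>
    intro g k v h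
    simp only [Sat, Fml.tr, Fml.bd] at *
    refine forall_congr' fun x => forall_congr' fun _ => ?_
    rw [h1]
    · apply Sat_congr
      intro i hi
      by_cases hin : i = n
      · subst hin; simp
      · have := h i (by omega)
        simp only [Function.update_of_ne hin]
        rw [Function.update_of_ne (by omega)]
    · intro i hi
      by_cases hin : i = n
      · subst hin; simp
      · have := h i (by omega)
        simp only [Function.update_of_ne hin]
        omega

theorem exists_ren (φ : Fml) (g : ℕ → ℕ) : ∃ ψ : Fml, ∀ (D : Set ZFSet.{u}) v,
    Sat D ψ v ↔ Sat D φ (fun i => v (g i)) := by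
  refine ⟨φ.tr g ((Finset.range φ.bd).sup g + 1), fun D v => Sat_tr D φ _ _ _ ?_⟩
  intro i hi
  have := Finset.le_sup (f := g) (Finset.mem_range.2 hi)
  omega

theorem exists_all (φ : Fml) : ∃ ψ : Fml, ∀ (D : Set ZFSet.{u}) v,
    Sat D ψ v ↔ ∀ x ∈ D, Sat D φ (scons x v) := by
  obtain ⟨χ, hχ⟩ := exists_ren.{u} φ (fun i => Nat.casesOn i φ.bd id)
  refine ⟨.all φ.bd χ, fun D v => ?_⟩
  simp only [Sat, hχ]
  refine forall_congr' fun x => forall_congr' fun _ => Sat_congr _ _ _ _ ?_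
  intro i hi
  cases i with
  | zero => simp
  | succ n => simp; rw [Function.update_of_ne (by omega)]

theorem exists_upd (φ : Fml) (n : ℕ) : ∃ ψ : Fml, ∀ (D : Set ZFSet.{u}) v x,
    Sat D ψ (scons x v) ↔ Sat D φ (Function.update v n x) := by
  obtain ⟨χ, hχ⟩ := exists_ren.{u} φ (fun i => if i = n then 0 else i + 1)
  refine ⟨χ, fun D v x => ?_⟩
  rw [hχ]
  apply Sat_congr
  intro i _
  by_cases hin : i = n
  · subst hin; simp
  · simp [hin]

/-- universal closure -/
theorem exists_closure (φ : Fml) : ∃ ψ : Fml, ∀ (D : Set ZFSet.{u}) (v : ℕ → ZFSet.{u}),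
    (∀ n, v n ∈ D) → (Sat D ψ v ↔ ∀ w : ℕ → ZFSet.{u}, (∀ n, w n ∈ D) → Sat D φ w) := by
  have key : ∀ k : ℕ, ∃ ψ : Fml, ∀ (D : Set ZFSet.{u}) (v : ℕ → ZFSet.{u}), (∀ n, v n ∈ D) →
      (Sat D ψ v ↔ ∀ w : ℕ → ZFSet.{u}, (∀ n, w n ∈ D) → (∀ n ≥ k, w n = v n) → Sat D φ w) := by
    intro k
    induction k with
    | zero =>
      refine ⟨φ, fun D v hv => ⟨fun h w hw hwv => ?_, fun h => h v hv (fun _ _ => rfl)⟩⟩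
      have : w = v := funext fun n => hwv n (Nat.zero_le _)
      rwa [this]
    | succ k ih =>
      obtain ⟨ψ, hψ⟩ := ih
      refine ⟨.all k ψ, fun D v hv => ?_⟩
      have hu : ∀ x ∈ D, ∀ n, Function.update v k x n ∈ D := by
        intro x hx n
        by_cases h : n = k
        · subst h; simpa using hx
        · simpa [Function.update_of_ne h] using hv n
      simp only [Sat]
      constructor
      · intro h w hw hwv
        refine (hψ D _ (hu (w k) (hw k))).1 (h (w k) (hw k)) w hw ?_
        intro n hn
        by_cases hnk : n = k
        · subst hnk; simp
        · rw [Function.update_of_ne hnk]; exact hwv n (by omega)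
      · intro h x hx
        refine (hψ D _ (hu x hx)).2 fun w hw hwv => h w hw fun n hn => ?_
        rw [hwv n (by omega), Function.update_of_ne (by omega)]
  obtain ⟨ψ, hψ⟩ := key φ.bd
  refine ⟨ψ, fun D v hv => (hψ D v hv).trans ⟨fun h w hw => ?_, fun h w hw _ => h w hw⟩⟩
  have := h (fun n => if n < φ.bd then w n else v n) (fun n => by
    by_cases h : n < φ.bd <;> simp only [h, if_true, if_false]
    exacts [hw n, hv n]) (fun n hn => by simp; omega)
  refine (Sat_congr D φ _ _ ?_).1 this
  intro i hi; simp [hi]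

/-! ### Definable predicates and terms -/

/-- transitive models of pairing, union, separation, collection, infinity -/
structure TM0 (M : ZFSet.{u}) : Prop where
  trans : M.IsTransitive
  omega_mem : ZFSet.omega ∈ M
  pair' : ∀ x ∈ M, ∀ y ∈ M, ({x, y} : ZFSet) ∈ M
  sUnion' : ∀ x ∈ M, (⋃₀ x : ZFSet) ∈ M
  sep' : ∀ (φ : Fml) (v : ℕ → ZFSet.{u}), (∀ n, v n ∈ M) → ∀ a ∈ M,
    ∃ b ∈ M, ∀ x, x ∈ b ↔ x ∈ a ∧ Sat M.toSet φ (Function.update v 0 x)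
  coll' : ∀ (φ : Fml) (v : ℕ → ZFSet.{u}), (∀ n, v n ∈ M) → ∀ a ∈ M,
    (∀ x ∈ a, ∃ y ∈ M, Sat M.toSet φ (Function.update (Function.update v 0 x) 1 y)) →
    ∃ b ∈ M, ∀ x ∈ a, ∃ y ∈ b, Sat M.toSet φ (Function.update (Function.update v 0 x) 1 y)

theorem IsTransModel.tm0 {M : ZFSet.{u}} (h : IsTransModel M) : TM0 M :=
  ⟨h.1, h.2.1, h.2.2.1, h.2.2.2.1, h.2.2.2.2.1, h.2.2.2.2.2.1⟩

/-- uniformly definable predicates -/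
class Dfn (K : ZFSet.{u} → Prop) (P : ZFSet.{u} → (ℕ → ZFSet.{u}) → Prop) : Prop where
  out : ∃ φ : Fml, ∀ M, K M → ∀ v : ℕ → ZFSet.{u}, (∀ n, v n ∈ M) →
    (Sat M.toSet φ v ↔ P M v)

/-- uniformly definable terms -/
class DT (K : ZFSet.{u} → Prop) (t : (ℕ → ZFSet.{u}) → ZFSet.{u}) : Prop where
  cl : ∀ M, K M → ∀ v : ℕ → ZFSet.{u}, (∀ n, v n ∈ M) → t v ∈ M
  mem : Dfn K (fun _ v => v 0 ∈ t (fun n => v (n + 1)))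

/-- every class of models we use is transitive -/
class KTr (K : ZFSet.{u} → Prop) : Prop where
  tr : ∀ M, K M → M.IsTransitive

instance : KTr TM0.{u} := ⟨fun _ h => h.trans⟩
instance : KTr (fun M : ZFSet.{u} => M.IsTransitive) := ⟨fun _ h => h⟩

section dfn
variable {K : ZFSet.{u} → Prop} {P Q : ZFSet.{u} → (ℕ → ZFSet.{u}) → Prop}
  {s t r : (ℕ → ZFSet.{u}) → ZFSet.{u}}

theorem Dfn.congr (h : Dfn K P)
    (hPQ : ∀ M, K M → ∀ v : ℕ → ZFSet.{u}, (∀ n, v n ∈ M) → (P M v ↔ Q M v)) : Dfn K Q := by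
  obtain ⟨φ, hφ⟩ := h.out
  exact ⟨φ, fun M hM v hv => (hφ M hM v hv).trans (hPQ M hM v hv)⟩

theorem Dfn.ren (h : Dfn K P) (g : ℕ → ℕ) : Dfn K (fun M v => P M (fun n => v (g n))) := by
  obtain ⟨φ, hφ⟩ := h.out
  obtain ⟨ψ, hψ⟩ := exists_ren.{u} φ g
  exact ⟨ψ, fun M hM v hv => (hψ _ v).trans (hφ M hM _ fun n => hv _)⟩

instance Dfn.impl [h1 : Dfn K P] [h2 : Dfn K Q] : Dfn K (fun M v => P M v → Q M v) := by
  obtain ⟨φ, hφ⟩ := h1.out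
  obtain ⟨ψ, hψ⟩ := h2.out
  exact ⟨.impl φ ψ, fun M hM v hv => by simp only [Sat, hφ M hM v hv, hψ M hM v hv]⟩

instance Dfn.neg [h1 : Dfn K P] : Dfn K (fun M v => ¬ P M v) := by
  obtain ⟨φ, hφ⟩ := h1.out
  exact ⟨.neg φ, fun M hM v hv => by simp only [Sat, hφ M hM v hv]⟩

instance Dfn.true : Dfn K (fun _ _ => True) :=
  ⟨.eq 0 0, fun M hM v hv => by simp [Sat]⟩

instance Dfn.and [h1 : Dfn K P] [h2 : Dfn K Q] : Dfn K (fun M v => P M v ∧ Q M v) :=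
  Dfn.congr (P := fun M v => ¬ (P M v → ¬ Q M v)) inferInstance (fun M _ v _ => by tauto)

instance Dfn.or [h1 : Dfn K P] [h2 : Dfn K Q] : Dfn K (fun M v => P M v ∨ Q M v) :=
  Dfn.congr (P := fun M v => (¬ P M v → Q M v)) inferInstance (fun M _ v _ => by tauto)

instance Dfn.iff [h1 : Dfn K P] [h2 : Dfn K Q] : Dfn K (fun M v => P M v ↔ Q M v) :=
  Dfn.congr (P := fun M v => (P M v → Q M v) ∧ (Q M v → P M v)) inferInstance
    (fun M _ v _ => by tauto)

instance Dfn.all {P : ZFSet.{u} → (ℕ → ZFSet.{u}) → ZFSet.{u} → Prop}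
    [h : Dfn K (fun M v => P M (fun n => v (n + 1)) (v 0))] :
    Dfn K (fun M v => ∀ x ∈ M, P M v x) := by
  obtain ⟨φ, hφ⟩ := h.out
  obtain ⟨ψ, hψ⟩ := exists_all.{u} φ
  refine ⟨ψ, fun M hM v hv => (hψ _ v).trans ?_⟩
  refine forall_congr' fun x => forall_congr' fun hx => ?_
  refine (hφ M hM (scons x v) ?_).trans ?_
  · rintro (_ | n)
    exacts [hx, hv n]
  · rfl

instance Dfn.ex {P : ZFSet.{u} → (ℕ → ZFSet.{u}) → ZFSet.{u} → Prop}
    [h : Dfn K (fun M v => P M (fun n => v (n + 1)) (v 0))] :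
    Dfn K (fun M v => ∃ x ∈ M, P M v x) :=
  Dfn.congr (P := fun M v => ¬ ∀ x ∈ M, ¬ P M v x) inferInstance (fun M _ v _ => by
    push Not; rfl)

theorem Dfn.mem_var (i j : ℕ) : Dfn K (fun _ v => v i ∈ v j) :=
  ⟨.mem i j, fun M hM v hv => by simp [Sat]⟩

theorem Dfn.eq_var (i j : ℕ) : Dfn K (fun _ v => v i = v j) :=
  ⟨.eq i j, fun M hM v hv => by simp [Sat]⟩

instance DT.var (i : ℕ) : DT K (fun v => v i) :=
  ⟨fun _ _ _ hv => hv i, Dfn.mem_var 0 (i + 1)⟩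

theorem DT.ren (h : DT K t) (g : ℕ → ℕ) : DT K (fun v => t (fun n => v (g n))) :=
  ⟨fun M hM v hv => h.cl M hM _ fun n => hv _,
   (h.mem.ren (fun n => Nat.casesOn n 0 (fun m => g m + 1))).congr fun M _ v _ => Iff.rfl⟩

/-- substitution of a term in a predicate -/
theorem Dfn.subst [KTr K] {P : ZFSet.{u} → (ℕ → ZFSet.{u}) → ZFSet.{u} → Prop} (ht : DT K t)
    (hP : Dfn K (fun M v => P M (fun n => v (n + 1)) (v 0))) :
    Dfn K (fun M v => P M v (t v)) := by
  have h1 : Dfn K (fun M v => v 0 ∈ t (fun n => v (n + 1 + 1))) :=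
    (ht.mem.ren (fun n => Nat.casesOn n 0 (fun m => m + 2))).congr fun M _ v _ => Iff.rfl
  have h2 : Dfn K (fun M v => v 0 ∈ v 1) := Dfn.mem_var 0 1
  have h3 : Dfn K (fun M v => ∀ y ∈ M, y ∈ v 0 ↔ y ∈ t (fun n => v (n + 1))) := by
    infer_instance
  refine Dfn.congr (P := fun M v => ∃ x ∈ M, (∀ y ∈ M, y ∈ x ↔ y ∈ t v) ∧ P M v x)
    inferInstance ?_
  intro M hM v hv
  have hc := ht.cl M hM v hv
  have htr := KTr.tr M hM
  constructor
  · rintro ⟨x, hx, hxy, hp⟩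
    have : x = t v := by
      ext y
      exact ⟨fun h => (hxy y (htr.mem_trans h hx)).1 h, fun h => (hxy y (htr.mem_trans h hc)).2 h⟩
    rwa [← this]
  · intro h
    exact ⟨_, hc, fun _ _ => Iff.rfl, h⟩

instance Dfn.mem [KTr K] [hs : DT K s] [ht : DT K t] : Dfn K (fun _ v => s v ∈ t v) :=
  Dfn.subst (P := fun _ v x => x ∈ t v) hs ht.mem

instance Dfn.eq [KTr K] [hs : DT K s] [ht : DT K t] : Dfn K (fun _ v => s v = t v) :=
  Dfn.subst (P := fun _ v x => x = t v) hs
    (Dfn.subst (t := fun v => t (fun n => v (n + 1))) (P := fun _ v x => v 0 = x) (ht.ren _)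
      (Dfn.eq_var 1 0))

instance Dfn.ball [KTr K] [ht : DT K t] {P : ZFSet.{u} → (ℕ → ZFSet.{u}) → ZFSet.{u} → Prop}
    [h : Dfn K (fun M v => P M (fun n => v (n + 1)) (v 0))] :
    Dfn K (fun M v => ∀ x ∈ t v, P M v x) := by
  have := ht.ren (fun n => n + 1)
  refine Dfn.congr (P := fun M v => ∀ x ∈ M, x ∈ t v → P M v x) inferInstance ?_
  intro M hM v hv
  exact ⟨fun h x hx => h x ((KTr.tr M hM).mem_trans hx (ht.cl M hM v hv)) hx,
    fun h x _ hx => h x hx⟩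

instance Dfn.bex [KTr K] [ht : DT K t] {P : ZFSet.{u} → (ℕ → ZFSet.{u}) → ZFSet.{u} → Prop}
    [h : Dfn K (fun M v => P M (fun n => v (n + 1)) (v 0))] :
    Dfn K (fun M v => ∃ x ∈ t v, P M v x) := by
  refine Dfn.congr (P := fun M v => ¬ ∀ x ∈ t v, ¬ P M v x) inferInstance ?_
  intro M hM v hv
  push Not; rfl

instance Dfn.subset [KTr K] [hs : DT K s] [ht : DT K t] : Dfn K (fun _ v => s v ⊆ t v) := by
  have := ht.ren (fun n => n + 1)
  exact Dfn.congr (P := fun M v => ∀ x ∈ s v, x ∈ t v) inferInstance fun M hM v hv => Iff.rfl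

/-- satisfaction in `M` of a formula under term assignments -/
theorem Dfn.sat [KTr K] (φ : Fml) : ∀ (t : ℕ → (ℕ → ZFSet.{u}) → ZFSet.{u}), (∀ i, DT K (t i)) →
    Dfn K (fun M v => Sat M.toSet φ (fun i => t i v)) := by
  induction φ with
  | mem i j => intro t ht; have := ht i; have := ht j; simp only [Sat]; infer_instance
  | eq i j => intro t ht; have := ht i; have := ht j; simp only [Sat]; infer_instance
  | impl φ ψ h1 h2 => intro t ht; have := h1 t ht; have := h2 t ht; simp only [Sat]; infer_instance
  | neg φ h1 => intro t ht; have := h1 t ht; simp only [Sat]; infer_instance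
  | all n φ h1 =>
    intro t ht
    have := h1 (fun i v => if i = n then v 0 else t i (fun m => v (m + 1))) (fun i => by
      by_cases h : i = n
      · simp only [h, if_true]; infer_instance
      · simp only [h, if_false]; exact (ht i).ren _)
    have h2 : Dfn K (fun M v => ∀ x ∈ M,
        Sat M.toSet φ (fun i => if i = n then x else t i v)) := inferInstance
    refine h2.congr fun M hM v hv => ?_
    simp only [Sat]
    refine forall_congr' fun x => forall_congr' fun hx => Sat_congr _ _ _ _ fun i _ => ?_
    by_cases h : i = n
    · subst h; simp
    · simp [h]

theorem Dfn.transfer (h : Dfn K P) {M N : ZFSet.{u}} (hM : K M) (hN : K N) {j : ZFSet → ZFSet}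
    (hj : ∀ x ∈ M, j x ∈ N)
    (he : ∀ (φ : Fml) (v : ℕ → ZFSet.{u}), (∀ n, v n ∈ M) →
      (Sat M.toSet φ v ↔ Sat N.toSet φ (fun n => j (v n))))
    (v : ℕ → ZFSet.{u}) (hv : ∀ n, v n ∈ M) : P M v ↔ P N (fun n => j (v n)) := by
  obtain ⟨φ, hφ⟩ := h.out
  rw [← hφ M hM v hv, he φ v hv, hφ N hN _ fun n => hj _ (hv n)]

end dfn

section comp
variable {K : ZFSet.{u} → Prop} {s t r q : (ℕ → ZFSet.{u}) → ZFSet.{u}}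

theorem Dfn.comp [KTr K] {P : ZFSet.{u} → (ℕ → ZFSet.{u}) → Prop} (h : Dfn K P)
    (t : ℕ → (ℕ → ZFSet.{u}) → ZFSet.{u}) (ht : ∀ i, DT K (t i)) :
    Dfn K (fun M v => P M (fun i => t i v)) := by
  obtain ⟨φ, hφ⟩ := h.out
  exact (Dfn.sat φ t ht).congr fun M hM v hv => hφ M hM _ fun n => (ht n).cl M hM v hv

theorem DT.comp [KTr K] (h : DT K s)
    (t : ℕ → (ℕ → ZFSet.{u}) → ZFSet.{u}) (ht : ∀ i, DT K (t i)) :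
    DT K (fun v => s (fun i => t i v)) := by
  refine ⟨fun M hM v hv => h.cl M hM _ fun n => (ht n).cl M hM v hv, ?_⟩
  refine (h.mem.comp (fun i => Nat.casesOn i (fun v => v 0) (fun n v => t n (fun m => v (m + 1))))
    ?_).congr fun _ _ _ _ => Iff.rfl
  rintro (_ | n)
  · exact DT.var 0
  · exact (ht n).ren _

/-- a list of terms padded with variables -/
def tl (l : List ((ℕ → ZFSet.{u}) → ZFSet.{u})) : ℕ → (ℕ → ZFSet.{u}) → ZFSet.{u} :=
  fun i => l.getD i (fun v => v i)

theorem tl_nil (i : ℕ) : DT K (tl.{u} [] i) := by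
  simp only [tl, List.getD_nil]; exact DT.var i

theorem tl_cons {l : List ((ℕ → ZFSet.{u}) → ZFSet.{u})}
    (h : ∀ (l') (_ : l' ∈ l), DT K l') (i : ℕ) : DT K (tl l i) := by
  unfold tl
  by_cases hi : i < l.length
  · rw [List.getD_eq_getElem _ _ hi]; exact h _ (List.getElem_mem hi)
  · rw [List.getD_eq_default _ _ (by omega)]; exact DT.var i

theorem Dfn.c1 [KTr K] {P : ZFSet.{u} → ZFSet.{u} → Prop}
    (h : Dfn K (fun M v => P M (v 0))) [h1 : DT K s] : Dfn K (fun M v => P M (s v)) :=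
  h.comp (tl [s]) (tl_cons (by simp; exact h1))

theorem Dfn.c2 [KTr K] {P : ZFSet.{u} → ZFSet.{u} → ZFSet.{u} → Prop}
    (h : Dfn K (fun M v => P M (v 0) (v 1))) [h1 : DT K s] [h2 : DT K t] :
    Dfn K (fun M v => P M (s v) (t v)) :=
  h.comp (tl [s, t]) (tl_cons (by simp; exact ⟨h1, h2⟩))

theorem Dfn.c3 [KTr K] {P : ZFSet.{u} → ZFSet.{u} → ZFSet.{u} → ZFSet.{u} → Prop}
    (h : Dfn K (fun M v => P M (v 0) (v 1) (v 2))) [h1 : DT K s] [h2 : DT K t] [h3 : DT K r] :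
    Dfn K (fun M v => P M (s v) (t v) (r v)) :=
  h.comp (tl [s, t, r]) (tl_cons (by simp; exact ⟨h1, h2, h3⟩))

theorem Dfn.c4 [KTr K] {P : ZFSet.{u} → ZFSet.{u} → ZFSet.{u} → ZFSet.{u} → ZFSet.{u} → Prop}
    (h : Dfn K (fun M v => P M (v 0) (v 1) (v 2) (v 3))) [h1 : DT K s] [h2 : DT K t] [h3 : DT K r]
    [h4 : DT K q] : Dfn K (fun M v => P M (s v) (t v) (r v) (q v)) :=
  h.comp (tl [s, t, r, q]) (tl_cons (by simp; exact ⟨h1, h2, h3, h4⟩))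

theorem DT.c1 [KTr K] {P : ZFSet.{u} → ZFSet.{u}}
    (h : DT K (fun v => P (v 0))) [h1 : DT K s] : DT K (fun v => P (s v)) :=
  h.comp (tl [s]) (tl_cons (by simp; exact h1))

theorem DT.c2 [KTr K] {P : ZFSet.{u} → ZFSet.{u} → ZFSet.{u}}
    (h : DT K (fun v => P (v 0) (v 1))) [h1 : DT K s] [h2 : DT K t] :
    DT K (fun v => P (s v) (t v)) :=
  h.comp (tl [s, t]) (tl_cons (by simp; exact ⟨h1, h2⟩))

theorem DT.c3 [KTr K] {P : ZFSet.{u} → ZFSet.{u} → ZFSet.{u} → ZFSet.{u}}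
    (h : DT K (fun v => P (v 0) (v 1) (v 2))) [h1 : DT K s] [h2 : DT K t] [h3 : DT K r] :
    DT K (fun v => P (s v) (t v) (r v)) :=
  h.comp (tl [s, t, r]) (tl_cons (by simp; exact ⟨h1, h2, h3⟩))

theorem DT.c4 [KTr K] {P : ZFSet.{u} → ZFSet.{u} → ZFSet.{u} → ZFSet.{u} → ZFSet.{u}}
    (h : DT K (fun v => P (v 0) (v 1) (v 2) (v 3))) [h1 : DT K s] [h2 : DT K t] [h3 : DT K r]
    [h4 : DT K q] : DT K (fun v => P (s v) (t v) (r v) (q v)) :=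
  h.comp (tl [s, t, r, q]) (tl_cons (by simp; exact ⟨h1, h2, h3, h4⟩))

end comp


/-! ### Terms in `TM0` models -/

theorem exists_mem_toSet {M : ZFSet.{u}} {p : ZFSet.{u} → Prop} :
    (∃ x ∈ M.toSet, p x) ↔ ∃ x ∈ M, p x := Iff.rfl

/-- replacement image -/
def zimg (a : ZFSet.{u}) (F : ZFSet.{u} → ZFSet.{u}) : ZFSet.{u} :=
  ZFSet.range (fun x : a => F x.1)

@[simp] theorem mem_zimg {a y : ZFSet.{u}} {F} : y ∈ zimg a F ↔ ∃ x ∈ a, y = F x := by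
  simp only [zimg, ZFSet.mem_range]
  constructor
  · rintro ⟨⟨x, hx⟩, h⟩; exact ⟨x, hx, h.symm⟩
  · rintro ⟨x, hx, h⟩; exact ⟨⟨x, hx⟩, h.symm⟩

/-- set-coded function -/
def lam (a : ZFSet.{u}) (F : ZFSet.{u} → ZFSet.{u}) : ZFSet.{u} := zimg a (fun x => pair x (F x))

theorem mem_lam {a p : ZFSet.{u}} {F} : p ∈ lam a F ↔ ∃ x ∈ a, p = pair x (F x) := mem_zimg

@[simp] theorem pair_mem_lam {a x y : ZFSet.{u}} {F} : pair x y ∈ lam a F ↔ x ∈ a ∧ y = F x := by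
  simp only [mem_lam, pair_inj]
  constructor
  · rintro ⟨z, hz, rfl, rfl⟩; exact ⟨hz, rfl⟩
  · rintro ⟨h, rfl⟩; exact ⟨x, h, rfl, rfl⟩

/-- cartesian product -/
def zprod (a b : ZFSet.{u}) : ZFSet.{u} := ⋃₀ (zimg a (fun x => zimg b (fun y => pair x y)))

@[simp] theorem mem_zprod {a b p : ZFSet.{u}} :
    p ∈ zprod a b ↔ ∃ x ∈ a, ∃ y ∈ b, p = pair x y := by
  simp only [zprod, mem_sUnion, mem_zimg]
  constructor
  · rintro ⟨z, ⟨x, hx, rfl⟩, h⟩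
    exact ⟨x, hx, mem_zimg.1 h⟩
  · rintro ⟨x, hx, h⟩
    exact ⟨_, ⟨x, hx, rfl⟩, mem_zimg.2 h⟩

theorem pair_mem_field {x y f : ZFSet.{u}} (h : pair x y ∈ f) : x ∈ ⋃₀ ⋃₀ f ∧ y ∈ ⋃₀ ⋃₀ f := by
  have h1 : ({x, y} : ZFSet) ∈ ⋃₀ f := mem_sUnion.2 ⟨_, h, by simp [pair]⟩
  exact ⟨mem_sUnion.2 ⟨_, h1, by simp⟩, mem_sUnion.2 ⟨_, h1, by simp⟩⟩

theorem fapp_eq {f x y : ZFSet.{u}} (h : pair x y ∈ f) (hu : ∀ z, pair x z ∈ f → z = y) :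
    fapp f x = y := by
  have : ZFSet.sep (fun b => pair x b ∈ f) (⋃₀ (⋃₀ f)) = {y} := by
    ext z
    simp only [mem_sep, mem_singleton]
    exact ⟨fun hz => hu z hz.2, fun hz => by subst hz; exact ⟨(pair_mem_field h).2, h⟩⟩
  rw [fapp, this, sUnion_singleton]

theorem IsZFunc.pair_mem {d f x : ZFSet.{u}} (h : IsZFunc d f) (hx : x ∈ d) :
    pair x (fapp f x) ∈ f := by
  obtain ⟨y, hy, hu⟩ := h.2 x hx
  rwa [fapp_eq hy hu]

theorem IsZFunc.fapp_eq {d f x y : ZFSet.{u}} (h : IsZFunc d f) (hx : pair x y ∈ f) :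
    x ∈ d ∧ fapp f x = y := by
  obtain ⟨a, ha, b, hb⟩ := h.1 _ hx
  obtain ⟨rfl, rfl⟩ := pair_inj.1 hb
  obtain ⟨z, hz, hu⟩ := h.2 x ha
  exact ⟨ha, MPaper.fapp_eq hx fun w hw => (hu w hw).trans (hu _ hx).symm⟩

theorem IsZFunc.eq_lam {d f : ZFSet.{u}} (h : IsZFunc d f) : f = lam d (fapp f) := by
  ext p
  rw [mem_lam]
  constructor
  · intro hp
    obtain ⟨a, ha, b, rfl⟩ := h.1 _ hp
    exact ⟨a, ha, by rw [(h.fapp_eq hp).2]⟩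
  · rintro ⟨x, hx, rfl⟩; exact h.pair_mem hx

theorem isZFunc_lam (a : ZFSet.{u}) (F) : IsZFunc a (lam a F) := by
  constructor
  · intro p hp
    obtain ⟨x, hx, rfl⟩ := mem_lam.1 hp
    exact ⟨x, hx, _, rfl⟩
  · intro x hx
    exact ⟨F x, by simp [hx], by simp⟩

@[simp] theorem fapp_lam {a x : ZFSet.{u}} {F} (hx : x ∈ a) : fapp (lam a F) x = F x :=
  fapp_eq (by simp [hx]) (by simp)

theorem lam_congr {a : ZFSet.{u}} {F G : ZFSet.{u} → ZFSet.{u}} (h : ∀ x ∈ a, F x = G x) :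
    lam a F = lam a G := by
  ext p; simp only [mem_lam]
  constructor <;> rintro ⟨x, hx, rfl⟩ <;> exact ⟨x, hx, by rw [h x hx]⟩

theorem IsZFunc.ext {d f g : ZFSet.{u}} (hf : IsZFunc d f) (hg : IsZFunc d g)
    (h : ∀ x ∈ d, fapp f x = fapp g x) : f = g := by
  rw [hf.eq_lam, hg.eq_lam, lam_congr h]

theorem isZFunc_iff {d f : ZFSet.{u}} : IsZFunc d f ↔
    (∀ p ∈ f, ∃ a ∈ d, ∃ b ∈ ⋃₀ ⋃₀ f, p = pair a b) ∧
    ∀ a ∈ d, ∃ b ∈ ⋃₀ ⋃₀ f, pair a b ∈ f ∧ ∀ c ∈ ⋃₀ ⋃₀ f, pair a c ∈ f → c = b := by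
  constructor
  · intro h
    refine ⟨fun p hp => ?_, fun a ha => ?_⟩
    · obtain ⟨a, ha, b, rfl⟩ := h.1 p hp
      exact ⟨a, ha, b, (pair_mem_field hp).2, rfl⟩
    · obtain ⟨b, hb, hu⟩ := h.2 a ha
      exact ⟨b, (pair_mem_field hb).2, hb, fun c _ hc => hu c hc⟩
  · intro h
    refine ⟨fun p hp => ?_, fun a ha => ?_⟩
    · obtain ⟨a, ha, b, _, rfl⟩ := h.1 p hp
      exact ⟨a, ha, b, rfl⟩
    · obtain ⟨b, _, hb, hu⟩ := h.2 a ha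
      exact ⟨b, hb, fun c hc => hu c (pair_mem_field hc).2 hc⟩

/-- range of a set-coded function -/
def ran (f : ZFSet.{u}) : ZFSet.{u} := ZFSet.sep (fun y => ∃ x ∈ ⋃₀ ⋃₀ f, pair x y ∈ f) (⋃₀ ⋃₀ f)

theorem mem_ran' {f y : ZFSet.{u}} : y ∈ ran f ↔ ∃ x, pair x y ∈ f := by
  simp only [ran, mem_sep]
  constructor
  · rintro ⟨_, x, _, h⟩; exact ⟨x, h⟩
  · rintro ⟨x, h⟩; exact ⟨(pair_mem_field h).2, x, (pair_mem_field h).1, h⟩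

theorem IsZFunc.mem_ran {d f y : ZFSet.{u}} (h : IsZFunc d f) :
    y ∈ ran f ↔ ∃ x ∈ d, y = fapp f x := by
  rw [mem_ran']
  constructor
  · rintro ⟨x, hx⟩; exact ⟨x, (h.fapp_eq hx).1, (h.fapp_eq hx).2.symm⟩
  · rintro ⟨x, hx, rfl⟩; exact ⟨x, h.pair_mem hx⟩

@[simp] theorem mem_ran_lam {a y : ZFSet.{u}} {F} : y ∈ ran (lam a F) ↔ ∃ x ∈ a, y = F x := by
  simp [mem_ran']

/-- restriction -/
def restr (f d : ZFSet.{u}) : ZFSet.{u} :=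
  ZFSet.sep (fun p => ∃ x ∈ d, ∃ y ∈ ⋃₀ ⋃₀ f, p = pair x y) f

@[simp] theorem pair_mem_restr {f d x y : ZFSet.{u}} :
    pair x y ∈ restr f d ↔ x ∈ d ∧ pair x y ∈ f := by
  simp only [restr, mem_sep, pair_inj]
  constructor
  · rintro ⟨h, a, ha, b, hb, rfl, rfl⟩; exact ⟨ha, h⟩
  · rintro ⟨h1, h2⟩; exact ⟨h2, x, h1, y, (pair_mem_field h2).2, rfl, rfl⟩

theorem mem_omega_iff {y : ZFSet.{u}} : y ∈ omega.{u} ↔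
    ∀ x ∈ (insert y y : ZFSet.{u}), x = ∅ ∨ ∃ z ∈ x, x = insert z z := by
  constructor
  · intro hy
    have h2 : ∀ n : ℕ, ∀ x ∈ (insert (mk (PSet.ofNat n)) (mk (PSet.ofNat n)) : ZFSet.{u}),
        x = ∅ ∨ ∃ z ∈ x, x = insert z z := by
      intro n
      induction n with
      | zero =>
        intro x hx
        rw [mem_insert_iff] at hx
        rcases hx with rfl | hx
        · left; rfl
        · exact absurd hx (notMem_empty x)
      | succ n ih =>
        intro x hx
        have hs : (mk (PSet.ofNat (n + 1)) : ZFSet.{u}) =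
          insert (mk (PSet.ofNat n)) (mk (PSet.ofNat n)) := rfl
        rw [mem_insert_iff] at hx
        rcases hx with rfl | hx
        · right; exact ⟨mk (PSet.ofNat n), by rw [hs]; simp, hs⟩
        · exact ih x (by rwa [hs] at hx)
    obtain ⟨n, hn⟩ : ∃ n : ℕ, y = mk (PSet.ofNat n) := by
      induction y using Quotient.inductionOn with
      | _ p =>
        obtain ⟨⟨n⟩, hn⟩ := (hy : p ∈ PSet.omega)
        exact ⟨n, ZFSet.sound hn⟩
    rw [hn]; exact h2 n
  · induction y using ZFSet.inductionOn with
    | _ y ih =>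
      intro h
      rcases h y (by simp) with h0 | ⟨z, hz, hyz⟩
      · rw [h0]; exact omega_zero
      · rw [hyz]
        refine omega_succ (ih z hz fun x hx => h x ?_)
        rw [mem_insert_iff, hyz]
        right; exact hx

theorem omega_induction {p : ZFSet.{u} → Prop} (h0 : p ∅)
    (hs : ∀ n ∈ omega.{u}, p n → p (insert n n)) : ∀ n ∈ omega.{u}, p n := by
  intro n
  induction n using ZFSet.inductionOn with
  | _ n ih =>
    intro hn
    rcases mem_omega_iff.1 hn n (by simp) with h | ⟨z, hz, h⟩
    · rw [h]; exact h0
    · have hzo : z ∈ omega := mem_omega_iff.2 fun x hx =>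
        mem_omega_iff.1 hn x (by rw [mem_insert_iff, h]; right; exact hx)
      rw [h]; exact hs z hzo (ih z hz hzo)

theorem omega_pred {n : ZFSet.{u}} (hn : n ∈ omega.{u}) :
    n = ∅ ∨ ∃ m ∈ omega, n = insert m m := by
  exact omega_induction (p := fun n => n = ∅ ∨ ∃ m ∈ omega, n = insert m m) (.inl rfl)
    (fun n hn _ => .inr ⟨n, hn, rfl⟩) n hn

/-! schemas for definable predicates -/

theorem sep_mem {M : ZFSet.{u}} (hM : TM0 M) (P : ZFSet.{u} → (ℕ → ZFSet.{u}) → Prop)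
    [h : Dfn TM0 P] {a : ZFSet.{u}} (ha : a ∈ M) (v : ℕ → ZFSet.{u}) (hv : ∀ n, v n ∈ M) :
    ZFSet.sep (fun x => P M (scons x v)) a ∈ M := by
  obtain ⟨φ, hφ⟩ := h.out
  obtain ⟨b, hb, hx⟩ := hM.sep' φ (scons a v) (by rintro (_ | n); exacts [ha, hv n]) a ha
  have : ZFSet.sep (fun x => P M (scons x v)) a = b := by
    ext x
    rw [mem_sep, hx]
    refine and_congr_right fun hxa => ?_
    have hxM := hM.trans.mem_trans hxa ha
    rw [← hφ M hM (scons x v) (by rintro (_ | n); exacts [hxM, hv n])]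
    apply Sat_congr
    rintro (_ | n) _ <;> simp
  rwa [this]

theorem coll_mem {M : ZFSet.{u}} (hM : TM0 M) (P : ZFSet.{u} → (ℕ → ZFSet.{u}) → Prop)
    [h : Dfn TM0 P] {a : ZFSet.{u}} (ha : a ∈ M) (v : ℕ → ZFSet.{u}) (hv : ∀ n, v n ∈ M)
    (hc : ∀ x ∈ a, ∃ y ∈ M, P M (scons x (scons y v))) :
    ∃ b ∈ M, ∀ x ∈ a, ∃ y ∈ b, P M (scons x (scons y v)) := by
  obtain ⟨φ, hφ⟩ := h.out
  have key : ∀ x ∈ a, ∀ y ∈ M, (P M (scons x (scons y v)) ↔ Sat M.toSet φ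
      (Function.update (Function.update (scons a (scons a v)) 0 x) 1 y)) := by
    intro x hx y hy
    rw [← hφ M hM (scons x (scons y v)) (by
      rintro (_ | _ | n); exacts [hM.trans.mem_trans hx ha, hy, hv n])]
    apply Sat_congr
    rintro (_ | _ | n) _
    · rfl
    · rfl
    · simp
  obtain ⟨b, hb, hx⟩ := hM.coll' φ (scons a (scons a v))
    (by rintro (_ | _ | n); exacts [ha, ha, hv n]) a ha (fun x hx => by
      obtain ⟨y, hy, hp⟩ := hc x hx
      exact ⟨y, hy, (key x hx y hy).1 hp⟩)
  refine ⟨b, hb, fun x hxa => ?_⟩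
  obtain ⟨y, hy, hp⟩ := hx x hxa
  exact ⟨y, hy, (key x hxa y (hM.trans.mem_trans hy hb)).2 hp⟩

section terms
variable {s t r : (ℕ → ZFSet.{u}) → ZFSet.{u}}

instance dt_sep [hs : DT TM0 s] {P : (ℕ → ZFSet.{u}) → ZFSet.{u} → Prop}
    [h : Dfn TM0 (fun _ v => P (fun n => v (n + 1)) (v 0))] :
    DT TM0 (fun v => ZFSet.sep (fun x => P v x) (s v)) := by
  refine ⟨fun M hM v hv => sep_mem hM (fun _ v => P (fun n => v (n + 1)) (v 0))
    (hs.cl M hM v hv) v hv, ?_⟩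
  have h1 := hs.mem
  exact Dfn.congr (P := fun M v => v 0 ∈ s (fun n => v (n + 1)) ∧ P (fun n => v (n + 1)) (v 0))
    inferInstance fun M hM v hv => by rw [mem_sep]

theorem TM0.singleton {M : ZFSet.{u}} (hM : TM0 M) {x : ZFSet.{u}} (hx : x ∈ M) :
    ({x} : ZFSet) ∈ M := by
  have := hM.pair' x hx x hx
  rwa [pair_eq_singleton] at this

instance dt_empty : DT TM0 (fun _ => (∅ : ZFSet.{u})) :=
  ⟨fun M hM v hv => hM.trans.mem_trans omega_zero hM.omega_mem,
   Dfn.congr (P := fun M v => ¬ True) inferInstance fun M hM v hv => by simp⟩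

instance dt_sUnion [hs : DT TM0 s] : DT TM0 (fun v => (⋃₀ (s v) : ZFSet)) := by
  refine DT.c1 (P := fun a => (⋃₀ a : ZFSet)) ?_
  exact ⟨fun M hM v hv => hM.sUnion' _ (hv 0), Dfn.congr (P := fun M v => ∃ z ∈ v 1, v 0 ∈ z)
    inferInstance fun M hM v hv => by rw [mem_sUnion]⟩

instance dt_singleton [hs : DT TM0 s] : DT TM0 (fun v => ({s v} : ZFSet)) := by
  refine DT.c1 (P := fun a => ({a} : ZFSet)) ?_
  exact ⟨fun M hM v hv => hM.singleton (hv 0), Dfn.congr (P := fun M v => v 0 = v 1)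
    inferInstance fun M hM v hv => by rw [mem_singleton]⟩

instance dt_union [hs : DT TM0 s] [ht : DT TM0 t] : DT TM0 (fun v => s v ∪ t v) := by
  refine DT.c2 (P := fun a b => a ∪ b) ?_
  exact ⟨fun M hM v hv => hM.sUnion' _ (hM.pair' _ (hv 0) _ (hv 1)),
    Dfn.congr (P := fun M v => v 0 ∈ v 1 ∨ v 0 ∈ v 2)
    inferInstance fun M hM v hv => by rw [mem_union]⟩

instance dt_insert_inst [hs : DT TM0 s] [ht : DT TM0 t] :
    DT TM0 (fun v => (insert (s v) (t v) : ZFSet)) := by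
  simp only [insert_eq]; infer_instance

instance dt_inter [hs : DT TM0 s] [ht : DT TM0 t] : DT TM0 (fun v => s v ∩ t v) := by
  have h1 : DT TM0 (fun v : ℕ → ZFSet.{u} => v 0 ∩ v 1) := by
    have : (fun v : ℕ → ZFSet.{u} => v 0 ∩ v 1) = fun v => ZFSet.sep (fun x => x ∈ v 1) (v 0) := by
      funext v; ext x; simp
    rw [this]; infer_instance
  exact DT.c2 (P := fun x y => x ∩ y) h1

instance dt_pair [hs : DT TM0 s] [ht : DT TM0 t] : DT TM0 (fun v => ZFSet.pair (s v) (t v)) := by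
  unfold ZFSet.pair; infer_instance

instance dt_omega : DT TM0 (fun _ => ZFSet.omega.{u}) :=
  ⟨fun M hM v hv => hM.omega_mem,
   Dfn.congr (P := fun M v => ∀ x ∈ (insert (v 0) (v 0) : ZFSet.{u}), x = ∅ ∨ ∃ z ∈ x, x = insert z z)
    inferInstance fun M hM v hv => by rw [mem_omega_iff]⟩

instance dt_ite [hs : DT TM0 s] [ht : DT TM0 t] {P : (ℕ → ZFSet.{u}) → Prop}
    [hP : Dfn TM0 (fun _ v => P v)] :
    DT TM0 (fun v => if P v then s v else t v) := by
  refine ⟨fun M hM v hv => ?_, ?_⟩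
  · by_cases h : P v
    · simp only [h, if_true]; exact hs.cl M hM v hv
    · simp only [h, if_false]; exact ht.cl M hM v hv
  have h1 := hs.mem
  have h2 := ht.mem
  have h3 : Dfn TM0 (fun M v => P (fun n => v (n + 1))) := hP.ren (fun n => n + 1)
  refine Dfn.congr (P := fun M v => (P (fun n => v (n + 1)) ∧ v 0 ∈ s (fun n => v (n + 1))) ∨
    (¬ P (fun n => v (n + 1)) ∧ v 0 ∈ t (fun n => v (n + 1))))
    inferInstance fun M hM v hv => ?_
  by_cases h : P (fun n => v (n + 1)) <;> simp [h]

instance dt_zimg [hs : DT TM0 s] {t : (ℕ → ZFSet.{u}) → ZFSet.{u} → ZFSet.{u}}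
    [ht : DT TM0 (fun v => t (fun n => v (n + 1)) (v 0))] :
    DT TM0 (fun v => zimg (s v) (fun x => t v x)) := by
  have hsr := hs.ren (fun n => n + 1)
  have htr : DT TM0 (fun v => t (fun n => v (n + 2)) (v 0)) :=
    ht.ren (fun n => Nat.casesOn n 0 (fun m => m + 2))
  refine ⟨fun M hM v hv => ?_, ?_⟩
  · have hcl := hs.cl M hM v hv
    have hcl2 : ∀ x ∈ s v, t v x ∈ M := fun x hx => ht.cl M hM (scons x v) (by
      rintro (_ | n)
      exacts [hM.trans.mem_trans hx hcl, hv n])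
    have hd : Dfn TM0 (fun M v => v 1 = t (fun n => v (n + 2)) (v 0)) := inferInstance
    obtain ⟨b, hb, hbx⟩ := coll_mem hM (fun M v => v 1 = t (fun n => v (n + 2)) (v 0)) hcl v hv
      (fun x hx => ⟨t v x, hcl2 x hx, rfl⟩)
    have he : MPaper.zimg (s v) (fun x => t v x) =
        ZFSet.sep (fun y => ∃ x ∈ s v, y = t v x) b := by
      ext y
      simp only [mem_zimg, mem_sep]
      refine ⟨fun h => ⟨?_, h⟩, fun h => h.2⟩
      obtain ⟨x, hx, rfl⟩ := h
      obtain ⟨y, hy, hyx⟩ := hbx x hx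
      have : y = t v x := hyx
      rwa [← this]
    rw [he]
    have htr2 : DT TM0 (fun v => t (fun n => v (n + 1 + 1)) (v 0)) := htr
    have hsr1 : DT TM0 (fun v => s (fun n => v (n + 1))) := hsr
    exact sep_mem hM (fun M v => ∃ x ∈ s (fun n => v (n + 1)), v 0 = t (fun n => v (n + 1)) x) hb
      v hv
  · have htr2 : DT TM0 (fun v => t (fun n => v (n + 1 + 1)) (v 0)) := htr
    have hsr1 : DT TM0 (fun v => s (fun n => v (n + 1))) := hsr
    exact Dfn.congr
      (P := fun M v => ∃ x ∈ s (fun n => v (n + 1)), v 0 = t (fun n => v (n + 1)) x)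
      (Dfn.bex (P := fun M v x => v 0 = t (fun n => v (n + 1)) x)
        (h := Dfn.eq (s := fun v => v 1) (ht := htr2)))
      fun M hM v hv => by rw [mem_zimg]

instance dt_lam [hs : DT TM0 s] {t : (ℕ → ZFSet.{u}) → ZFSet.{u} → ZFSet.{u}}
    [ht : DT TM0 (fun v => t (fun n => v (n + 1)) (v 0))] :
    DT TM0 (fun v => lam (s v) (fun x => t v x)) := by
  unfold MPaper.lam; infer_instance

instance dt_zprod [hs : DT TM0 s] [ht : DT TM0 t] : DT TM0 (fun v => zprod (s v) (t v)) := by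
  refine DT.c2 (P := fun a b => MPaper.zprod a b) ?_
  unfold MPaper.zprod; infer_instance

instance dt_fapp [hs : DT TM0 s] [ht : DT TM0 t] : DT TM0 (fun v => fapp (s v) (t v)) := by
  refine DT.c2 (P := fun a b => MPaper.fapp a b) ?_
  unfold MPaper.fapp; infer_instance

instance dt_compl [hs : DT TM0 s] [ht : DT TM0 t] : DT TM0 (fun v => compl (s v) (t v)) := by
  refine DT.c2 (P := fun a b => MPaper.compl a b) ?_
  unfold MPaper.compl; infer_instance

instance dt_tailSet [hs : DT TM0 s] [ht : DT TM0 t] : DT TM0 (fun v => tailSet (s v) (t v)) := by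
  refine DT.c2 (P := fun a b => MPaper.tailSet a b) ?_
  unfold MPaper.tailSet; infer_instance

instance dt_ran [hs : DT TM0 s] : DT TM0 (fun v => ran (s v)) := by
  refine DT.c1 (P := fun a => MPaper.ran a) ?_
  unfold MPaper.ran; infer_instance

instance dt_restr [hs : DT TM0 s] [ht : DT TM0 t] : DT TM0 (fun v => restr (s v) (t v)) := by
  refine DT.c2 (P := fun a b => MPaper.restr a b) ?_
  unfold MPaper.restr; infer_instance

instance dfn_isZFunc [hs : DT TM0 s] [ht : DT TM0 t] : Dfn TM0 (fun _ v => IsZFunc (s v) (t v)) := by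
  refine Dfn.c2 (P := fun _ a b => IsZFunc a b) ?_
  simp only [isZFunc_iff]; infer_instance

instance dfn_isTransitive [hs : DT TM0 s] : Dfn TM0 (fun _ v => (s v).IsTransitive) := by
  refine Dfn.c1 (P := fun _ a => ZFSet.IsTransitive a) ?_
  unfold ZFSet.IsTransitive; infer_instance

end terms

/-! user level forms -/

section user
variable {M : ZFSet.{u}} (hM : TM0 M)

theorem DT1 (hM : TM0 M) (t : ZFSet.{u} → ZFSet.{u}) [h : DT TM0 (fun v => t (v 0))] {a} (ha : a ∈ M) :
    t a ∈ M := h.cl M hM (fun _ => a) (fun _ => ha)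

theorem DT2 (hM : TM0 M) (t : ZFSet.{u} → ZFSet.{u} → ZFSet.{u}) [h : DT TM0 (fun v => t (v 0) (v 1))] {a b}
    (ha : a ∈ M) (hb : b ∈ M) : t a b ∈ M :=
  h.cl M hM (scons a (fun _ => b)) (by rintro (_ | n); exacts [ha, hb])

theorem DT3 (hM : TM0 M) (t : ZFSet.{u} → ZFSet.{u} → ZFSet.{u} → ZFSet.{u})
    [h : DT TM0 (fun v => t (v 0) (v 1) (v 2))] {a b c}
    (ha : a ∈ M) (hb : b ∈ M) (hc : c ∈ M) : t a b c ∈ M :=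
  h.cl M hM (scons a (scons b (fun _ => c))) (by rintro (_ | _ | n); exacts [ha, hb, hc])

theorem DT4 (hM : TM0 M) (t : ZFSet.{u} → ZFSet.{u} → ZFSet.{u} → ZFSet.{u} → ZFSet.{u})
    [h : DT TM0 (fun v => t (v 0) (v 1) (v 2) (v 3))] {a b c d}
    (ha : a ∈ M) (hb : b ∈ M) (hc : c ∈ M) (hd : d ∈ M) : t a b c d ∈ M :=
  h.cl M hM (scons a (scons b (scons c (fun _ => d))))
    (by rintro (_ | _ | _ | n); exacts [ha, hb, hc, hd])

theorem DT5 (hM : TM0 M) (t : ZFSet.{u} → ZFSet.{u} → ZFSet.{u} → ZFSet.{u} → ZFSet.{u} → ZFSet.{u})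
    [h : DT TM0 (fun v => t (v 0) (v 1) (v 2) (v 3) (v 4))] {a b c d e}
    (ha : a ∈ M) (hb : b ∈ M) (hc : c ∈ M) (hd : d ∈ M) (he : e ∈ M) : t a b c d e ∈ M :=
  h.cl M hM (scons a (scons b (scons c (scons d (fun _ => e)))))
    (by rintro (_ | _ | _ | _ | n); exacts [ha, hb, hc, hd, he])

theorem sepM1 (hM : TM0 M) (P : ZFSet.{u} → ZFSet.{u} → ZFSet.{u} → Prop)
    [h : Dfn TM0 (fun M v => P M (v 0) (v 1))] {x a}
    (hx : x ∈ M) (ha : a ∈ M) : ZFSet.sep (fun y => P M y a) x ∈ M :=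
  sep_mem hM (fun M v => P M (v 0) (v 1)) hx (fun _ => a) (fun _ => ha)

theorem sepM2 (hM : TM0 M) (P : ZFSet.{u} → ZFSet.{u} → ZFSet.{u} → ZFSet.{u} → Prop)
    [h : Dfn TM0 (fun M v => P M (v 0) (v 1) (v 2))] {x a b}
    (hx : x ∈ M) (ha : a ∈ M) (hb : b ∈ M) : ZFSet.sep (fun y => P M y a b) x ∈ M :=
  sep_mem hM (fun M v => P M (v 0) (v 1) (v 2)) hx (scons a (fun _ => b))
    (by rintro (_ | n); exacts [ha, hb])

theorem sepM3 (hM : TM0 M) (P : ZFSet.{u} → ZFSet.{u} → ZFSet.{u} → ZFSet.{u} → ZFSet.{u} → Prop)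
    [h : Dfn TM0 (fun M v => P M (v 0) (v 1) (v 2) (v 3))] {x a b c}
    (hx : x ∈ M) (ha : a ∈ M) (hb : b ∈ M) (hc : c ∈ M) :
    ZFSet.sep (fun y => P M y a b c) x ∈ M :=
  sep_mem hM (fun M v => P M (v 0) (v 1) (v 2) (v 3)) hx (scons a (scons b (fun _ => c)))
    (by rintro (_ | _ | n); exacts [ha, hb, hc])

theorem sepM4 (hM : TM0 M) (P : ZFSet.{u} → ZFSet.{u} → ZFSet.{u} → ZFSet.{u} → ZFSet.{u} → ZFSet.{u} → Prop)
    [h : Dfn TM0 (fun M v => P M (v 0) (v 1) (v 2) (v 3) (v 4))] {x a b c d}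
    (hx : x ∈ M) (ha : a ∈ M) (hb : b ∈ M) (hc : c ∈ M) (hd : d ∈ M) :
    ZFSet.sep (fun y => P M y a b c d) x ∈ M :=
  sep_mem hM (fun M v => P M (v 0) (v 1) (v 2) (v 3) (v 4)) hx
    (scons a (scons b (scons c (fun _ => d))))
    (by rintro (_ | _ | _ | n); exacts [ha, hb, hc, hd])

theorem collM1 (hM : TM0 M) (P : ZFSet.{u} → ZFSet.{u} → ZFSet.{u} → ZFSet.{u} → Prop)
    [h : Dfn TM0 (fun M v => P M (v 0) (v 1) (v 2))] {x a}
    (hx : x ∈ M) (ha : a ∈ M) (H : ∀ y ∈ x, ∃ z ∈ M, P M y z a) :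
    ∃ w ∈ M, ∀ y ∈ x, ∃ z ∈ w, P M y z a :=
  coll_mem hM (fun M v => P M (v 0) (v 1) (v 2)) hx (fun _ => a) (fun _ => ha) H

theorem collM2 (hM : TM0 M) (P : ZFSet.{u} → ZFSet.{u} → ZFSet.{u} → ZFSet.{u} → ZFSet.{u} → Prop)
    [h : Dfn TM0 (fun M v => P M (v 0) (v 1) (v 2) (v 3))] {x a b}
    (hx : x ∈ M) (ha : a ∈ M) (hb : b ∈ M) (H : ∀ y ∈ x, ∃ z ∈ M, P M y z a b) :
    ∃ w ∈ M, ∀ y ∈ x, ∃ z ∈ w, P M y z a b :=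
  coll_mem hM (fun M v => P M (v 0) (v 1) (v 2) (v 3)) hx (scons a (fun _ => b))
    (by rintro (_ | n); exacts [ha, hb]) H

theorem collM3 (hM : TM0 M) (P : ZFSet.{u} → ZFSet.{u} → ZFSet.{u} → ZFSet.{u} → ZFSet.{u} → ZFSet.{u} → Prop)
    [h : Dfn TM0 (fun M v => P M (v 0) (v 1) (v 2) (v 3) (v 4))] {x a b c}
    (hx : x ∈ M) (ha : a ∈ M) (hb : b ∈ M) (hc : c ∈ M) (H : ∀ y ∈ x, ∃ z ∈ M, P M y z a b c) :
    ∃ w ∈ M, ∀ y ∈ x, ∃ z ∈ w, P M y z a b c :=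
  coll_mem hM (fun M v => P M (v 0) (v 1) (v 2) (v 3) (v 4)) hx (scons a (scons b (fun _ => c)))
    (by rintro (_ | _ | n); exacts [ha, hb, hc]) H

theorem TM0.mem_of_mem (hM : TM0 M) {x y : ZFSet.{u}} (hx : x ∈ y) (hy : y ∈ M) : x ∈ M :=
  hM.trans.mem_trans hx hy

theorem TM0.fapp_mem (hM : TM0 M) {d f x : ZFSet.{u}} (hf : f ∈ M) (h : IsZFunc d f) (hx : x ∈ d) :
    fapp f x ∈ M :=
  hM.mem_of_mem (pair_mem_field (h.pair_mem hx)).2 (DT1 hM (fun f => ⋃₀ ⋃₀ f) hf)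

end user


/-! ### Recursion -/

/-- domain of a set-coded function -/
def dom (f : ZFSet.{u}) : ZFSet.{u} := ZFSet.sep (fun x => ∃ y ∈ ⋃₀ ⋃₀ f, pair x y ∈ f) (⋃₀ ⋃₀ f)

theorem mem_dom {f x : ZFSet.{u}} : x ∈ dom f ↔ ∃ y, pair x y ∈ f := by
  simp only [dom, mem_sep]
  constructor
  · rintro ⟨_, x, _, h⟩; exact ⟨x, h⟩
  · rintro ⟨y, h⟩; exact ⟨(pair_mem_field h).1, y, (pair_mem_field h).2, h⟩

@[simp] theorem mem_dom_lam {a x : ZFSet.{u}} {F} : x ∈ dom (lam a F) ↔ x ∈ a := by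
  simp [mem_dom]

instance dt_dom {s : (ℕ → ZFSet.{u}) → ZFSet.{u}} [hs : DT TM0 s] : DT TM0 (fun v => dom (s v)) := by
  refine DT.c1 (P := fun a => MPaper.dom a) ?_
  unfold MPaper.dom; infer_instance

/-- the relation coded by `r` on `a` -/
def RR (a r y x : ZFSet.{u}) : Prop := y ∈ a ∧ pair y x ∈ r

/-- the well-founded part -/
def Wf (a r : ZFSet.{u}) : ZFSet.{u} := ZFSet.sep (fun x => Acc (RR a r) x) a

/-- predecessors -/
def prd (a r x : ZFSet.{u}) : ZFSet.{u} := ZFSet.sep (fun y => pair y x ∈ r) a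

theorem mem_prd {a r x y : ZFSet.{u}} : y ∈ prd a r x ↔ RR a r y x := by simp [prd, RR]

instance dt_prd {s t q : (ℕ → ZFSet.{u}) → ZFSet.{u}} [hs : DT TM0 s] [ht : DT TM0 t]
    [hq : DT TM0 q] : DT TM0 (fun v => prd (s v) (t v) (q v)) := by
  refine DT.c3 (P := fun a b c => MPaper.prd a b c) ?_
  unfold MPaper.prd; infer_instance

theorem RR_wf' (a r : ZFSet.{u}) :
    WellFounded (fun y x : ZFSet.{u} => RR a r y x ∧ Acc (RR a r) x) := by
  have h1 : ∀ x, Acc (RR a r) x → Acc (fun y x : ZFSet.{u} => RR a r y x ∧ Acc (RR a r) x) x := by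
    intro x hx
    induction hx with
    | intro x h ih => exact ⟨x, fun y hy => ih y hy.1⟩
  refine ⟨fun x => ?_⟩
  by_cases hx : Acc (RR a r) x
  · exact h1 x hx
  · exact ⟨x, fun y hy => absurd hy.2 hx⟩

/-- function defined by recursion on the well-founded part of `r` -/
def recF (a r : ZFSet.{u}) (G : ZFSet.{u} → ZFSet.{u} → ZFSet.{u}) : ZFSet.{u} → ZFSet.{u} :=
  WellFounded.fix (RR_wf' a r) fun x ih =>
    G x (lam (prd a r x) fun y => if h : RR a r y x ∧ Acc (RR a r) x then ih y h else ∅)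

theorem recF_eq {a r x : ZFSet.{u}} {G} (hx : Acc (RR a r) x) :
    recF a r G x = G x (lam (prd a r x) (recF a r G)) := by
  rw [recF, WellFounded.fix_eq]
  congr 1
  refine lam_congr fun y hy => ?_
  rw [dif_pos ⟨mem_prd.1 hy, hx⟩]

/-- recursion as a set-coded function -/
def Rec (a r : ZFSet.{u}) (G : ZFSet.{u} → ZFSet.{u} → ZFSet.{u}) : ZFSet.{u} :=
  lam (Wf a r) (recF a r G)

/-- good approximations -/
def Appr (a r : ZFSet.{u}) (G : ZFSet.{u} → ZFSet.{u} → ZFSet.{u}) (g : ZFSet.{u}) : Prop :=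
  ∃ d : ZFSet.{u}, g = lam d (recF a r G) ∧ ∀ x ∈ d, x ∈ Wf a r ∧ prd a r x ⊆ d

/-- first-order description of approximations -/
def App (a r : ZFSet.{u}) (G : ZFSet.{u} → ZFSet.{u} → ZFSet.{u}) (g : ZFSet.{u}) : Prop :=
  ∀ p ∈ g, ∃ x ∈ a, ∃ y ∈ ⋃₀ ⋃₀ g, p = pair x y ∧ y = G x (restr g (prd a r x)) ∧
    prd a r x ⊆ dom g

theorem restr_lam {d e : ZFSet.{u}} {F} (h : e ⊆ d) : restr (lam d F) e = lam e F := by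
  ext p
  constructor
  · intro hp
    obtain ⟨x, hx, rfl⟩ := mem_lam.1 (mem_sep.1 hp).1
    simp only [pair_mem_restr] at hp
    simp [hp.1]
  · intro hp
    obtain ⟨x, hx, rfl⟩ := mem_lam.1 hp
    simp only [pair_mem_restr]
    simp [hx, h hx]

theorem App.appr {a r g : ZFSet.{u}} {G} (h : App a r G g)
    (hacc : ∀ x ∈ dom g, Acc (RR a r) x) : Appr a r G g := by
  have hd : ∀ x y, pair x y ∈ g → x ∈ a ∧ y = G x (restr g (prd a r x)) ∧ prd a r x ⊆ dom g := by
    intro x y hp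
    obtain ⟨x', hx, y', hy, he, h2, h3⟩ := h _ hp
    obtain ⟨rfl, rfl⟩ := pair_inj.1 he
    exact ⟨hx, h2, h3⟩
  have hval : ∀ x, Acc (RR a r) x → ∀ y, pair x y ∈ g → y = recF a r G x := by
    intro x hx
    induction hx with
    | intro x hx ih =>
      intro y hy
      obtain ⟨hxa, hyG, hdd⟩ := hd x y hy
      rw [recF_eq ⟨x, hx⟩, hyG]
      congr 1
      ext p
      constructor
      · intro hp
        obtain ⟨hp1, z, hz, w, hw, rfl⟩ := mem_sep.1 hp
        rw [pair_mem_lam]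
        exact ⟨hz, ih z (mem_prd.1 hz) w hp1⟩
      · intro hp
        obtain ⟨z, hz, rfl⟩ := mem_lam.1 hp
        obtain ⟨w, hw⟩ := mem_dom.1 (hdd hz)
        rw [pair_mem_restr]
        refine ⟨hz, ?_⟩
        rw [← ih z (mem_prd.1 hz) w hw]; exact hw
  refine ⟨dom g, ?_, fun x hx => ?_⟩
  · ext p
    constructor
    · intro hp
      obtain ⟨x, hx, y, hy, rfl, _, _⟩ := h _ hp
      have hxd : x ∈ dom g := mem_dom.2 ⟨y, hp⟩
      rw [pair_mem_lam]
      exact ⟨hxd, hval x (hacc x hxd) y hp⟩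
    · intro hp
      obtain ⟨x, hx, rfl⟩ := mem_lam.1 hp
      obtain ⟨y, hy⟩ := mem_dom.1 hx
      rw [← hval x (hacc x hx) y hy]; exact hy
  · obtain ⟨y, hy⟩ := mem_dom.1 hx
    obtain ⟨hxa, hyG, hdd⟩ := hd x y hy
    exact ⟨mem_sep.2 ⟨hxa, hacc x hx⟩, hdd⟩

theorem Appr.app {a r g : ZFSet.{u}} {G} (h : Appr a r G g) :
    App a r G g ∧ ∀ x ∈ dom g, x ∈ Wf a r := by
  obtain ⟨d, rfl, h⟩ := h
  refine ⟨fun p hp => ?_, fun x hx => (h x (by simpa using hx)).1⟩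
  have hp' := hp
  obtain ⟨x, hx, rfl⟩ := mem_lam.1 hp
  refine ⟨x, (mem_sep.1 (h x hx).1).1, _, (pair_mem_field hp').2, rfl, ?_, ?_⟩
  · rw [restr_lam (h x hx).2, recF_eq (mem_sep.1 (h x hx).1).2]
  · intro y hy; rw [mem_dom_lam]; exact (h x hx).2 hy

section rec
variable {t : (ℕ → ZFSet.{u}) → ZFSet.{u}}

theorem exists_appr [ht : DT TM0 t]
    (hA : Dfn TM0 (fun M v => Appr (v 1) (v 2)
      (fun x g => t (scons x (scons g (fun n => v (n + 1))))) (v 0)))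
    {M : ZFSet.{u}} (hM : TM0 M) (v : ℕ → ZFSet.{u}) (hv : ∀ n, v n ∈ M) :
    ∀ x, Acc (RR (v 0) (v 1)) x → x ∈ v 0 →
      ∃ g ∈ M, Appr (v 0) (v 1) (fun x g => t (scons x (scons g v))) g ∧ x ∈ dom g := by
  intro x hx
  induction hx with
  | intro x hacc ih =>
    intro hxa
    set G := (fun x g => t (scons x (scons g v))) with hG
    have hxM := hM.mem_of_mem hxa (hv 0)
    have hpM : prd (v 0) (v 1) x ∈ M := DT3 hM (fun a b c => prd a b c) (hv 0) (hv 1) hxM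
    have hA1 : Dfn TM0 (fun M v => Appr (v 2) (v 3)
        (fun x g => t (scons x (scons g (fun n => v (n + 2))))) (v 1)) :=
      hA.ren (fun n => n + 1)
    obtain ⟨b, hb, hbx⟩ := coll_mem hM (fun M v => Appr (v 2) (v 3)
        (fun x g => t (scons x (scons g (fun n => v (n + 2))))) (v 1) ∧ v 0 ∈ dom (v 1)) hpM v hv
      (fun y hy => ih y (mem_prd.1 hy) (mem_prd.1 hy).1)
    let c := ZFSet.sep (fun g => Appr (v 0) (v 1) G g) b
    have hc : c ∈ M := sep_mem hM (fun M v => Appr (v 1) (v 2)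
      (fun x g => t (scons x (scons g (fun n => v (n + 1))))) (v 0)) hb v hv
    let d := ⋃₀ (zimg c (fun g => dom g))
    have hd : ∀ z, z ∈ d ↔ ∃ g ∈ c, z ∈ dom g := by
      intro z
      simp only [d, mem_sUnion, mem_zimg]
      constructor
      · rintro ⟨_, ⟨g, hg, rfl⟩, h⟩; exact ⟨g, hg, h⟩
      · rintro ⟨g, hg, h⟩; exact ⟨_, ⟨g, hg, rfl⟩, h⟩
    have hcA : ∀ g ∈ c, Appr (v 0) (v 1) G g := fun g hg => (mem_sep.1 hg).2
    have hU : ⋃₀ c = lam d (recF (v 0) (v 1) G) := by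
      ext p
      rw [mem_sUnion, mem_lam]
      constructor
      · rintro ⟨g, hg, hp⟩
        obtain ⟨d', rfl, h'⟩ := hcA g hg
        obtain ⟨z, hz, rfl⟩ := mem_lam.1 hp
        exact ⟨z, (hd z).2 ⟨_, hg, by simpa using hz⟩, rfl⟩
      · rintro ⟨z, hz, rfl⟩
        obtain ⟨g, hg, hz⟩ := (hd z).1 hz
        refine ⟨g, hg, ?_⟩
        obtain ⟨d', rfl, h'⟩ := hcA g hg
        simpa using hz
    have hUM : lam d (recF (v 0) (v 1) G) ∈ M := by rw [← hU]; exact hM.sUnion' _ hc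
    have hpd : prd (v 0) (v 1) x ⊆ d := by
      intro y hy
      obtain ⟨g, hg, hA, hyd⟩ := hbx y hy
      exact (hd y).2 ⟨g, mem_sep.2 ⟨hg, hA⟩, hyd⟩
    have hdA : ∀ z ∈ d, z ∈ Wf (v 0) (v 1) ∧ prd (v 0) (v 1) z ⊆ d := by
      intro z hz
      obtain ⟨g, hg, hzg⟩ := (hd z).1 hz
      have hgA := hcA g hg
      refine ⟨(hgA.app).2 z hzg, fun y hy => (hd y).2 ⟨g, hg, ?_⟩⟩
      obtain ⟨d', rfl, h'⟩ := hgA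
      rw [mem_dom_lam] at hzg ⊢
      exact (h' z hzg).2 hy
    have hFx : recF (v 0) (v 1) G x ∈ M := by
      rw [recF_eq ⟨x, hacc⟩, ← restr_lam hpd, hG]
      refine ht.cl M hM _ ?_
      rintro (_ | _ | n)
      · exact hxM
      · exact DT2 hM (fun a b => restr a b) hUM hpM
      · exact hv n
    refine ⟨insert (pair x (recF (v 0) (v 1) G x)) (lam d (recF (v 0) (v 1) G)), ?_, ?_, ?_⟩
    · exact DT3 hM (fun a b c => (insert (pair a b) c : ZFSet)) hxM hFx hUM
    · refine ⟨insert x d, ?_, ?_⟩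
      · ext p
        simp only [mem_insert_iff, mem_lam]
        constructor
        · rintro (rfl | ⟨z, hz, rfl⟩)
          exacts [⟨x, .inl rfl, rfl⟩, ⟨z, .inr hz, rfl⟩]
        · rintro ⟨z, (rfl | hz), rfl⟩
          exacts [.inl rfl, .inr ⟨z, hz, rfl⟩]
      · intro z hz
        rcases mem_insert_iff.1 hz with rfl | hz
        · exact ⟨mem_sep.2 ⟨hxa, ⟨_, hacc⟩⟩, fun y hy => mem_insert_iff.2 (.inr (hpd hy))⟩
        · exact ⟨(hdA z hz).1, fun y hy => mem_insert_iff.2 (.inr ((hdA z hz).2 hy))⟩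
    · rw [mem_dom]; exact ⟨_, mem_insert_iff.2 (.inl rfl)⟩

theorem ran_acc {a r g : ZFSet.{u}} (h : App a r (fun _ g => ran g) g) :
    ∀ x ∈ dom g, Acc (RR a r) x := by
  have : ∀ y x, pair x y ∈ g → Acc (RR a r) x := by
    intro y
    induction y using ZFSet.inductionOn with
    | _ y ih =>
      intro x hp
      obtain ⟨x', hx, y', hy, he, h2, h3⟩ := h _ hp
      obtain ⟨rfl, rfl⟩ := pair_inj.1 he
      refine ⟨x, fun z hz => ?_⟩
      obtain ⟨w, hw⟩ := mem_dom.1 (h3 (mem_prd.2 hz))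
      refine ih w ?_ z hw
      rw [h2, mem_ran']
      exact ⟨z, pair_mem_restr.2 ⟨mem_prd.2 hz, hw⟩⟩
  intro x hx
  obtain ⟨y, hy⟩ := mem_dom.1 hx
  exact this y x hy

theorem dfn_app_var [ht : DT TM0 t] : Dfn TM0 (fun M v => App (v 1) (v 2)
      (fun x g => t (scons x (scons g (fun n => v (n + 1))))) (v 0)) := by
  unfold App
  have h1 : DT TM0 (fun v => t (scons (v 1) (scons (restr (v 3) (prd (v 4) (v 5) (v 1)))
      (fun n => v (n + 4))))) := by
    have := ht.comp (fun i => Nat.casesOn i (fun v => v 1) (fun i => Nat.casesOn i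
      (fun v => restr (v 3) (prd (v 4) (v 5) (v 1))) (fun i v => v (i + 4)))) (by
        rintro (_ | _ | n)
        · exact DT.var 1
        · exact (inferInstance : DT TM0 (fun v => restr (v 3) (prd (v 4) (v 5) (v 1))))
        · exact DT.var (n + 4))
    convert this using 3 with v
    funext i
    rcases i with _ | _ | n <;> rfl
  have h2 : Dfn TM0 (fun M v => v 0 =
      t (scons (v 1) (scons (restr (v 3) (prd (v 4) (v 5) (v 1))) (fun n => v (n + 4))))) :=
    Dfn.eq (s := fun v => v 0) (ht := h1)
  have h3 : Dfn TM0 (fun M v => v 2 = pair (v 1) (v 0) ∧ v 0 =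
      t (scons (v 1) (scons (restr (v 3) (prd (v 4) (v 5) (v 1))) (fun n => v (n + 4)))) ∧
      prd (v 4) (v 5) (v 1) ⊆ dom (v 3)) := inferInstance
  have h4 : Dfn TM0 (fun M v => ∃ y ∈ ⋃₀ ⋃₀ (v 2), v 1 = pair (v 0) y ∧ y =
      t (scons (v 0) (scons (restr (v 2) (prd (v 3) (v 4) (v 0))) (fun n => v (n + 3)))) ∧
      prd (v 3) (v 4) (v 0) ⊆ dom (v 2)) := Dfn.bex (h := h3)
  have h5 : Dfn TM0 (fun M v => ∃ x ∈ v 2, ∃ y ∈ ⋃₀ ⋃₀ (v 1), v 0 = pair x y ∧ y =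
      t (scons x (scons (restr (v 1) (prd (v 2) (v 3) x)) (fun n => v (n + 2)))) ∧
      prd (v 2) (v 3) x ⊆ dom (v 1)) := Dfn.bex (t := fun v => v 2) (h := h4)
  exact Dfn.ball (t := fun v => v 0) (h := h5)

theorem dfn_appr_ran : Dfn TM0.{u} (fun M v => Appr (v 1) (v 2) (fun x g => ran g) (v 0)) := by
  refine Dfn.congr (P := fun M v => App (v 1) (v 2) (fun x g => ran g) (v 0))
    (dfn_app_var (t := fun v => ran (v 1))) fun M hM v hv => ?_
  exact ⟨fun h => h.appr (ran_acc h), fun h => h.app.1⟩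

theorem mem_wf_iff {M a r : ZFSet.{u}} (hM : TM0 M) (ha : a ∈ M) (hr : r ∈ M) (x : ZFSet.{u}) :
    x ∈ Wf a r ↔ x ∈ a ∧ ∃ g ∈ M, Appr a r (fun x g => ran g) g ∧ x ∈ dom g := by
  constructor
  · intro hx
    refine ⟨(mem_sep.1 hx).1, ?_⟩
    exact exists_appr (t := fun v => ran (v 1)) dfn_appr_ran hM (scons a (fun _ => r))
      (by rintro (_ | n); exacts [ha, hr]) x (mem_sep.1 hx).2 (mem_sep.1 hx).1
  · rintro ⟨_, g, _, hg, hx⟩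
    exact hg.app.2 x hx

theorem dt_wf_var : DT TM0.{u} (fun v => Wf (v 0) (v 1)) := by
  have h0 := dfn_appr_ran.{u}
  have h1 : Dfn TM0.{u} (fun M v => Appr (v 2) (v 3) (fun x g => ran g) (v 0)) :=
    (h0.ren (fun n => if n = 0 then 0 else n + 1)).congr fun M _ v _ => by simp
  have h2 : Dfn TM0.{u} (fun M v => v 0 ∈ v 1 ∧ ∃ g ∈ M, Appr (v 1) (v 2) (fun x g => ran g) g ∧
    v 0 ∈ dom g) := inferInstance
  refine ⟨fun M hM v hv => ?_, ?_⟩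
  · have : Wf (v 0) (v 1) = ZFSet.sep (fun x => x ∈ v 0 ∧ ∃ g ∈ M,
        Appr (v 0) (v 1) (fun x g => ran g) g ∧ x ∈ dom g) (v 0) := by
      ext x; rw [mem_sep, ← mem_wf_iff hM (hv 0) (hv 1)]
      exact ⟨fun h => ⟨(mem_sep.1 h).1, h⟩, fun h => h.2⟩
    rw [this]
    exact sep_mem hM (fun M v => v 0 ∈ v 1 ∧ ∃ g ∈ M, Appr (v 1) (v 2) (fun x g => ran g) g ∧
      v 0 ∈ dom g) (hv 0) v hv
  · exact h2.congr fun M hM v hv => (mem_wf_iff hM (hv 1) (hv 2) (v 0)).symm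

instance dt_wf {s q : (ℕ → ZFSet.{u}) → ZFSet.{u}} [hs : DT TM0 s] [hq : DT TM0 q] :
    DT TM0 (fun v => Wf (s v) (q v)) := DT.c2 (P := fun a b => Wf a b) dt_wf_var

theorem dfn_appr_var [ht : DT TM0 t] : Dfn TM0 (fun M v => Appr (v 1) (v 2)
      (fun x g => t (scons x (scons g (fun n => v (n + 1))))) (v 0)) := by
  have := dfn_app_var (t := t)
  refine Dfn.congr (P := fun M v => App (v 1) (v 2)
      (fun x g => t (scons x (scons g (fun n => v (n + 1))))) (v 0) ∧
      ∀ x ∈ dom (v 0), x ∈ Wf (v 1) (v 2))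
    inferInstance fun M hM v hv => ?_
  exact ⟨fun h => h.1.appr (fun x hx => (mem_sep.1 (h.2 x hx)).2), fun h => h.app⟩

theorem mem_rec_iff [ht : DT TM0 t] {M : ZFSet.{u}} (hM : TM0 M) (v : ℕ → ZFSet.{u})
    (hv : ∀ n, v n ∈ M) (p : ZFSet.{u}) :
    p ∈ Rec (v 0) (v 1) (fun x g => t (scons x (scons g v))) ↔
      ∃ g ∈ M, Appr (v 0) (v 1) (fun x g => t (scons x (scons g v))) g ∧ p ∈ g := by
  constructor
  · intro hp
    obtain ⟨x, hx, rfl⟩ := mem_lam.1 hp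
    obtain ⟨g, hg, hA, hxd⟩ := exists_appr (t := t) dfn_appr_var hM v hv x (mem_sep.1 hx).2 (mem_sep.1 hx).1
    refine ⟨g, hg, hA, ?_⟩
    obtain ⟨d, rfl, h⟩ := hA
    simpa using hxd
  · rintro ⟨g, hg, hA, hp⟩
    have h2 := hA.app.2
    obtain ⟨d, rfl, h⟩ := hA
    obtain ⟨x, hx, rfl⟩ := mem_lam.1 hp
    rw [Rec, pair_mem_lam]
    exact ⟨(h x hx).1, rfl⟩

theorem Rec_mem [ht : DT TM0 t] {M : ZFSet.{u}} (hM : TM0 M) (v : ℕ → ZFSet.{u})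
    (hv : ∀ n, v n ∈ M) : Rec (v 0) (v 1) (fun x g => t (scons x (scons g v))) ∈ M := by
  have h0 := dfn_appr_var (t := t)
  have hW : Wf (v 0) (v 1) ∈ M := DT2 hM (fun a b => Wf a b) (hv 0) (hv 1)
  have h1 : Dfn TM0 (fun M v => Appr (v 2) (v 3)
      (fun x g => t (scons x (scons g (fun n => v (n + 2))))) (v 1)) := h0.ren (fun n => n + 1)
  obtain ⟨b, hb, hbx⟩ := coll_mem hM (fun M v => Appr (v 2) (v 3)
        (fun x g => t (scons x (scons g (fun n => v (n + 2))))) (v 1) ∧ v 0 ∈ dom (v 1)) hW v hv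
      (fun y hy => exists_appr h0 hM v hv y (mem_sep.1 hy).2 (mem_sep.1 hy).1)
  have hc := sep_mem hM (fun M v => Appr (v 1) (v 2)
      (fun x g => t (scons x (scons g (fun n => v (n + 1))))) (v 0)) hb v hv
  have : Rec (v 0) (v 1) (fun x g => t (scons x (scons g v))) = ⋃₀ (ZFSet.sep (fun g =>
      Appr (v 0) (v 1) (fun x g => t (scons x (scons g v))) g) b) := by
    ext p
    rw [mem_sUnion]
    constructor
    · intro hp
      obtain ⟨x, hx, rfl⟩ := mem_lam.1 hp
      obtain ⟨g, hg, hA, hxd⟩ := hbx x hx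
      refine ⟨g, mem_sep.2 ⟨hg, hA⟩, ?_⟩
      have hA' : Appr (v 0) (v 1) (fun x g => t (scons x (scons g v))) g := hA
      have hxd : x ∈ dom g := hxd
      clear hA
      obtain ⟨d, rfl, h⟩ := hA'
      have : x ∈ d := by simpa using hxd
      exact pair_mem_lam.2 ⟨this, rfl⟩
    · rintro ⟨g, hg, hp⟩
      obtain ⟨hgb, hA⟩ := mem_sep.1 hg
      exact (mem_rec_iff hM v hv p).2 ⟨g, hM.mem_of_mem hgb hb, hA, hp⟩
  rw [this]
  exact hM.sUnion' _ hc

theorem dt_rec_var [ht : DT TM0 t] :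
    DT TM0 (fun v => Rec (v 0) (v 1) (fun x g => t (scons x (scons g v)))) := by
  refine ⟨fun M hM v hv => Rec_mem (t := t) hM v hv, ?_⟩
  have h1 : Dfn TM0 (fun M v => Appr (v 2) (v 3)
      (fun x g => t (scons x (scons g (fun n => v (n + 1 + 1))))) (v 0)) :=
    ((dfn_appr_var (t := t)).ren (fun n => if n = 0 then 0 else n + 1)).congr
      fun M _ v _ => by simp
  have h2 : Dfn TM0 (fun M v => Appr (v 2) (v 3)
      (fun x g => t (scons x (scons g (fun n => v (n + 1 + 1))))) (v 0) ∧ v 1 ∈ v 0) := inferInstance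
  have h3 : Dfn TM0 (fun M v => ∃ g ∈ M, Appr (v 1) (v 2)
      (fun x g => t (scons x (scons g (fun n => v (n + 1))))) g ∧ v 0 ∈ g) :=
    Dfn.ex (h := h2)
  exact h3.congr fun M hM v hv => (mem_rec_iff (t := t) hM (fun n => v (n + 1)) (fun n => hv _) (v 0)).symm

instance dt_rec {s q : (ℕ → ZFSet.{u}) → ZFSet.{u}} [hs : DT TM0 s] [hq : DT TM0 q]
    {G : (ℕ → ZFSet.{u}) → ZFSet.{u} → ZFSet.{u} → ZFSet.{u}}
    [hG : DT TM0 (fun v => G (fun n => v (n + 1 + 1)) (v 0) (v 1))] :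
    DT TM0 (fun v => Rec (s v) (q v) (fun x g => G v x g)) := by
  have h1 : DT TM0 (fun v => G (fun n => v (n + 4)) (v 0) (v 1)) :=
    hG.ren (fun n => Nat.casesOn n 0 (fun n => Nat.casesOn n 1 (fun n => n + 4)))
  have h2 := dt_rec_var (t := fun v => G (fun n => v (n + 4)) (v 0) (v 1))
  have h3 := h2.comp (fun i => Nat.casesOn i s (fun i => Nat.casesOn i q (fun i v => v i))) (by
        rintro (_ | _ | n)
        · exact hs
        · exact hq
        · exact DT.var n)
  exact h3

end rec

/-! collapse -/

/-- collapsing map of the well-founded part of `r` on `a` -/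
def Col (a r : ZFSet.{u}) : ZFSet.{u} := Rec a r (fun _ g => ran g)

instance dt_col {s q : (ℕ → ZFSet.{u}) → ZFSet.{u}} [hs : DT TM0 s] [hq : DT TM0 q] :
    DT TM0 (fun v => Col (s v) (q v)) := by
  unfold Col; infer_instance

theorem isZFunc_Col (a r : ZFSet.{u}) : IsZFunc (Wf a r) (Col a r) := isZFunc_lam _ _

theorem Wf_down {a r x y : ZFSet.{u}} (hx : x ∈ Wf a r) (hy : y ∈ a) (h : pair y x ∈ r) :
    y ∈ Wf a r := mem_sep.2 ⟨hy, (mem_sep.1 hx).2.inv ⟨hy, h⟩⟩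

theorem mem_fapp_Col {a r x z : ZFSet.{u}} (hx : x ∈ Wf a r) :
    z ∈ fapp (Col a r) x ↔ ∃ y ∈ a, pair y x ∈ r ∧ z = fapp (Col a r) y := by
  rw [Col, Rec, fapp_lam hx, recF_eq (mem_sep.1 hx).2, mem_ran_lam]
  constructor
  · rintro ⟨y, hy, rfl⟩
    refine ⟨y, (mem_prd.1 hy).1, (mem_prd.1 hy).2, ?_⟩
    rw [fapp_lam (Wf_down hx (mem_prd.1 hy).1 (mem_prd.1 hy).2)]
  · rintro ⟨y, hy, h, rfl⟩
    refine ⟨y, mem_prd.2 ⟨hy, h⟩, ?_⟩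
    rw [fapp_lam (Wf_down hx hy h)]

/-- uniqueness of collapses -/
theorem Col_unique {a r : ZFSet.{u}} {c : ZFSet.{u} → ZFSet.{u}}
    (hc : ∀ x ∈ a, ∀ z, z ∈ c x ↔ ∃ y ∈ a, pair y x ∈ r ∧ z = c y) :
    Wf a r = a ∧ ∀ x ∈ a, fapp (Col a r) x = c x := by
  have h1 : ∀ z, ∀ x ∈ a, c x = z → Acc (RR a r) x := by
    intro z
    induction z using ZFSet.inductionOn with
    | _ z ih =>
      intro x hx hz
      refine ⟨x, fun y hy => ih (c y) ?_ y hy.1 rfl⟩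
      rw [← hz, hc x hx]
      exact ⟨y, hy.1, hy.2, rfl⟩
  have hW : Wf a r = a := by
    ext x; rw [Wf, mem_sep]
    exact ⟨fun h => h.1, fun h => ⟨h, h1 _ x h rfl⟩⟩
  refine ⟨hW, ?_⟩
  have h2 : ∀ z, ∀ x ∈ a, c x = z → fapp (Col a r) x = c x := by
    intro z
    induction z using ZFSet.inductionOn with
    | _ z ih =>
      intro x hx hz
      ext w
      rw [mem_fapp_Col (by rwa [hW]), hc x hx]
      refine exists_congr fun y => and_congr_right fun hy => and_congr_right fun hyx => ?_
      rw [ih (c y) (by rw [← hz, hc x hx]; exact ⟨y, hy, hyx, rfl⟩) y hy rfl]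
  intro x hx
  exact h2 _ x hx rfl

/-! recursion on `ω` -/

/-- membership relation on a set -/
def memRel (a : ZFSet.{u}) : ZFSet.{u} :=
  ZFSet.sep (fun p => ∃ x ∈ a, ∃ y ∈ a, p = pair y x ∧ y ∈ x) (zprod a a)

theorem pair_mem_memRel {a x y : ZFSet.{u}} : pair y x ∈ memRel a ↔ y ∈ a ∧ x ∈ a ∧ y ∈ x := by
  simp only [memRel, mem_sep, mem_zprod]
  constructor
  · rintro ⟨_, x', hx, y', hy, he, h⟩
    obtain ⟨rfl, rfl⟩ := pair_inj.1 he
    exact ⟨hy, hx, h⟩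
  · rintro ⟨hy, hx, h⟩; exact ⟨⟨y, hy, x, hx, rfl⟩, x, hx, y, hy, rfl, h⟩

instance dt_memRel {s : (ℕ → ZFSet.{u}) → ZFSet.{u}} [hs : DT TM0 s] :
    DT TM0 (fun v => memRel (s v)) := by
  refine DT.c1 (P := fun a => MPaper.memRel a) ?_
  unfold MPaper.memRel; infer_instance

theorem Wf_memRel (a : ZFSet.{u}) : Wf a (memRel a) = a := by
  have h1 : ∀ x, Acc (RR a (memRel a)) x := by
    intro x
    induction x using ZFSet.inductionOn with
    | _ x ih => exact ⟨x, fun y hy => ih y (pair_mem_memRel.1 hy.2).2.2⟩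
  ext x; rw [Wf, mem_sep]; exact ⟨fun h => h.1, fun h => ⟨h, h1 x⟩⟩

theorem sUnion_succ_omega {n : ZFSet.{u}} (hn : n ∈ omega.{u}) : (⋃₀ (insert n n : ZFSet)) = n := by
  have htr : ∀ n ∈ omega.{u}, n.IsTransitive := by
    refine omega_induction (by intro y hy; exact absurd hy (notMem_empty y)) ?_
    intro n hn h y hy
    rw [mem_insert_iff] at hy
    intro z hz
    rcases hy with rfl | hy
    · exact mem_insert_iff.2 (.inr hz)
    · exact mem_insert_iff.2 (.inr (h.mem_trans hz hy))
  ext y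
  rw [mem_sUnion]
  constructor
  · rintro ⟨z, hz, hy⟩
    rcases mem_insert_iff.1 hz with rfl | hz
    exacts [hy, (htr n hn).mem_trans hy hz]
  · intro hy; exact ⟨n, mem_insert _ _, hy⟩

/-- recursion on `ω` -/
def oRec (x0 : ZFSet.{u}) (S : ZFSet.{u} → ZFSet.{u}) : ZFSet.{u} :=
  Rec omega (memRel omega) (fun n g => if n = ∅ then x0 else S (fapp g (⋃₀ n)))

instance dt_oRec {s : (ℕ → ZFSet.{u}) → ZFSet.{u}} [hs : DT TM0 s]
    {S : (ℕ → ZFSet.{u}) → ZFSet.{u} → ZFSet.{u}}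
    [hS : DT TM0 (fun v => S (fun n => v (n + 1)) (v 0))] :
    DT TM0 (fun v => oRec (s v) (fun x => S v x)) := by
  have h1 : DT TM0 (fun v => S (fun n => v (n + 2)) (fapp (v 1) (⋃₀ (v 0)))) :=
    hS.comp (fun i => Nat.casesOn i (fun v => fapp (v 1) (⋃₀ (v 0))) (fun i v => v (i + 2))) (by
        rintro (_ | n)
        · exact (inferInstance : DT TM0 (fun v => fapp (v 1) (⋃₀ (v 0))))
        · exact DT.var _)
  have h2 : DT TM0 (fun v => s (fun n => v (n + 2))) := hs.ren _
  exact dt_rec (G := fun v n g => if n = ∅ then s v else S v (fapp g (⋃₀ n)))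
    (hG := dt_ite (hs := h2) (ht := h1))

theorem isZFunc_oRec (x0 : ZFSet.{u}) (S) : IsZFunc omega (oRec x0 S) := by
  have := isZFunc_lam (Wf omega (memRel omega))
    (recF omega (memRel omega) (fun n g => if n = ∅ then x0 else S (fapp g (⋃₀ n))))
  unfold oRec Rec; rwa [Wf_memRel] at this ⊢

theorem oRec_zero (x0 : ZFSet.{u}) (S) : fapp (oRec x0 S) ∅ = x0 := by
  have h : (∅ : ZFSet) ∈ Wf omega (memRel omega.{u}) := by rw [Wf_memRel]; exact omega_zero
  rw [oRec, Rec, fapp_lam h, recF_eq (mem_sep.1 h).2, if_pos rfl]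

theorem oRec_succ (x0 : ZFSet.{u}) (S) {n : ZFSet.{u}} (hn : n ∈ omega.{u}) :
    fapp (oRec x0 S) (insert n n) = S (fapp (oRec x0 S) n) := by
  have h : (insert n n : ZFSet) ∈ Wf omega (memRel omega.{u}) := by
    rw [Wf_memRel]; exact omega_succ hn
  have h' : n ∈ Wf omega (memRel omega.{u}) := by rw [Wf_memRel]; exact hn
  have hne : (insert n n : ZFSet) ≠ ∅ := fun h => notMem_empty n (h ▸ mem_insert n n)
  rw [oRec, Rec, fapp_lam h, recF_eq (mem_sep.1 h).2, if_neg hne, sUnion_succ_omega hn, fapp_lam,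
    fapp_lam h']
  exact mem_prd.2 ⟨hn, pair_mem_memRel.2 ⟨hn, omega_succ hn, mem_insert _ _⟩⟩


/-! ### Cardinal arithmetic and pairing -/

theorem IsCard.ord {κ : ZFSet.{u}} (h : IsCard κ) : κ.IsOrdinal :=
  isOrdinal_iff_forall_mem_isTransitive.2 ⟨h.1.1, fun y hy => h.1.2 y hy⟩

theorem zcard_le_of_inj {a b : ZFSet.{u}} (F : ZFSet.{u} → ZFSet.{u}) (h1 : ∀ x ∈ a, F x ∈ b)
    (h2 : ∀ x ∈ a, ∀ y ∈ a, F x = F y → x = y) : zcard a ≤ zcard b := by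
  refine Cardinal.mk_le_of_injective (f := fun x : a.toSet => (⟨F x.1, h1 _ x.2⟩ : b.toSet)) ?_
  intro x y h
  exact Subtype.ext (h2 _ x.2 _ y.2 (congrArg Subtype.val h))

theorem zcard_le_of_surj {a b : ZFSet.{u}} (F : ZFSet.{u} → ZFSet.{u})
    (h : ∀ y ∈ b, ∃ x ∈ a, F x = y) : zcard b ≤ zcard a := by
  choose! G hG using h
  exact zcard_le_of_inj G (fun x hx => (hG x hx).1) fun x hx y hy e => by
    rw [← (hG x hx).2, e, (hG y hy).2]

theorem zcard_mono {a b : ZFSet.{u}} (h : a ⊆ b) : zcard a ≤ zcard b :=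
  zcard_le_of_inj id (fun x hx => h hx) fun _ _ _ _ e => e

theorem zcard_zprod_le (a b : ZFSet.{u}) : zcard (zprod a b) ≤ zcard a * zcard b := by
  unfold zcard
  rw [Cardinal.mul_def]
  refine Cardinal.mk_le_of_surjective
    (f := fun p : a.toSet × b.toSet => (⟨pair p.1.1 p.2.1, ?_⟩ : (zprod a b).toSet)) ?_
  · exact mem_zprod.2 ⟨p.1.1, p.1.2, p.2.1, p.2.2, rfl⟩
  · rintro ⟨q, hq⟩
    obtain ⟨x, hx, y, hy, rfl⟩ := mem_zprod.1 hq
    exact ⟨(⟨x, hx⟩, ⟨y, hy⟩), rfl⟩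

theorem IsCard.mem_of_lt {κ x : ZFSet.{u}} (h : IsCard κ) (hx : x.IsOrdinal)
    (hc : zcard x < zcard κ) : x ∈ κ := by
  rcases hx.mem_or_subset h.ord with h1 | h1
  · exact h1
  · exact absurd (zcard_mono h1) (not_le.2 hc)

theorem omega_inf : Cardinal.aleph0 ≤ zcard omega.{u} := by
  let f : ℕ → ZFSet.{u} := fun n => Ordinal.toZFSet (n : Ordinal)
  have hf : ∀ n, f n ∈ omega.{u} := by
    intro n
    induction n with
    | zero => simp [f]
    | succ n ih =>
      have : f (n+1) = insert (f n) (f n) := by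
        simp only [f]; push_cast; rw [Ordinal.toZFSet_add_one]
      rw [this]; exact omega_succ ih
  have : Infinite (omega.{u}.toSet) := by
    refine Infinite.of_injective (fun n => (⟨f n, hf n⟩ : omega.{u}.toSet)) ?_
    intro n m h
    have := Ordinal.toZFSet_injective (congrArg Subtype.val h)
    exact_mod_cast this
  exact Cardinal.aleph0_le_mk _

/-- `κ` is an infinite cardinal -/
structure IC (κ : ZFSet.{u}) : Prop where
  card : IsCard κ
  inf : Cardinal.aleph0 ≤ zcard κ

theorem IC.ord {κ : ZFSet.{u}} (h : IC κ) : κ.IsOrdinal := h.card.ord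

theorem IC.succ {κ x : ZFSet.{u}} (h : IC κ) (hx : x ∈ κ) : (insert x x : ZFSet) ∈ κ := by
  refine h.card.mem_of_lt (isOrdinal_succ (h.ord.mem hx)) ?_
  have h1 : zcard (insert x x : ZFSet) ≤ zcard x + 1 := by
    have : (insert x x : ZFSet).toSet = insert x x.toSet := by
      ext y; exact mem_insert_iff
    unfold zcard
    rw [this]; exact Cardinal.mk_insert_le
  exact h1.trans_lt (Cardinal.add_lt_of_lt h.inf (h.card.2 x hx)
    (Cardinal.one_lt_aleph0.trans_le h.inf))

theorem IC.empty_mem {κ : ZFSet.{u}} (h : IC κ) : ∅ ∈ κ := by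
  refine h.card.mem_of_lt isOrdinal_empty ?_
  have : zcard (∅ : ZFSet.{u}) = 0 := by
    have : IsEmpty (∅ : ZFSet.{u}).toSet := ⟨fun x => notMem_empty x.1 x.2⟩
    exact Cardinal.mk_eq_zero _
  rw [this]; exact Cardinal.aleph0_pos.trans_le h.inf

theorem IC.omega_sub {κ : ZFSet.{u}} (h : IC κ) : omega ⊆ κ := fun n hn =>
  omega_induction (p := fun n => n ∈ κ) h.empty_mem (fun n _ hn => h.succ hn) n hn

/-- Gödel order relation -/
def gLt (a b c d : ZFSet.{u}) : Prop :=
  a ∪ b ∈ c ∪ d ∨ (a ∪ b = c ∪ d ∧ (a ∈ c ∨ (a = c ∧ b ∈ d)))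

def gOrd (κ : ZFSet.{u}) : ZFSet.{u} :=
  ZFSet.sep (fun q => ∃ a ∈ κ, ∃ b ∈ κ, ∃ c ∈ κ, ∃ d ∈ κ,
    q = pair (pair a b) (pair c d) ∧ gLt a b c d) (zprod (zprod κ κ) (zprod κ κ))

/-- the pairing function on `κ` -/
def gP (κ a b : ZFSet.{u}) : ZFSet.{u} := fapp (Col (zprod κ κ) (gOrd κ)) (pair a b)

instance dt_gOrd {s : (ℕ → ZFSet.{u}) → ZFSet.{u}} [hs : DT TM0 s] :
    DT TM0 (fun v => gOrd (s v)) := by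
  refine DT.c1 (P := gOrd) ?_
  unfold gOrd gLt; infer_instance

instance dt_gP {s t q : (ℕ → ZFSet.{u}) → ZFSet.{u}} [hs : DT TM0 s] [ht : DT TM0 t]
    [hq : DT TM0 q] : DT TM0 (fun v => gP (s v) (t v) (q v)) := by
  unfold gP; infer_instance

theorem pair_mem_gOrd {κ a b c d : ZFSet.{u}} (ha : a ∈ κ) (hb : b ∈ κ) (hc : c ∈ κ) (hd : d ∈ κ) :
    pair (pair a b) (pair c d) ∈ gOrd κ ↔ gLt a b c d := by
  constructor
  · intro h
    obtain ⟨_, a', _, b', _, c', _, d', _, e, h⟩ := mem_sep.1 h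
    simp only [pair_inj] at e
    obtain ⟨⟨rfl, rfl⟩, rfl, rfl⟩ := e
    exact h
  · intro h
    refine mem_sep.2 ⟨?_, a, ha, b, hb, c, hc, d, hd, rfl, h⟩
    exact mem_zprod.2 ⟨_, mem_zprod.2 ⟨a, ha, b, hb, rfl⟩, _, mem_zprod.2 ⟨c, hc, d, hd, rfl⟩, rfl⟩

theorem ord_union {κ a b : ZFSet.{u}} (h : κ.IsOrdinal) (ha : a ∈ κ) (hb : b ∈ κ) : a ∪ b ∈ κ := by
  rcases (h.mem ha).subset_total (h.mem hb) with h1 | h1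
  · have : a ∪ b = b := by ext x; simpa using fun hx => h1 hx
    rwa [this]
  · have : a ∪ b = a := by ext x; simpa using fun hx => h1 hx
    rwa [this]

theorem gOrd_acc {κ : ZFSet.{u}} : ∀ m a b : ZFSet.{u}, a ∈ κ → b ∈ κ → a ∪ b = m →
    Acc (RR (zprod κ κ) (gOrd κ)) (pair a b) := by
  intro m
  induction m using ZFSet.inductionOn with
  | _ m ihm =>
    intro a
    induction a using ZFSet.inductionOn with
    | _ a iha =>
      intro b
      induction b using ZFSet.inductionOn with
      | _ b ihb =>
        intro ha hb hm
        refine Acc.intro _ fun y hy => ?_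
        obtain ⟨h1, h2⟩ := hy
        obtain ⟨c, hc, d, hd, rfl⟩ := mem_zprod.1 h1
        rcases (pair_mem_gOrd hc hd ha hb).1 h2 with h3 | ⟨h3, h4 | ⟨rfl, h4⟩⟩
        · exact ihm _ (hm ▸ h3) c d hc hd rfl
        · exact iha c h4 d hc hd (h3.trans hm)
        · exact ihb d h4 hc hd (h3.trans hm)

theorem Wf_gOrd (κ : ZFSet.{u}) : Wf (zprod κ κ) (gOrd κ) = zprod κ κ := by
  ext x
  simp only [Wf, mem_sep, and_iff_left_iff_imp]
  intro hx
  obtain ⟨c, hc, d, hd, rfl⟩ := mem_zprod.1 hx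
  exact gOrd_acc _ c d hc hd rfl

theorem gLt_total {κ a b c d : ZFSet.{u}} (h : κ.IsOrdinal) (ha : a ∈ κ) (hb : b ∈ κ)
    (hc : c ∈ κ) (hd : d ∈ κ) : gLt a b c d ∨ (a = c ∧ b = d) ∨ gLt c d a b := by
  have h1 := (h.mem (ord_union h ha hb)).mem_trichotomous (h.mem (ord_union h hc hd))
  have h2 := (h.mem ha).mem_trichotomous (h.mem hc)
  have h3 := (h.mem hb).mem_trichotomous (h.mem hd)
  unfold gLt
  rcases h1 with h1 | h1 | h1
  · exact .inl (.inl h1)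
  · rcases h2 with h2 | h2 | h2
    · exact .inl (.inr ⟨h1, .inl h2⟩)
    · rcases h3 with h3 | h3 | h3
      · exact .inl (.inr ⟨h1, .inr ⟨h2, h3⟩⟩)
      · exact .inr (.inl ⟨h2, h3⟩)
      · exact .inr (.inr (.inr ⟨h1.symm, .inr ⟨h2.symm, h3⟩⟩))
    · exact .inr (.inr (.inr ⟨h1.symm, .inl h2⟩))
  · exact .inr (.inr (.inl h1))

theorem gLt_trans {κ a b c d e f : ZFSet.{u}} (h : κ.IsOrdinal) 
    (he : e ∈ κ) (hf : f ∈ κ) (h1 : gLt a b c d) (h2 : gLt c d e f) : gLt a b e f := by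
  have hE := (h.mem (ord_union h he hf))
  rcases h1 with h1 | ⟨e1, h1⟩ <;> rcases h2 with h2 | ⟨e2, h2⟩
  · exact .inl (hE.mem_trans h1 h2)
  · exact .inl (e2 ▸ h1)
  · exact .inl (e1 ▸ h2)
  · refine .inr ⟨e1.trans e2, ?_⟩
    rcases h1 with h1 | ⟨e3, h1⟩ <;> rcases h2 with h2 | ⟨e4, h2⟩
    · exact .inl ((h.mem he).mem_trans h1 h2)
    · exact .inl (e4 ▸ h1)
    · exact .inl (e3 ▸ h2)
    · exact .inr ⟨e3.trans e4, (h.mem hf).mem_trans h1 h2⟩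

theorem mem_gP {κ a b z : ZFSet.{u}} (ha : a ∈ κ) (hb : b ∈ κ) :
    z ∈ gP κ a b ↔ ∃ c ∈ κ, ∃ d ∈ κ, gLt c d a b ∧ z = gP κ c d := by
  have hx : pair a b ∈ Wf (zprod κ κ) (gOrd κ) := by
    rw [Wf_gOrd]; exact mem_zprod.2 ⟨a, ha, b, hb, rfl⟩
  rw [gP, mem_fapp_Col hx]
  constructor
  · rintro ⟨y, hy, h1, h2⟩
    obtain ⟨c, hc, d, hd, rfl⟩ := mem_zprod.1 hy
    exact ⟨c, hc, d, hd, (pair_mem_gOrd hc hd ha hb).1 h1, h2⟩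
  · rintro ⟨c, hc, d, hd, h1, h2⟩
    exact ⟨_, mem_zprod.2 ⟨c, hc, d, hd, rfl⟩, (pair_mem_gOrd hc hd ha hb).2 h1, h2⟩

theorem gP_inj {κ a b c d : ZFSet.{u}} (h : κ.IsOrdinal) (ha : a ∈ κ) (hb : b ∈ κ)
    (hc : c ∈ κ) (hd : d ∈ κ) (e : gP κ a b = gP κ c d) : a = c ∧ b = d := by
  rcases gLt_total h ha hb hc hd with h1 | h1 | h1
  · have : gP κ a b ∈ gP κ c d := (mem_gP hc hd).2 ⟨a, ha, b, hb, h1, rfl⟩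
    rw [e] at this; exact absurd this (mem_irrefl _)
  · exact h1
  · have : gP κ c d ∈ gP κ a b := (mem_gP ha hb).2 ⟨c, hc, d, hd, h1, rfl⟩
    rw [e] at this; exact absurd this (mem_irrefl _)

theorem gP_trans {κ a b : ZFSet.{u}} (h : κ.IsOrdinal) (ha : a ∈ κ) (hb : b ∈ κ) :
    (gP κ a b).IsTransitive := by
  intro z hz w hw
  obtain ⟨c, hc, d, hd, h1, rfl⟩ := (mem_gP ha hb).1 hz
  obtain ⟨e, he, f, hf, h2, rfl⟩ := (mem_gP hc hd).1 hw
  exact (mem_gP ha hb).2 ⟨e, he, f, hf, gLt_trans h ha hb h2 h1, rfl⟩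

theorem gP_mem {κ a b : ZFSet.{u}} (h : IC κ) (ha : a ∈ κ) (hb : b ∈ κ) : gP κ a b ∈ κ := by
  have ho : (gP κ a b).IsOrdinal := isOrdinal_iff_forall_mem_isTransitive.2
    ⟨gP_trans h.ord ha hb, fun z hz => by
      obtain ⟨c, hc, d, hd, h1, rfl⟩ := (mem_gP ha hb).1 hz
      exact gP_trans h.ord hc hd⟩
  refine h.card.mem_of_lt ho ?_
  have hm := h.succ (ord_union h.ord ha hb)
  set m := (insert (a ∪ b) (a ∪ b) : ZFSet) with hmd
  have h1 : zcard (gP κ a b) ≤ zcard (zprod m m) := by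
    refine zcard_le_of_surj (fapp (Col (zprod κ κ) (gOrd κ))) fun z hz => ?_
    obtain ⟨c, hc, d, hd, h1, rfl⟩ := (mem_gP ha hb).1 hz
    refine ⟨pair c d, ?_, rfl⟩
    have hu : (c ∪ d) ∈ m := by
      rw [hmd, mem_insert_iff]
      rcases h1 with h1 | h1
      · exact .inr h1
      · exact .inl h1.1
    have hmo := h.ord.mem hm
    have hx : ∀ x ∈ κ, x ⊆ c ∪ d → x ∈ m := fun x hx hs =>
      (h.ord.mem hx).mem_of_subset_of_mem hmo hs hu
    exact mem_zprod.2 ⟨c, hx c hc (by intro z hz; simp [hz]), d, hx d hd (by intro z hz; simp [hz]), rfl⟩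
  exact (h1.trans (zcard_zprod_le m m)).trans_lt
    (Cardinal.mul_lt_of_lt h.inf (h.card.2 m hm) (h.card.2 m hm))

/-- inverses -/
def gFst (κ x : ZFSet.{u}) : ZFSet.{u} := ⋃₀ ZFSet.sep (fun a => ∃ b ∈ κ, gP κ a b = x) κ
def gSnd (κ x : ZFSet.{u}) : ZFSet.{u} := ⋃₀ ZFSet.sep (fun b => ∃ a ∈ κ, gP κ a b = x) κ

instance dt_gFst {s t : (ℕ → ZFSet.{u}) → ZFSet.{u}} [hs : DT TM0 s] [ht : DT TM0 t] :
    DT TM0 (fun v => gFst (s v) (t v)) := by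
  refine DT.c2 (P := gFst) ?_
  unfold gFst; infer_instance

instance dt_gSnd {s t : (ℕ → ZFSet.{u}) → ZFSet.{u}} [hs : DT TM0 s] [ht : DT TM0 t] :
    DT TM0 (fun v => gSnd (s v) (t v)) := by
  refine DT.c2 (P := gSnd) ?_
  unfold gSnd; infer_instance

theorem gFst_gP {κ a b : ZFSet.{u}} (h : κ.IsOrdinal) (ha : a ∈ κ) (hb : b ∈ κ) :
    gFst κ (gP κ a b) = a := by
  have : ZFSet.sep (fun a' => ∃ b' ∈ κ, gP κ a' b' = gP κ a b) κ = {a} := by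
    ext x
    rw [mem_sep, mem_singleton]
    constructor
    · rintro ⟨hx, b', hb', e⟩; exact (gP_inj h hx hb' ha hb e).1
    · rintro rfl; exact ⟨ha, b, hb, rfl⟩
  rw [gFst, this, sUnion_singleton]

theorem gSnd_gP {κ a b : ZFSet.{u}} (h : κ.IsOrdinal) (ha : a ∈ κ) (hb : b ∈ κ) :
    gSnd κ (gP κ a b) = b := by
  have : ZFSet.sep (fun b' => ∃ a' ∈ κ, gP κ a' b' = gP κ a b) κ = {b} := by
    ext x
    rw [mem_sep, mem_singleton]
    constructor
    · rintro ⟨hx, b', hb', e⟩; exact (gP_inj h hb' hx ha hb e).2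
    · rintro rfl; exact ⟨hb, a, ha, rfl⟩
  rw [gSnd, this, sUnion_singleton]


/-! ### Choice inside models, the hereditary model -/

theorem choice_mem {M : ZFSet.{u}} (hM : IsTransModel M) (P : ZFSet.{u} → (ℕ → ZFSet.{u}) → Prop)
    [h : Dfn TM0 P] {a : ZFSet.{u}} (ha : a ∈ M) (v : ℕ → ZFSet.{u}) (hv : ∀ n, v n ∈ M)
    (hc : ∀ x ∈ a, ∃ y ∈ M, P M (scons x (scons y v))) :
    ∃ g ∈ M, IsZFunc a g ∧ ∀ x ∈ a, P M (scons x (scons (fapp g x) v)) := by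
  have hM0 := hM.tm0
  obtain ⟨b, hb, hbx⟩ := coll_mem hM0 P ha v hv hc
  obtain ⟨r, hr, hw⟩ := hM.2.2.2.2.2.2 b hb
  let Q : ZFSet.{u} → (ℕ → ZFSet.{u}) → Prop := fun M v =>
    ∃ x ∈ v 1, ∃ y ∈ v 2, v 0 = pair x y ∧ P M (scons x (scons y (fun n => v (n + 4)))) ∧
      ∀ z ∈ v 2, P M (scons x (scons z (fun n => v (n + 4)))) → pair z y ∉ v 3
  have hQ : Dfn TM0 Q := by
    have h1 : Dfn TM0 (fun M v => P M (scons (v 1) (scons (v 0) (fun n => v (n + 4 + 1 + 1))))) :=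
      (h.ren (fun n => if n = 0 then 1 else if n = 1 then 0 else n + 4)).congr fun M _ v _ => by
        apply Iff.of_eq; congr 1; ext (_ | _ | n) <;> simp
    have h2 : Dfn TM0 (fun M v => P M (scons (v 2) (scons (v 0) (fun n => v (n + 4 + 1 + 1 + 1))))) :=
      (h.ren (fun n => if n = 0 then 2 else if n = 1 then 0 else n + 5)).congr fun M _ v _ => by
        apply Iff.of_eq; congr 1; ext (_ | _ | n) <;> simp
    unfold Q
    infer_instance
  have hg := sep_mem hM0 Q (a := zprod a b) (DT2 hM0 zprod ha hb)
    (scons a (scons b (scons r v))) (by rintro (_ | _ | _ | n); exacts [ha, hb, hr, hv n])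
  set g := ZFSet.sep (fun x => Q M (scons x (scons a (scons b (scons r v))))) (zprod a b) with hgd
  have hgm : ∀ x y, pair x y ∈ g ↔ x ∈ a ∧ y ∈ b ∧ P M (scons x (scons y v)) ∧
      ∀ z ∈ b, P M (scons x (scons z v)) → pair z y ∉ r := by
    intro x y
    rw [hgd, mem_sep]
    constructor
    · rintro ⟨_, x', hx', y', hy', e, h1, h2⟩
      obtain ⟨rfl, rfl⟩ := pair_inj.1 e
      exact ⟨hx', hy', h1, h2⟩
    · rintro ⟨h1, h2, h3, h4⟩
      exact ⟨mem_zprod.2 ⟨x, h1, y, h2, rfl⟩, x, h1, y, h2, rfl, h3, h4⟩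
  have hfun : IsZFunc a g := by
    constructor
    · intro p hp
      obtain ⟨x, hx, y, hy, rfl⟩ := mem_zprod.1 (mem_sep.1 hp).1
      exact ⟨x, hx, y, rfl⟩
    · intro x hx
      obtain ⟨y, hy, hmin⟩ := hw.2.2.2.2 {y | y ∈ b ∧ P M (scons x (scons y v))}
        (fun y hy => hy.1) (hbx x hx)
      refine ⟨y, (hgm x y).2 ⟨hx, hy.1, hy.2, fun z hz hp => hmin z ⟨hz, hp⟩⟩, ?_⟩
      intro y' hy'
      obtain ⟨_, h1, h2, h3⟩ := (hgm x y').1 hy'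
      rcases hw.2.1 y hy.1 y' h1 with e | e | e
      · exact e.symm
      · exact absurd e (h3 y hy.1 hy.2)
      · exact absurd e (hmin y' ⟨h1, h2⟩)
  exact ⟨g, hg, hfun, fun x hx => ((hgm _ _).1 (hfun.pair_mem hx)).2.2.1⟩

theorem choiceM1 {M : ZFSet.{u}} (hM : IsTransModel M)
    (P : ZFSet.{u} → ZFSet.{u} → ZFSet.{u} → ZFSet.{u} → Prop)
    [h : Dfn TM0 (fun M v => P M (v 0) (v 1) (v 2))] {x a}
    (hx : x ∈ M) (ha : a ∈ M) (H : ∀ y ∈ x, ∃ z ∈ M, P M y z a) :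
    ∃ g ∈ M, IsZFunc x g ∧ ∀ y ∈ x, P M y (fapp g y) a :=
  choice_mem hM (fun M v => P M (v 0) (v 1) (v 2)) hx (fun _ => a) (fun _ => ha) H

theorem choiceM2 {M : ZFSet.{u}} (hM : IsTransModel M)
    (P : ZFSet.{u} → ZFSet.{u} → ZFSet.{u} → ZFSet.{u} → ZFSet.{u} → Prop)
    [h : Dfn TM0 (fun M v => P M (v 0) (v 1) (v 2) (v 3))] {x a b}
    (hx : x ∈ M) (ha : a ∈ M) (hb : b ∈ M) (H : ∀ y ∈ x, ∃ z ∈ M, P M y z a b) :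
    ∃ g ∈ M, IsZFunc x g ∧ ∀ y ∈ x, P M y (fapp g y) a b :=
  choice_mem hM (fun M v => P M (v 0) (v 1) (v 2) (v 3)) hx (scons a (fun _ => b))
    (by rintro (_ | n); exacts [ha, hb]) H

/-- `f` enumerates (a superset of) `y` -/
def EnumBy (κ f y : ZFSet.{u}) : Prop := ∀ z ∈ y, ∃ ξ ∈ κ, fapp f ξ = z

instance dfn_enumBy {s t q : (ℕ → ZFSet.{u}) → ZFSet.{u}} [hs : DT TM0 s] [ht : DT TM0 t]
    [hq : DT TM0 q] : Dfn TM0 (fun _ v => EnumBy (s v) (t v) (q v)) := by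
  refine Dfn.c3 (P := fun _ a b c => EnumBy a b c) ?_
  unfold EnumBy; infer_instance

def InH (κ M x : ZFSet.{u}) : Prop :=
  ∃ t ∈ M, t.IsTransitive ∧ x ⊆ t ∧ ∃ f ∈ M, EnumBy κ f t

def Hset (κ M : ZFSet.{u}) : ZFSet.{u} := ZFSet.sep (InH κ M) M

instance dfn_InH {s t : (ℕ → ZFSet.{u}) → ZFSet.{u}} [hs : DT TM0 s] [ht : DT TM0 t] :
    Dfn TM0 (fun M v => InH (s v) M (t v)) := by
  refine Dfn.c2 (P := fun M a b => InH a M b) ?_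
  unfold InH
  infer_instance

theorem mem_Hset {κ M x : ZFSet.{u}} : x ∈ Hset κ M ↔ x ∈ M ∧ InH κ M x := mem_sep

theorem Hset_trans {κ M : ZFSet.{u}} (hM : TM0 M) : (Hset κ M).IsTransitive := by
  intro x hx y hy
  obtain ⟨h1, t, ht, h2, h3, h4⟩ := mem_Hset.1 hx
  exact mem_Hset.2 ⟨hM.mem_of_mem hy h1, t, ht, h2, h2.subset_of_mem (h3 hy), h4⟩

theorem Hset_sub {κ M x y : ZFSet.{u}} (hx : x ∈ Hset κ M) (hy : y ∈ M) (h : y ⊆ x) :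
    y ∈ Hset κ M := by
  obtain ⟨h1, t, ht, h2, h3, h4⟩ := mem_Hset.1 hx
  exact mem_Hset.2 ⟨hy, t, ht, h2, fun z hz => h3 (h hz), h4⟩

theorem dfn_satH (φ : Fml) : Dfn TM0.{u} (fun M v => Sat (Hset (v 0) M).toSet φ (fun n => v (n+1))) := by
  induction φ with
  | mem i j => exact inferInstanceAs (Dfn TM0.{u} (fun M v => v (i+1) ∈ v (j+1)))
  | eq i j => exact inferInstanceAs (Dfn TM0.{u} (fun M v => v (i+1) = v (j+1)))
  | impl φ ψ h1 h2 => exact Dfn.impl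
  | neg φ h1 => exact Dfn.neg
  | all n φ ih =>
    have h1 : Dfn TM0.{u} (fun M v => Sat (Hset (v 1) M).toSet φ
        (Function.update (fun m => v (m + 1 + 1)) n (v 0))) :=
      (ih.ren (fun m => if m = 0 then 1 else if m = n + 1 then 0 else m + 1)).congr
        fun M _ v _ => by
          apply Iff.of_eq
          have e : (fun m => v (if m + 1 = 0 then 1 else if m + 1 = n + 1 then 0 else m + 1 + 1))
            = (Function.update (fun m => v (m + 1 + 1)) n (v 0)) := by
            ext m
            by_cases hm : m = n
            · subst hm; simp
            · simp [hm]
          simp only [if_true, e]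
    refine Dfn.congr (P := fun M v => ∀ x ∈ M, InH (v 0) M x → Sat (Hset (v 0) M).toSet φ
      (Function.update (fun m => v (m + 1)) n x)) ?_ ?_
    · exact Dfn.all (P := fun M v x => InH (v 0) M x → Sat (Hset (v 0) M).toSet φ
        (Function.update (fun m => v (m + 1)) n x)) (h := Dfn.impl (h2 := h1))
    · intro M hM v hv
      constructor
      · intro h x hx
        obtain ⟨h1, h2⟩ := mem_Hset.1 hx
        exact h x h1 h2
      · intro h x h1 h2
        exact h x (mem_Hset.2 ⟨h1, h2⟩)

theorem enum_union {κ M a b f g : ZFSet.{u}} (hκ : IC κ) (hM : TM0 M) (hκM : κ ∈ M)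
    (hf : f ∈ M) (hg : g ∈ M) (h1 : EnumBy κ f a) (h2 : EnumBy κ g b) :
    ∃ e ∈ M, EnumBy κ e (a ∪ b) := by
  refine ⟨lam κ (fun ν => if gFst κ ν = ∅ then fapp f (gSnd κ ν) else fapp g (gSnd κ ν)),
    DT3 hM (fun κ f g => lam κ (fun ν => if gFst κ ν = ∅ then fapp f (gSnd κ ν)
      else fapp g (gSnd κ ν))) hκM hf hg, ?_⟩
  intro z hz
  rcases mem_union.1 hz with hz | hz
  · obtain ⟨ξ, hξ, e⟩ := h1 z hz
    refine ⟨gP κ ∅ ξ, gP_mem hκ hκ.empty_mem hξ, ?_⟩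
    rw [fapp_lam (gP_mem hκ hκ.empty_mem hξ), gFst_gP hκ.ord hκ.empty_mem hξ,
      gSnd_gP hκ.ord hκ.empty_mem hξ, if_pos rfl, e]
  · obtain ⟨ξ, hξ, e⟩ := h2 z hz
    have h1 := hκ.succ hκ.empty_mem
    refine ⟨gP κ (insert ∅ ∅) ξ, gP_mem hκ h1 hξ, ?_⟩
    have hne : (insert ∅ ∅ : ZFSet.{u}) ≠ ∅ := by
      intro h; have : (∅ : ZFSet.{u}) ∈ (insert ∅ ∅ : ZFSet.{u}) := by simp
      rw [h] at this; exact notMem_empty _ this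
    rw [fapp_lam (gP_mem hκ h1 hξ), gFst_gP hκ.ord h1 hξ,
      gSnd_gP hκ.ord h1 hξ, if_neg hne, e]

theorem enum_sub {κ f a b : ZFSet.{u}} (h : EnumBy κ f b) (h2 : a ⊆ b) : EnumBy κ f a :=
  fun z hz => h z (h2 hz)

theorem Hset_closure {κ M y f : ZFSet.{u}} (hκ : IC κ) (hM : IsTransModel M) (hκM : κ ∈ M)
    (hy : y ∈ M) (hH : y ⊆ Hset κ M) (hf : f ∈ M) (hfy : EnumBy κ f y) : y ∈ Hset κ M := by
  have hM0 := hM.tm0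
  obtain ⟨T, hT, hTf, hTp⟩ := choiceM1 hM (fun M z t κ => t.IsTransitive ∧ z ⊆ t ∧
    ∃ f ∈ M, EnumBy κ f t) hy hκM (fun z hz => (mem_Hset.1 (hH hz)).2)
  obtain ⟨F, hF, hFf, hFp⟩ := choiceM2 hM (fun M z f κ T => EnumBy κ f (fapp T z)) hy hκM hT
    (fun z hz => (hTp z hz).2.2)
  obtain ⟨e, he, heu⟩ := enum_union (a := y) (b := ⋃₀ zimg y (fapp T)) (f := f)
    (g := lam κ (fun ν => fapp (fapp F (fapp f (gFst κ ν))) (gSnd κ ν))) hκ hM0 hκM hf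
    (DT3 hM0 (fun κ F f => lam κ (fun ν => fapp (fapp F (fapp f (gFst κ ν))) (gSnd κ ν))) hκM hF hf)
    hfy (by
      intro z hz
      obtain ⟨w, hw, hzw⟩ := mem_sUnion.1 hz
      obtain ⟨x, hx, rfl⟩ := mem_zimg.1 hw
      obtain ⟨ξ, hξ, rfl⟩ := hfy x hx
      obtain ⟨η, hη, rfl⟩ := hFp _ hx z hzw
      refine ⟨gP κ ξ η, gP_mem hκ hξ hη, ?_⟩
      rw [fapp_lam (gP_mem hκ hξ hη), gFst_gP hκ.ord hξ hη, gSnd_gP hκ.ord hξ hη])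
  refine mem_Hset.2 ⟨hy, y ∪ ⋃₀ zimg y (fapp T), DT2 hM0 (fun y T => y ∪ ⋃₀ zimg y (fapp T)) hy hT,
    ?_, ?_, e, he, heu⟩
  · intro z hz w hw
    rw [mem_union] at hz ⊢
    right
    rw [mem_sUnion]
    rcases hz with hz | hz
    · exact ⟨_, mem_zimg.2 ⟨z, hz, rfl⟩, (hTp z hz).2.1 hw⟩
    · obtain ⟨t, ht, hzt⟩ := mem_sUnion.1 hz
      obtain ⟨x, hx, rfl⟩ := mem_zimg.1 ht
      exact ⟨_, ht, (hTp x hx).1.mem_trans hw hzt⟩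
  · intro z hz; exact mem_union.2 (.inl hz)


/-! ### `M_U` is the canonical model -/

theorem enum_id {κ M x : ZFSet.{u}} (hM : TM0 M) (hκM : κ ∈ M) (h : x ⊆ κ) :
    ∃ f ∈ M, EnumBy κ f x :=
  ⟨lam κ (fun ξ => ξ), DT1 hM (fun κ => lam κ (fun ξ => ξ)) hκM, fun z hz =>
    ⟨z, h hz, fapp_lam (h hz)⟩⟩

theorem kappa_mem_Hset {κ M : ZFSet.{u}} (hκ : IC κ) (hM : TM0 M) (hκM : κ ∈ M) :
    κ ∈ Hset κ M :=
  mem_Hset.2 ⟨hκM, κ, hκM, hκ.card.1.1, fun _ h => h, enum_id hM hκM fun _ h => h⟩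

theorem Hset_transModel {κ M : ZFSet.{u}} (hκ : IC κ) (hM : IsTransModel M) (hκM : κ ∈ M) :
    IsTransModel (Hset κ M) := by
  have hM0 := hM.tm0
  have hsub : ∀ {x}, x ∈ Hset κ M → x ∈ M := fun h => (mem_Hset.1 h).1
  have hpair : ∀ x ∈ Hset κ M, ∀ y ∈ Hset κ M, ({x, y} : ZFSet) ∈ Hset κ M := by
    intro x hx y hy
    refine Hset_closure hκ hM hκM (hM.2.2.1 x (hsub hx) y (hsub hy)) ?_
      (f := lam κ (fun ξ => if ξ = ∅ then x else y))
      (DT3 hM0 (fun κ x y => lam κ (fun ξ => if ξ = ∅ then x else y)) hκM (hsub hx) (hsub hy)) ?_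
    · intro z hz
      rcases mem_pair.1 hz with rfl | rfl
      exacts [hx, hy]
    · intro z hz
      have h1 := hκ.succ hκ.empty_mem
      have hne : (insert ∅ ∅ : ZFSet.{u}) ≠ ∅ := by
        intro h; have : (∅ : ZFSet.{u}) ∈ (insert ∅ ∅ : ZFSet.{u}) := by simp
        rw [h] at this; exact notMem_empty _ this
      rcases mem_pair.1 hz with rfl | rfl
      · exact ⟨∅, hκ.empty_mem, by rw [fapp_lam hκ.empty_mem, if_pos rfl]⟩
      · exact ⟨_, h1, by rw [fapp_lam h1, if_neg hne]⟩
  have hp2 : ∀ x ∈ Hset κ M, ∀ y ∈ Hset κ M, pair x y ∈ Hset κ M := by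
    intro x hx y hy
    have h1 := hpair x hx x hx
    have h2 := hpair x hx y hy
    rw [pair_eq_singleton] at h1
    exact hpair _ h1 _ h2
  have hal : ∀ a ∈ Hset κ M, ∃ f ∈ M, EnumBy κ f a := by
    intro a ha
    obtain ⟨_, t, _, _, h1, f, hf, h2⟩ := mem_Hset.1 ha
    exact ⟨f, hf, enum_sub h2 h1⟩
  have hcl : ∀ (g a : ZFSet.{u}), g ∈ M → a ∈ Hset κ M → (∀ x ∈ a, fapp g x ∈ Hset κ M) →
      zimg a (fapp g) ∈ Hset κ M := by
    intro g a hg ha hH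
    obtain ⟨f, hf, he⟩ := hal a ha
    refine Hset_closure hκ hM hκM (DT2 hM0 (fun a g => zimg a (fapp g)) (hsub ha) hg) ?_
      (f := lam κ (fun ξ => fapp g (fapp f ξ)))
      (DT3 hM0 (fun κ g f => lam κ (fun ξ => fapp g (fapp f ξ))) hκM hg hf) ?_
    · intro z hz
      obtain ⟨x, hx, rfl⟩ := mem_zimg.1 hz
      exact hH x hx
    · intro z hz
      obtain ⟨x, hx, rfl⟩ := mem_zimg.1 hz
      obtain ⟨ξ, hξ, rfl⟩ := he x hx
      exact ⟨ξ, hξ, fapp_lam hξ⟩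
  refine ⟨Hset_trans hM0, Hset_sub (kappa_mem_Hset hκ hM0 hκM) hM.2.1 hκ.omega_sub, hpair, ?_, ?_,
    ?_, ?_⟩
  · intro x hx
    obtain ⟨h1, t, ht, h2, h3, h4⟩ := mem_Hset.1 hx
    refine mem_Hset.2 ⟨hM.2.2.2.1 x h1, t, ht, h2, ?_, h4⟩
    intro z hz
    obtain ⟨w, hw, hzw⟩ := mem_sUnion.1 hz
    exact h2.mem_trans hzw (h3 hw)
  · intro φ v hv a ha
    have := dfn_satH.{u} φ
    have h2 : Dfn TM0.{u} (fun M w => Sat (Hset (w 1) M).toSet φ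
        (fun n => if n = 0 then w 0 else w (n + 2))) :=
      (this.ren (fun n => if n = 0 then 1 else if n = 1 then 0 else n + 1)).congr fun M _ v _ => by
        apply Iff.of_eq; simp only [if_true]; congr 1; ext (_ | n) <;> simp
    refine ⟨_, Hset_sub ha (sep_mem hM0 (fun M w => Sat (Hset (w 1) M).toSet φ
        (fun n => if n = 0 then w 0 else w (n + 2))) (hsub ha) (scons κ v)
      (by rintro (_ | n); exacts [hκM, hsub (hv n)])) (fun z hz => (mem_sep.1 hz).1), ?_⟩
    intro x
    rw [mem_sep]
    refine and_congr_right fun _ => ?_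
    simp only [scons_zero, scons_succ]
    apply Iff.of_eq; congr 1; ext (_ | n) <;> simp
  · intro φ v hv a ha hc
    have := dfn_satH.{u} φ
    have h2 : Dfn TM0.{u} (fun M w => w 1 ∈ M ∧ InH (w 2) M (w 1) ∧ Sat (Hset (w 2) M).toSet φ
        (fun n => if n = 0 then w 0 else if n = 1 then w 1 else w (n + 3))) := by
      have h3 : Dfn TM0.{u} (fun M w => Sat (Hset (w 2) M).toSet φ
        (fun n => if n = 0 then w 0 else if n = 1 then w 1 else w (n + 3))) :=
        (this.ren (fun n => if n = 0 then 2 else if n = 1 then 0 else if n = 2 then 1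
          else n + 2)).congr fun M _ v _ => by
          apply Iff.of_eq; simp only [if_true]; congr 1; ext (_ | _ | n) <;> simp
      have h4 : Dfn TM0.{u} (fun M w => w 1 ∈ M) :=
        Dfn.congr (P := fun _ _ => True) inferInstance fun M hM v hv => by simp [hv 1]
      infer_instance
    have key : ∀ x y : ZFSet.{u}, (fun n => if n = 0 then x else if n = 1 then y else
        scons x (scons y (scons κ v)) (n + 3)) = Function.update (Function.update v 0 x) 1 y := by
      intro x y; ext (_ | _ | n) <;> simp
    obtain ⟨g, hg, hgf, hgp⟩ := choice_mem hM _ (hsub ha) (scons κ v)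
      (by rintro (_ | n); exacts [hκM, hsub (hv n)]) (h := h2) (by
        intro x hx
        obtain ⟨y, hy, hs⟩ := hc x hx
        obtain ⟨h5, h6⟩ := mem_Hset.1 hy
        refine ⟨y, h5, h5, h6, ?_⟩
        have := key x y
        simp only [scons_zero, scons_succ] at this ⊢
        rw [this]; exact hs)
    refine ⟨zimg a (fapp g), hcl g a hg ha (fun x hx => ?_), fun x hx => ⟨fapp g x,
      mem_zimg.2 ⟨x, hx, rfl⟩, ?_⟩⟩
    · obtain ⟨h1, h2, h3⟩ := hgp x hx
      exact mem_Hset.2 ⟨h1, h2⟩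
    · obtain ⟨h1, h2, h3⟩ := hgp x hx
      have := key x (fapp g x)
      simp only [scons_zero, scons_succ] at this h3
      rw [this] at h3; exact h3
  · intro x hx
    obtain ⟨r, hr, hw⟩ := hM.2.2.2.2.2.2 x (hsub hx)
    refine ⟨r, ?_, hw⟩
    obtain ⟨f, hf, he⟩ := hal x hx
    refine Hset_closure hκ hM hκM hr ?_
      (f := lam κ (fun ν => pair (fapp f (gFst κ ν)) (fapp f (gSnd κ ν))))
      (DT2 hM0 (fun κ f => lam κ (fun ν => pair (fapp f (gFst κ ν)) (fapp f (gSnd κ ν)))) hκM hf) ?_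
    · intro p hp
      obtain ⟨a, ha, b, hb, rfl⟩ := hw.1 p hp
      exact hp2 a ((Hset_trans hM0).mem_trans ha hx) b ((Hset_trans hM0).mem_trans hb hx)
    · intro p hp
      obtain ⟨a, ha, b, hb, rfl⟩ := hw.1 p hp
      obtain ⟨ξ, hξ, rfl⟩ := he a ha
      obtain ⟨η, hη, rfl⟩ := he b hb
      refine ⟨gP κ ξ η, gP_mem hκ hξ hη, ?_⟩
      rw [fapp_lam (gP_mem hκ hξ hη), gFst_gP hκ.ord hξ hη, gSnd_gP hκ.ord hξ hη]

/-- the relation on `κ` coded by `A` -/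
def rA (κ A : ZFSet.{u}) : ZFSet.{u} :=
  ZFSet.sep (fun q => ∃ ξ ∈ κ, ∃ η ∈ κ, q = pair ξ η ∧ gP κ ξ η ∈ A) (zprod κ κ)

instance dt_rA {s t : (ℕ → ZFSet.{u}) → ZFSet.{u}} [hs : DT TM0 s] [ht : DT TM0 t] :
    DT TM0 (fun v => rA (s v) (t v)) := by
  refine DT.c2 (P := rA) ?_
  unfold rA; infer_instance

theorem pair_mem_rA {κ A ξ η : ZFSet.{u}} :
    pair ξ η ∈ rA κ A ↔ ξ ∈ κ ∧ η ∈ κ ∧ gP κ ξ η ∈ A := by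
  rw [rA, mem_sep]
  constructor
  · rintro ⟨_, a, ha, b, hb, e, h⟩
    obtain ⟨rfl, rfl⟩ := pair_inj.1 e
    exact ⟨ha, hb, h⟩
  · rintro ⟨ha, hb, h⟩
    exact ⟨mem_zprod.2 ⟨_, ha, _, hb, rfl⟩, ξ, ha, η, hb, rfl, h⟩

/-- The canonical model of `U` -/
def Mp (κ U : ZFSet.{u}) : ZFSet.{u} :=
  ⋃₀ (zimg (ZFSet.sep (fun A => Wf κ (rA κ A) = κ) (U ∪ zimg U (fun A => compl κ A)))
    (fun A => ran (Col κ (rA κ A))))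

instance dt_Mp {s t : (ℕ → ZFSet.{u}) → ZFSet.{u}} [hs : DT TM0 s] [ht : DT TM0 t] :
    DT TM0 (fun v => Mp (s v) (t v)) := by
  refine DT.c2 (P := Mp) ?_
  unfold Mp; infer_instance

theorem mem_Mp {κ U x : ZFSet.{u}} : x ∈ Mp κ U ↔
    ∃ A, (A ∈ U ∨ ∃ B ∈ U, A = compl κ B) ∧ Wf κ (rA κ A) = κ ∧
      ∃ η ∈ κ, x = fapp (Col κ (rA κ A)) η := by
  rw [Mp, mem_sUnion]
  constructor
  · rintro ⟨z, hz, hx⟩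
    obtain ⟨A, hA, rfl⟩ := mem_zimg.1 hz
    obtain ⟨h1, h2⟩ := mem_sep.1 hA
    rw [mem_union, mem_zimg] at h1
    obtain ⟨η, hη, e⟩ := (isZFunc_Col _ _).mem_ran.1 hx
    exact ⟨A, h1, h2, η, h2 ▸ hη, e⟩
  · rintro ⟨A, h1, h2, η, hη, e⟩
    refine ⟨_, mem_zimg.2 ⟨A, mem_sep.2 ⟨?_, h2⟩, rfl⟩, (isZFunc_Col _ _).mem_ran.2 ⟨η, ?_, e⟩⟩
    · rw [mem_union, mem_zimg]; exact h1
    · rw [h2]; exact hη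

theorem Mp_sub {κ U M : ZFSet.{u}} (hM : TM0 M) (hκM : κ ∈ M) (hU : ∀ A ∈ U, A ∈ M) :
    Mp κ U ⊆ M := by
  intro x hx
  obtain ⟨A, hA, h2, η, hη, rfl⟩ := mem_Mp.1 hx
  have hAM : A ∈ M := by
    rcases hA with h | ⟨B, hB, rfl⟩
    · exact hU A h
    · exact DT2 hM (fun κ B => compl κ B) hκM (hU B hB)
  exact hM.fapp_mem (DT2 hM (fun κ A => Col κ (rA κ A)) hκM hAM) (isZFunc_Col _ _)
    (by rw [h2]; exact hη)

theorem compl_compl' {κ A : ZFSet.{u}} (h : A ⊆ κ) : compl κ (compl κ A) = A := by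
  ext x
  simp only [compl, mem_sep, not_and, not_not]
  exact ⟨fun ⟨h1, h2⟩ => h2 h1, fun hx => ⟨h hx, fun _ => hx⟩⟩

theorem compl_sub {κ A : ZFSet.{u}} : compl κ A ⊆ κ := fun x hx => (mem_sep.1 hx).1

theorem subset_mem_iff {κ M U A : ZFSet.{u}} (hM : TM0 M) (hκM : κ ∈ M) (hU : IsMUltrafilter κ M U)
    (hA : A ⊆ κ) : A ∈ M ↔ A ∈ U ∨ compl κ A ∈ U := by
  constructor
  · intro h; exact hU.2.2.2.2.2.1 A h hA
  · rintro (h | h)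
    · exact (hU.1 A h).1
    · rw [← compl_compl' hA]
      exact DT2 hM (fun κ B => compl κ B) hκM (hU.1 _ h).1

theorem Hset_sub_Mp {κ M U : ZFSet.{u}} (hκ : IC κ) (hM : TM0 M) (hκM : κ ∈ M)
    (hU : IsMUltrafilter κ M U) : Hset κ M ⊆ Mp κ U := by
  intro x hx
  obtain ⟨h1, t, ht, h2, h3, f, hf, h4⟩ := mem_Hset.1 hx
  -- transitive set containing x and ∅
  set t' := (t ∪ {∅}) ∪ {x} with ht'd
  have he : (∅ : ZFSet) ∈ M := DT1 hM (fun _ => ∅) hκM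
  have ht' : t' ∈ M := DT2 hM (fun t x => (t ∪ {∅}) ∪ {x}) ht h1
  have htr : t'.IsTransitive := by
    intro y hy z hz
    simp only [ht'd, mem_union, mem_singleton] at hy ⊢
    rcases hy with (hy | rfl) | rfl
    · exact .inl (.inl (h2.mem_trans hz hy))
    · exact absurd hz (notMem_empty _)
    · exact .inl (.inl (h3 hz))
  have hcst : ∀ y ∈ M, ∃ g ∈ M, EnumBy κ g {y} := fun y hy =>
    ⟨lam κ (fun _ => y), DT2 hM (fun κ y => lam κ (fun _ => y)) hκM hy, fun z hz =>
      ⟨∅, hκ.empty_mem, by rw [fapp_lam hκ.empty_mem, mem_singleton.1 hz]⟩⟩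
  obtain ⟨g1, hg1, he1⟩ := hcst ∅ he
  obtain ⟨g2, hg2, he2⟩ := hcst x h1
  obtain ⟨e1, hee1, he3⟩ := enum_union hκ hM hκM hf hg1 h4 he1
  obtain ⟨e, hee, he4⟩ := enum_union hκ hM hκM hee1 hg2 he3 he2
  have het : (∅ : ZFSet) ∈ t' := by simp [ht'd]
  let c : ZFSet → ZFSet := fun ξ => if fapp e ξ ∈ t' then fapp e ξ else ∅
  have hct : ∀ ξ, c ξ ∈ t' := by
    intro ξ; simp only [c]; split_ifs with h; exacts [h, het]
  have hcs : ∀ z ∈ t', ∃ ξ ∈ κ, c ξ = z := by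
    intro z hz
    obtain ⟨ξ, hξ, h⟩ := he4 z hz
    exact ⟨ξ, hξ, by simp only [c]; rw [h, if_pos hz]⟩
  let A := ZFSet.sep (fun ν => c (gFst κ ν) ∈ c (gSnd κ ν)) κ
  have hA : A ∈ M := DT3 hM (fun κ e t' => ZFSet.sep (fun ν =>
    (if fapp e (gFst κ ν) ∈ t' then fapp e (gFst κ ν) else ∅) ∈
    (if fapp e (gSnd κ ν) ∈ t' then fapp e (gSnd κ ν) else ∅)) κ) hκM hee ht'
  have hAκ : A ⊆ κ := fun x hx => (mem_sep.1 hx).1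
  have hr : ∀ ξ ∈ κ, ∀ η ∈ κ, (pair ξ η ∈ rA κ A ↔ c ξ ∈ c η) := by
    intro ξ hξ η hη
    rw [pair_mem_rA, mem_sep, gFst_gP hκ.ord hξ hη, gSnd_gP hκ.ord hξ hη]
    exact ⟨fun h => h.2.2.2, fun h => ⟨hξ, hη, gP_mem hκ hξ hη, h⟩⟩
  obtain ⟨hw, hc⟩ := Col_unique (a := κ) (r := rA κ A) (c := c) (by
    intro η hη z
    constructor
    · intro hz
      obtain ⟨ξ, hξ, rfl⟩ := hcs z (htr.mem_trans hz (hct η))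
      exact ⟨ξ, hξ, (hr ξ hξ η hη).2 hz, rfl⟩
    · rintro ⟨ξ, hξ, h, rfl⟩
      exact (hr ξ hξ η hη).1 h)
  obtain ⟨η, hη, hx'⟩ := hcs x (by simp [ht'd])
  refine mem_Mp.2 ⟨A, ?_, hw, η, hη, by rw [hc η hη, hx']⟩
  rcases (subset_mem_iff hM hκM hU hAκ).1 hA with h | h
  · exact .inl h
  · exact .inr ⟨_, h, (compl_compl' hAκ).symm⟩

theorem IsMUltrafilter.Hset {κ M U : ZFSet.{u}} (hκ : IC κ) (hM : TM0 M) (hκM : κ ∈ M)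
    (hU : IsMUltrafilter κ M U) : IsMUltrafilter κ (Hset κ M) U := by
  have hsub : ∀ {x}, x ∈ MPaper.Hset κ M → x ∈ M := fun h => (mem_Hset.1 h).1
  obtain ⟨h1, h2, h3, h4, h5, h6, h7⟩ := hU
  refine ⟨fun A hA => ⟨Hset_sub (kappa_mem_Hset hκ hM hκM) (h1 A hA).1 (h1 A hA).2, (h1 A hA).2⟩,
    h2, h3, h4, ?_, ?_, ?_⟩
  · intro A hA B hB; exact h5 A hA B (hsub hB)
  · intro B hB; exact h6 B (hsub hB)
  · intro f hf; exact h7 f (hsub hf)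

theorem IsWeakModel.ic {κ M : ZFSet.{u}} (hκ : IsCard κ) (h : IsWeakModel κ M) : IC κ :=
  ⟨hκ, h.2.2 ▸ omega_inf.trans (zcard_mono (fun x hx => h.1.1.mem_trans hx h.1.2.1))⟩

theorem IsMUModel.eq_Mp {κ U M : ZFSet.{u}} (hκ : IsCard κ) (h : IsMUModel κ U M) :
    M = Mp κ U := by
  have hi := h.1.ic hκ
  have hM0 := h.1.1.tm0
  have h1 : M ⊆ Hset κ M := h.2.2.2 _ (Hset_transModel hi h.1.1 h.1.2.1)
    (kappa_mem_Hset hi hM0 h.1.2.1) (h.2.2.1.Hset hi hM0 h.1.2.1)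
  ext x
  exact ⟨fun hx => Hset_sub_Mp hi hM0 h.1.2.1 h.2.2.1 (h1 hx),
    fun hx => Mp_sub hM0 h.1.2.1 (fun A hA => (h.2.2.1.1 A hA).1) hx⟩

theorem IsSUMeasure.isMU {κ U : ZFSet.{u}} (h : IsSUMeasure κ U) : IsMUModel κ U (MU κ U) := by
  rw [MU, dif_pos h.2.2]; exact h.2.2.choose_spec

theorem IsSUMeasure.MU_eq {κ U : ZFSet.{u}} (hκ : IsCard κ) (h : IsSUMeasure κ U) :
    MU κ U = Mp κ U := h.isMU.eq_Mp hκ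

theorem omega_mem_kappa {κ M U : ZFSet.{u}} (hκ : IC κ) (hM : TM0 M) (hκM : κ ∈ M)
    (hU : IsMUltrafilter κ M U) : omega ∈ κ := by
  by_contra hn
  have hsub : ∀ n ∈ κ, n ∈ omega.{u} := by
    intro n
    induction n using ZFSet.inductionOn with
    | _ n ih =>
      intro hn'
      by_contra hno
      apply hn
      have hs : omega ⊆ n := fun m hm => omega_induction (p := fun m => m ∈ n) (by
        rcases (isOrdinal_empty).mem_trichotomous (hκ.ord.mem hn') with h | h | h
        · exact h
        · exact absurd (h ▸ omega_zero) hno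
        · exact absurd h (notMem_empty _)) (fun m hm hmn => by
          rcases (isOrdinal_succ (hκ.ord.mem (hκ.omega_sub hm))).mem_trichotomous (hκ.ord.mem hn')
            with h | h | h
          · exact h
          · exact absurd (h ▸ omega_succ hm) hno
          · rcases mem_insert_iff.1 h with h | h
            · exact absurd (h ▸ hm) hno
            · exact absurd hmn (fun h' => mem_asymm h h')) m hm
      have : n = omega := by
        ext m
        exact ⟨fun hm => ih m hm (hκ.ord.mem_trans hm hn'), fun hm => hs hm⟩
      rwa [← this]
  have h1 := hκ.succ hκ.empty_mem
  obtain ⟨γ, hγ, h⟩ := hU.2.2.2.2.2.2 (lam κ (fun ξ => ⋃₀ ξ)) (DT1 hM (fun κ => lam κ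
    (fun ξ => (⋃₀ ξ : ZFSet))) hκM) (isZFunc_lam _ _) (by
      refine hU.2.2.2.2.1 _ (hU.2.1 _ h1) _ (DT1 hM (fun κ => ZFSet.sep (fun ξ =>
        fapp (lam κ (fun ξ => (⋃₀ ξ : ZFSet))) ξ ∈ ξ) κ) hκM) (fun x hx => (mem_sep.1 hx).1) ?_
      intro ξ hξ
      obtain ⟨h2, h3⟩ := mem_sep.1 hξ
      refine mem_sep.2 ⟨h2, ?_⟩
      rw [fapp_lam h2]
      rcases omega_pred (hsub ξ h2) with rfl | ⟨m, hm, rfl⟩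
      · simp at h3
      · rw [sUnion_succ_omega hm]; simp)
  have h2 := hκ.succ (hκ.succ hγ)
  have h3 := hU.2.2.2.1 _ h _ (hU.2.1 _ h2)
  apply hU.2.2.1
  convert h3
  symm
  rw [eq_empty]
  intro ξ hξ
  obtain ⟨h4, h5⟩ := mem_inter.1 hξ
  obtain ⟨h6, h7⟩ := mem_sep.1 h4
  obtain ⟨_, h8⟩ := mem_sep.1 h5
  rw [fapp_lam h6] at h7
  rcases omega_pred (hsub ξ h6) with rfl | ⟨m, hm, rfl⟩
  · apply h8
    rcases (isOrdinal_empty).mem_trichotomous (hκ.ord.mem h2) with h | h | h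
    · exact h
    · have : γ ∈ (insert (insert γ γ) (insert γ γ) : ZFSet) := by simp
      rw [← h] at this; exact absurd this (notMem_empty _)
    · exact absurd h (notMem_empty _)
  · rw [sUnion_succ_omega hm] at h7
    subst h7
    apply h8; simp


/-! ### elementary embeddings between transitive sets -/

structure El (M N : ZFSet.{u}) (j : ZFSet.{u} → ZFSet.{u}) : Prop where
  tm : TM0 M
  tn : N.IsTransitive
  maps : ∀ x ∈ M, j x ∈ N
  el : ∀ (φ : Fml) (v : ℕ → ZFSet.{u}), (∀ n, v n ∈ M) →
    (Sat M.toSet φ v ↔ Sat N.toSet φ (fun n => j (v n)))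

abbrev Tr : ZFSet.{u} → Prop := fun M => M.IsTransitive

theorem El.cl {M N : ZFSet.{u}} {j} (h : El M N j)
    (P : ZFSet.{u} → (ℕ → ZFSet.{u}) → Prop) [hP : Dfn Tr P]
    (H : ∀ v, (∀ n, v n ∈ M) → P M v) : ∀ v, (∀ n, v n ∈ N) → P N v := by
  obtain ⟨φ, hφ⟩ := hP.out
  obtain ⟨ψ, hψ⟩ := exists_closure.{u} φ
  have h1 : Sat M.toSet ψ (fun _ => omega) := (hψ M.toSet _ (fun _ => h.tm.omega_mem)).2
    fun w hw => (hφ M h.tm.trans w hw).2 (H w hw)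
  rw [h.el ψ _ (fun _ => h.tm.omega_mem),
    hψ N.toSet _ (fun _ => h.maps _ h.tm.omega_mem)] at h1
  intro v hv
  exact (hφ N h.tn v hv).1 (h1 v hv)

theorem omega_char {x : ZFSet.{u}} (h1 : ∃ y ∈ x, ∀ w ∈ y, ¬ w = w)
    (h2 : ∀ y ∈ x, ∃ z ∈ x, (∀ w ∈ z, w ∈ y ∨ w = y) ∧ y ⊆ z ∧ y ∈ z)
    (h3 : ∀ y ∈ x, (∀ w ∈ y, ¬ w = w) ∨ ∃ z ∈ x, (∀ w ∈ y, w ∈ z ∨ w = z) ∧ z ⊆ y ∧ z ∈ y) :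
    x = omega := by
  have e0 : ∀ y : ZFSet.{u}, (∀ w ∈ y, ¬ w = w) → y = ∅ := fun y hy =>
    (eq_empty _).2 fun w hw => hy w hw rfl
  have e1 : ∀ y z : ZFSet.{u}, (∀ w ∈ z, w ∈ y ∨ w = y) → y ⊆ z → y ∈ z → z = insert y y := by
    intro y z h1 h2 h3
    ext w; rw [mem_insert_iff]
    exact ⟨fun hw => (h1 w hw).symm, fun hw => hw.elim (fun e => e ▸ h3) (fun e => h2 e)⟩
  ext y
  constructor
  · induction y using ZFSet.inductionOn with
    | _ y ih =>
      intro hy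
      rcases h3 y hy with h | ⟨z, hz, h, h', h''⟩
      · rw [e0 y h]; exact omega_zero
      · rw [e1 z y h h' h'']; exact omega_succ (ih z h'' hz)
  · intro hy
    refine omega_induction (p := fun y => y ∈ x) ?_ ?_ y hy
    · obtain ⟨y, hy, h⟩ := h1; rw [← e0 y h]; exact hy
    · intro n _ hn
      obtain ⟨z, hz, h, h', h''⟩ := h2 n hn
      rw [← e1 n z h h' h'']; exact hz

theorem El.omega {M N : ZFSet.{u}} {j} (h : El M N j) : j omega = omega.{u} := by
  have key : Dfn Tr.{u} (fun M v => (∃ y ∈ v 0, ∀ w ∈ y, ¬ w = w) ∧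
    (∀ y ∈ v 0, ∃ z ∈ v 0, (∀ w ∈ z, w ∈ y ∨ w = y) ∧ y ⊆ z ∧ y ∈ z) ∧
    (∀ y ∈ v 0, (∀ w ∈ y, ¬ w = w) ∨ ∃ z ∈ v 0, (∀ w ∈ y, w ∈ z ∨ w = z) ∧ z ⊆ y ∧ z ∈ y)) :=
    inferInstance
  have h1 := (key.transfer h.tm.trans h.tn h.maps h.el (fun _ => ZFSet.omega)
    (fun _ => h.tm.omega_mem)).1 ?_
  · exact omega_char h1.1 h1.2.1 h1.2.2
  refine ⟨⟨∅, omega_zero, fun w hw => absurd hw (notMem_empty _)⟩, fun y hy => ⟨insert y y,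
    omega_succ hy, ?_, ?_, by simp⟩, fun y hy => ?_⟩
  · intro w hw; rw [mem_insert_iff] at hw; exact hw.symm
  · intro w hw; rw [mem_insert_iff]; exact .inr hw
  · rcases omega_pred hy with rfl | ⟨m, hm, rfl⟩
    · exact .inl fun w hw => absurd hw (notMem_empty _)
    · refine .inr ⟨m, hm, ?_, ?_, by simp⟩
      · intro w hw; rw [mem_insert_iff] at hw; exact hw.symm
      · intro w hw; rw [mem_insert_iff]; exact .inr hw

theorem El.tm0 {M N : ZFSet.{u}} {j} (h : El M N j) : TM0 N := by
  have hM := h.tm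
  refine ⟨h.tn, h.omega ▸ h.maps _ hM.omega_mem, ?_, ?_, ?_, ?_⟩
  · intro x hx y hy
    obtain ⟨z, hz, h1, h2, h3⟩ := h.cl (fun M v => ∃ z ∈ M, v 0 ∈ z ∧ v 1 ∈ z ∧ ∀ w ∈ z, w = v 0 ∨ w = v 1)
      (fun v hv => ⟨_, hM.pair' _ (hv 0) _ (hv 1), by simp, by simp, fun w hw => by simpa using hw⟩)
      (scons x (fun _ => y)) (by rintro (_ | n); exacts [hx, hy])
    have : ({x, y} : ZFSet) = z := by
      ext w; rw [mem_pair]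
      exact ⟨fun hw => hw.elim (fun e => e ▸ h1) (fun e => e ▸ h2), fun hw => h3 w hw⟩
    rwa [this]
  · intro x hx
    obtain ⟨z, hz, h1, h2⟩ := h.cl (fun M v => ∃ z ∈ M, (∀ y ∈ v 0, y ⊆ z) ∧
      ∀ w ∈ z, ∃ y ∈ v 0, w ∈ y)
      (fun v hv => ⟨_, hM.sUnion' _ (hv 0), fun y hy w hw => mem_sUnion.2 ⟨y, hy, hw⟩,
        fun w hw => mem_sUnion.1 hw⟩) (fun _ => x) (fun _ => hx)
    have : (⋃₀ x : ZFSet) = z := by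
      ext w; rw [mem_sUnion]
      exact ⟨fun ⟨y, hy, hw⟩ => h1 y hy hw, fun hw => h2 w hw⟩
    rwa [this]
  · intro φ v hv a ha
    have hd : Dfn Tr.{u} (fun M v => Sat M.toSet φ (fun i => (fun i (v : ℕ → ZFSet.{u}) =>
      if i = 0 then v 0 else v (i + 1 + 2)) i v)) :=
      Dfn.sat φ _ (fun i => by split_ifs <;> infer_instance)
    have he : ∀ (x b : ZFSet.{u}) (v : ℕ → ZFSet.{u}), (fun i => (fun i (v : ℕ → ZFSet.{u}) =>
      if i = 0 then v 0 else v (i + 1 + 2)) i (scons x (scons b v))) =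
      Function.update (fun n => v (n + 1)) 0 x := by
      intro x b v; ext (_ | n) <;> simp
    obtain ⟨b, hb, h1⟩ := h.cl (fun M v => ∃ b ∈ M, ∀ x ∈ M, (x ∈ b ↔ x ∈ v 0 ∧
      Sat M.toSet φ (fun i => (fun i (v : ℕ → ZFSet.{u}) =>
      if i = 0 then v 0 else v (i + 1 + 2)) i (scons x (scons b v)))))
      (hP := by
        have : Dfn Tr.{u} (fun M v => v 0 ∈ v 1 ↔ (v 0 ∈ v 2 ∧ Sat M.toSet φ
          (fun i => (fun i (v : ℕ → ZFSet.{u}) => if i = 0 then v 0 else v (i + 1 + 2)) i v))) :=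
          inferInstance
        refine Dfn.ex (h := Dfn.all (h := this.congr fun M _ v _ => ?_))
        have e : scons (v 0) (scons (v 1) (fun n => v (n + 2))) = v := by
          ext (_ | _ | n) <;> rfl
        simp only [e])
      (fun v hv => by
        obtain ⟨b, hb, h1⟩ := hM.sep' φ (fun n => v (n + 1)) (fun n => hv _) (v 0) (hv 0)
        refine ⟨b, hb, fun x hx => ?_⟩
        rw [h1, he]) (scons a v) (by rintro (_ | n); exacts [ha, hv n])
    refine ⟨b, hb, fun x => ?_⟩
    constructor
    · intro hx
      have := (h1 x (h.tn.mem_trans hx hb)).1 hx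
      rwa [he] at this
    · intro hx
      refine (h1 x (h.tn.mem_trans hx.1 ha)).2 ?_
      rwa [he]
  · intro φ v hv a ha hc
    have hd : Dfn Tr.{u} (fun M v => Sat M.toSet φ (fun i => (fun i (v : ℕ → ZFSet.{u}) =>
      if i = 0 then v 1 else if i = 1 then v 0 else v (i + 1 + 2)) i v)) :=
      Dfn.sat φ _ (fun i => by split_ifs <;> infer_instance)
    have hd2 : Dfn Tr.{u} (fun M v => Sat M.toSet φ (fun i => (fun i (v : ℕ → ZFSet.{u}) =>
      if i = 0 then v 1 else if i = 1 then v 0 else v (i + 1 + 2)) i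
        (scons (v 0) (scons (v 1) (fun n => v (n + 2)))))) := hd.congr fun M _ v _ => by
        have e : scons (v 0) (scons (v 1) (fun n => v (n + 2))) = v := by
          ext (_ | _ | n) <;> rfl
        simp only [e]
    have hd3 : Dfn Tr.{u} (fun M v => Sat M.toSet φ (fun i => (fun i (v : ℕ → ZFSet.{u}) =>
      if i = 0 then v 1 else if i = 1 then v 0 else v (i + 1 + 2)) i
        (scons (v 0) (scons (v 1) (fun n => v (n + 3)))))) :=
        (hd2.ren (fun n => if n = 0 then 0 else if n = 1 then 1 else n + 1)).congr fun M _ v _ => by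
          simp
    have he : ∀ (x y : ZFSet.{u}) (v : ℕ → ZFSet.{u}), (fun i => (fun i (v : ℕ → ZFSet.{u}) =>
      if i = 0 then v 1 else if i = 1 then v 0 else v (i + 1 + 2)) i (scons y (scons x v))) =
      Function.update (Function.update (fun n => v (n + 1)) 0 x) 1 y := by
      intro x b v; ext (_ | _ | n) <;> simp
    obtain ⟨b, hb, h1⟩ := h.cl (fun M v => (∀ x ∈ v 0, ∃ y ∈ M, Sat M.toSet φ
      (fun i => (fun i (v : ℕ → ZFSet.{u}) =>
      if i = 0 then v 1 else if i = 1 then v 0 else v (i + 1 + 2)) i (scons y (scons x v)))) →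
       ∃ b ∈ M, (∀ x ∈ v 0, ∃ y ∈ b, Sat M.toSet φ
      (fun i => (fun i (v : ℕ → ZFSet.{u}) =>
      if i = 0 then v 1 else if i = 1 then v 0 else v (i + 1 + 2)) i (scons y (scons x v)))))
      (hP := by
        refine @Dfn.impl _ _ _ (Dfn.ball (h := Dfn.ex (h := hd2))) (Dfn.ex (h := Dfn.ball (h :=
          Dfn.bex (h := hd3)))))
      (fun v hv => by
        intro hc
        obtain ⟨b, hb, h1⟩ := hM.coll' φ (fun n => v (n + 1)) (fun n => hv _) (v 0) (hv 0) (by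
          intro x hx
          obtain ⟨y, hy, h⟩ := hc x hx
          exact ⟨y, hy, by rwa [he] at h⟩)
        refine ⟨b, hb, fun x hx => ?_⟩
        obtain ⟨y, hy, h⟩ := h1 x hx
        exact ⟨y, hy, by rwa [he]⟩) (scons a v) (by rintro (_ | n); exacts [ha, hv n]) (by
          intro x hx
          obtain ⟨y, hy, h⟩ := hc x hx
          exact ⟨y, hy, by rw [he]; exact h⟩)
    refine ⟨b, hb, fun x hx => ?_⟩
    obtain ⟨y, hy, h⟩ := h1 x hx
    rw [he] at h
    exact ⟨y, hy, h⟩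


/-! ### transfer along an elementary embedding, ultrapowers -/

section tr
variable {M N : ZFSet.{u}} {j : ZFSet.{u} → ZFSet.{u}} (h : El M N j)

theorem El.tr (h : El M N j) (P : ZFSet.{u} → (ℕ → ZFSet.{u}) → Prop) [hP : Dfn TM0 P]
    (v : ℕ → ZFSet.{u}) (hv : ∀ n, v n ∈ M) : P M v ↔ P N (fun n => j (v n)) :=
  hP.transfer h.tm h.tm0 h.maps h.el v hv

theorem El.tr1 (h : El M N j) (P : ZFSet.{u} → ZFSet.{u} → Prop) [hP : Dfn TM0 (fun M v => P M (v 0))]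
    {a : ZFSet.{u}} (ha : a ∈ M) : P M a ↔ P N (j a) :=
  h.tr (fun M v => P M (v 0)) (fun _ => a) (fun _ => ha)

theorem El.tr2 (h : El M N j) (P : ZFSet.{u} → ZFSet.{u} → ZFSet.{u} → Prop)
    [hP : Dfn TM0 (fun M v => P M (v 0) (v 1))]
    {a b : ZFSet.{u}} (ha : a ∈ M) (hb : b ∈ M) : P M a b ↔ P N (j a) (j b) :=
  h.tr (fun M v => P M (v 0) (v 1)) (scons a (fun _ => b)) (by rintro (_ | n); exacts [ha, hb])

theorem El.tr3 (h : El M N j) (P : ZFSet.{u} → ZFSet.{u} → ZFSet.{u} → ZFSet.{u} → Prop)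
    [hP : Dfn TM0 (fun M v => P M (v 0) (v 1) (v 2))]
    {a b c : ZFSet.{u}} (ha : a ∈ M) (hb : b ∈ M) (hc : c ∈ M) :
    P M a b c ↔ P N (j a) (j b) (j c) :=
  h.tr (fun M v => P M (v 0) (v 1) (v 2)) (scons a (scons b (fun _ => c)))
    (by rintro (_ | _ | n); exacts [ha, hb, hc])

theorem El.mem_iff (h : El M N j) {a b : ZFSet.{u}} (ha : a ∈ M) (hb : b ∈ M) : a ∈ b ↔ j a ∈ j b :=
  h.tr2 (fun _ a b => a ∈ b) ha hb

end tr

structure UP (κ M U N : ZFSet.{u}) (j : ZFSet.{u} → ZFSet.{u}) : Prop where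
  ic : IC κ
  mod : IsTransModel M
  kM : κ ∈ M
  uf : IsMUltrafilter κ M U
  emb : IsUltrapowerEmb κ M U N j

section up
variable {κ M U N : ZFSet.{u}} {j : ZFSet.{u} → ZFSet.{u}} (h : UP κ M U N j)

theorem UP.toEl (h : UP κ M U N j) : El M N j := ⟨h.mod.tm0, h.emb.1, h.emb.2.1, h.emb.2.2.1⟩

theorem UP.tn (h : UP κ M U N j) : TM0 N := h.toEl.tm0
theorem UP.tm (h : UP κ M U N j) : TM0 M := h.mod.tm0
theorem UP.maps (h : UP κ M U N j) {x : ZFSet.{u}} (hx : x ∈ M) : j x ∈ N := h.toEl.maps x hx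
theorem UP.seed (h : UP κ M U N j) {A : ZFSet.{u}} (hA : A ∈ M) (hs : A ⊆ κ) : A ∈ U ↔ κ ∈ j A := h.emb.2.2.2.2 A hA hs

theorem UP.kU (h : UP κ M U N j) : κ ∈ U := by
  have := h.uf.2.1 ∅ h.ic.empty_mem
  have e : tailSet κ ∅ = κ := by ext x; simp [tailSet]
  rwa [e] at this

theorem UP.k_jk (h : UP κ M U N j) : κ ∈ j κ := (h.seed h.kM (fun _ h => h)).1 h.kU
theorem UP.kN (h : UP κ M U N j) : κ ∈ N := h.tn.mem_of_mem h.k_jk (h.maps h.kM)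

theorem UP.los (h : UP κ M U N j) (P : ZFSet.{u} → (ℕ → ZFSet.{u}) → Prop) [hP : Dfn TM0 P]
    (v : ℕ → ZFSet.{u}) (hv : ∀ n, v n ∈ M) :
    ZFSet.sep (fun ξ => P M (scons ξ v)) κ ∈ U ↔ P N (scons κ (fun n => j (v n))) := by
  have hA := sep_mem h.tm P h.kM v hv
  set A := ZFSet.sep (fun ξ => P M (scons ξ v)) κ with hAd
  rw [h.seed hA (fun x hx => (mem_sep.1 hx).1)]
  have hd : Dfn TM0.{u} (fun M w => P M (scons (w 0) (fun n => w (n + 3)))) :=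
    (hP.ren (fun n => if n = 0 then 0 else n + 2)).congr fun M _ v _ => by
      apply Iff.of_eq; congr 1; ext (_ | n) <;> simp
  have h1 := (h.toEl.tr (fun M w => ∀ y ∈ M, (y ∈ w 0 ↔ y ∈ w 1 ∧ P M (scons y (fun n => w (n + 2)))))
    (scons A (scons κ v)) (by rintro (_ | _ | n); exacts [hA, h.kM, hv n])).1 (by
      intro y hy; simp [hAd])
  have h2 := h1 κ h.kN
  simp only [scons_zero, scons_succ] at h2
  rw [h2]
  exact ⟨fun h => h.2, fun h' => ⟨h.k_jk, h'⟩⟩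

theorem UP.los1 (h : UP κ M U N j) (P : ZFSet.{u} → ZFSet.{u} → ZFSet.{u} → Prop)
    [hP : Dfn TM0 (fun M v => P M (v 0) (v 1))] {a : ZFSet.{u}} (ha : a ∈ M) :
    ZFSet.sep (fun ξ => P M ξ a) κ ∈ U ↔ P N κ (j a) :=
  h.los (fun M v => P M (v 0) (v 1)) (fun _ => a) (fun _ => ha)

theorem UP.los2 (h : UP κ M U N j) (P : ZFSet.{u} → ZFSet.{u} → ZFSet.{u} → ZFSet.{u} → Prop)
    [hP : Dfn TM0 (fun M v => P M (v 0) (v 1) (v 2))] {a b : ZFSet.{u}} (ha : a ∈ M) (hb : b ∈ M) :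
    ZFSet.sep (fun ξ => P M ξ a b) κ ∈ U ↔ P N κ (j a) (j b) :=
  h.los (fun M v => P M (v 0) (v 1) (v 2)) (scons a (fun _ => b))
    (by rintro (_ | n); exacts [ha, hb])

theorem UP.surj (h : UP κ M U N j) {a : ZFSet.{u}} (ha : a ∈ N) : ∃ f ∈ M, IsZFunc κ f ∧ fapp (j f) κ = a := by
  obtain ⟨f, hf, h1, _, h2⟩ := h.emb.2.2.2.1 a ha
  exact ⟨f, hf, h1, h2⟩

theorem UP.jfun (h : UP κ M U N j) {f : ZFSet.{u}} (hf : f ∈ M) (h1 : IsZFunc κ f) : IsZFunc (j κ) (j f) :=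
  (h.toEl.tr2 (fun _ κ f => IsZFunc κ f) h.kM hf).1 h1

theorem UP.jfun_mem (h : UP κ M U N j) {f : ZFSet.{u}} (hf : f ∈ M) (h1 : IsZFunc κ f) : fapp (j f) κ ∈ N :=
  h.tn.fapp_mem (h.maps hf) (h.jfun hf h1) h.k_jk

theorem UP.U_ne (h : UP κ M U N j) {A : ZFSet.{u}} (hA : A ∈ U) : ∃ x, x ∈ A := by
  by_contra hn
  push Not at hn
  exact h.uf.2.2.1 ((eq_empty A).2 hn ▸ hA)

theorem UP.fix (h : UP κ M U N j) {ξ : ZFSet.{u}} (hξ : ξ ∈ κ) : j ξ = ξ := by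
  induction ξ using ZFSet.inductionOn with
  | _ ξ ih =>
    have hM := h.tm
    have hξM := hM.mem_of_mem hξ h.kM
    ext a
    constructor
    · intro ha
      obtain ⟨f, hf, h1, rfl⟩ := h.surj (h.tn.mem_of_mem ha (h.maps hξM))
      have hA := (h.los2 (fun _ η f ξ => fapp f η ∈ ξ) hf hξM).2 ha
      have hB := h.uf.2.2.2.1 _ hA _ (h.uf.2.1 ξ hξ)
      obtain ⟨γ, hγ, hc⟩ := h.uf.2.2.2.2.2.2 f hf h1 (by
        refine h.uf.2.2.2.2.1 _ hB _ (sepM1 hM (fun _ η f => fapp f η ∈ η) h.kM hf)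
          (fun x hx => (mem_sep.1 hx).1) ?_
        intro η hη
        obtain ⟨h2, h3⟩ := mem_inter.1 hη
        obtain ⟨h4, h5⟩ := mem_sep.1 h2
        obtain ⟨_, h6⟩ := mem_sep.1 h3
        refine mem_sep.2 ⟨h4, ?_⟩
        rcases (h.ic.ord.mem hξ).mem_trichotomous (h.ic.ord.mem h4) with h7 | h7 | h7
        · exact (h.ic.ord.mem h4).mem_trans h5 h7
        · exact h7 ▸ h5
        · exact absurd h7 h6)
      have h2 := (h.los2 (fun _ η f γ => fapp f η = γ) hf (hM.mem_of_mem hγ h.kM)).1 hc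
      obtain ⟨η, hη⟩ := h.U_ne (h.uf.2.2.2.1 _ hA _ hc)
      have h3 := (mem_sep.1 (mem_inter.1 hη).1).2
      have h4 := (mem_sep.1 (mem_inter.1 hη).2).2
      rw [h4] at h3
      rw [h2, ih γ h3 hγ]
      exact h3
    · intro ha
      have hak := h.ic.ord.mem_trans ha hξ
      rw [← ih a ha hak]
      exact (h.toEl.mem_iff (hM.mem_of_mem hak h.kM) hξM).1 ha

theorem UP.sub_mem (h : UP κ M U N j) {A : ZFSet.{u}} (hA : A ∈ M) (hs : A ⊆ κ) : A ∈ N := by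
  have : A = κ ∩ j A := by
    ext x
    rw [mem_inter]
    constructor
    · intro hx
      refine ⟨hs hx, ?_⟩
      rw [← h.fix (hs hx)]
      exact (h.toEl.mem_iff (h.tm.mem_of_mem (hs hx) h.kM) hA).1 hx
    · rintro ⟨hx, h1⟩
      rw [← h.fix hx] at h1
      exact (h.toEl.mem_iff (h.tm.mem_of_mem hx h.kM) hA).2 h1
  rw [this]
  exact DT2 h.tn (fun a b => a ∩ b) h.kN (h.maps hA)

theorem UP.mem_sub (h : UP κ M U N j) (hw : WeaklyAmenable κ M U) {A : ZFSet.{u}} (hA : A ∈ N) (hs : A ⊆ κ) :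
    A ∈ M := by
  have hM := h.tm
  obtain ⟨f, hf, h1, rfl⟩ := h.surj hA
  let F := lam κ (fun ξ => ZFSet.sep (fun η => ξ ∈ fapp f η) κ)
  have hF : F ∈ M := DT2 hM (fun κ f => lam κ (fun ξ => ZFSet.sep (fun η => ξ ∈ fapp f η) κ)) h.kM hf
  have h2 := hw (ran F) (DT1 hM (fun F => ran F) hF) ⟨F, hF, isZFunc_lam _ _, fun y hy => by
    obtain ⟨ξ, hξ, e⟩ := mem_ran_lam.1 hy
    exact ⟨ξ, hξ, by rw [e]; exact fapp_lam hξ⟩⟩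
  have h3 : fapp (j f) κ = ZFSet.sep (fun ξ => fapp F ξ ∈ ran F ∩ U) κ := by
    ext ξ
    rw [mem_sep, mem_inter]
    have key : ∀ ξ ∈ κ, (ξ ∈ fapp (j f) κ ↔ fapp F ξ ∈ U) := by
      intro ξ hξ
      rw [fapp_lam hξ, h.los2 (fun _ η f ξ => ξ ∈ fapp f η) hf (hM.mem_of_mem hξ h.kM), h.fix hξ]
    constructor
    · intro hx
      exact ⟨hs hx, mem_ran_lam.2 ⟨ξ, hs hx, fapp_lam (hs hx)⟩, (key ξ (hs hx)).1 hx⟩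
    · rintro ⟨hx, _, h4⟩
      exact (key ξ hx).2 h4
  rw [h3]
  exact sepM2 hM (fun _ ξ F X => fapp F ξ ∈ X) h.kM hF h2

end up

/-- functions on `κ` in `m` -/
def Fn (κ m : ZFSet.{u}) : ZFSet.{u} := ZFSet.sep (fun f => IsZFunc κ f) m

def EE (κ m U : ZFSet.{u}) : ZFSet.{u} :=
  ZFSet.sep (fun p => ∃ f ∈ Fn κ m, ∃ g ∈ Fn κ m, p = pair f g ∧
    ZFSet.sep (fun ξ => fapp f ξ ∈ fapp g ξ) κ ∈ U) (zprod (Fn κ m) (Fn κ m))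

/-- The transitive collapse of the ultrapower, as a term -/
def Np (κ m U : ZFSet.{u}) : ZFSet.{u} := ran (Col (Fn κ m) (EE κ m U))

section
variable {s t r : (ℕ → ZFSet.{u}) → ZFSet.{u}}

instance dt_Fn [hs : DT TM0 s] [ht : DT TM0 t] : DT TM0 (fun v => Fn (s v) (t v)) := by
  refine DT.c2 (P := Fn) ?_
  unfold Fn; infer_instance

instance dt_EE [hs : DT TM0 s] [ht : DT TM0 t] [hr : DT TM0 r] :
    DT TM0 (fun v => EE (s v) (t v) (r v)) := by
  refine DT.c3 (P := EE) ?_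
  unfold EE; infer_instance

instance dt_Np [hs : DT TM0 s] [ht : DT TM0 t] [hr : DT TM0 r] :
    DT TM0 (fun v => Np (s v) (t v) (r v)) := by
  refine DT.c3 (P := Np) ?_
  unfold Np; infer_instance
end

theorem pair_mem_EE {κ m U f g : ZFSet.{u}} : pair f g ∈ EE κ m U ↔
    f ∈ Fn κ m ∧ g ∈ Fn κ m ∧ ZFSet.sep (fun ξ => fapp f ξ ∈ fapp g ξ) κ ∈ U := by
  rw [EE, mem_sep]
  constructor
  · rintro ⟨_, a, ha, b, hb, e, h⟩
    obtain ⟨rfl, rfl⟩ := pair_inj.1 e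
    exact ⟨ha, hb, h⟩
  · rintro ⟨ha, hb, h⟩
    exact ⟨mem_zprod.2 ⟨_, ha, _, hb, rfl⟩, f, ha, g, hb, rfl, h⟩

section up
variable {κ M U N : ZFSet.{u}} {j : ZFSet.{u} → ZFSet.{u}} (h : UP κ M U N j)

theorem UP.eq_Np (h : UP κ M U N j) : N = Np κ M U := by
  obtain ⟨h1, h2⟩ := Col_unique (a := Fn κ M) (r := EE κ M U) (c := fun f => fapp (j f) κ) (by
    intro f hf z
    obtain ⟨hfM, hff⟩ := mem_sep.1 hf
    constructor
    · intro hz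
      obtain ⟨g, hg, hgf, rfl⟩ := h.surj (h.tn.mem_of_mem hz (h.jfun_mem hfM hff))
      have hg' : g ∈ Fn κ M := mem_sep.2 ⟨hg, hgf⟩
      exact ⟨g, hg', pair_mem_EE.2 ⟨hg', hf,
        (h.los2 (fun _ ξ g f => fapp g ξ ∈ fapp f ξ) hg hfM).2 hz⟩, rfl⟩
    · rintro ⟨g, hg, h1, rfl⟩
      exact (h.los2 (fun _ ξ g f => fapp g ξ ∈ fapp f ξ) (mem_sep.1 hg).1 hfM).1 (pair_mem_EE.1 h1).2.2)
  ext z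
  rw [Np, (isZFunc_Col _ _).mem_ran, h1]
  constructor
  · intro hz
    obtain ⟨f, hf, hff, rfl⟩ := h.surj hz
    have : f ∈ Fn κ M := mem_sep.2 ⟨hf, hff⟩
    exact ⟨f, this, (h2 f this).symm⟩
  · rintro ⟨f, hf, rfl⟩
    rw [h2 f hf]
    exact h.jfun_mem (mem_sep.1 hf).1 (mem_sep.1 hf).2

theorem UP.card (h : UP κ M U N j) : zcard N ≤ zcard M := by
  refine zcard_le_of_surj (fun f => if f ∈ M ∧ IsZFunc κ f then fapp (j f) κ else ∅) ?_
  intro z hz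
  obtain ⟨f, hf, hff, rfl⟩ := h.surj hz
  exact ⟨f, hf, by simp [hf, hff]⟩

end up


/-! ### existence of the ultrapower -/

theorem sep_congr' {a : ZFSet.{u}} {p q : ZFSet.{u} → Prop} (h : ∀ x ∈ a, (p x ↔ q x)) :
    ZFSet.sep p a = ZFSet.sep q a := by
  ext x; rw [mem_sep, mem_sep]; exact and_congr_right fun hx => h x hx

theorem IsMUltrafilter.not_iff {κ M U B : ZFSet.{u}} (h : IsMUltrafilter κ M U) (hB : B ∈ M)
    (hs : B ⊆ κ) : compl κ B ∈ U ↔ B ∉ U := by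
  constructor
  · intro h1 h2
    apply h.2.2.1
    have := h.2.2.2.1 _ h1 _ h2
    convert this
    symm; rw [eq_empty]
    intro x hx
    obtain ⟨h3, h4⟩ := mem_inter.1 hx
    exact (mem_sep.1 h3).2 h4
  · intro h1
    exact (h.2.2.2.2.2.1 B hB hs).resolve_left h1

theorem IsMUltrafilter.all_mem {κ M U : ZFSet.{u}} (hi : IC κ) (h : IsMUltrafilter κ M U) :
    κ ∈ U := by
  have := h.2.1 ∅ hi.empty_mem
  have e : tailSet κ ∅ = κ := by ext x; simp [tailSet]
  rwa [e] at this

theorem ultrapower_wf {κ ℳ M U : ZFSet.{u}} (hℳ : IsTransModel ℳ) (hκ : κ ∈ ℳ) (hM : M ∈ ℳ)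
    (hU : U ∈ ℳ) (ho : OmegaOneIntersectingIn ℳ U) (hs : ∀ A ∈ U, A ⊆ κ) :
    Wf (Fn κ M) (EE κ M U) = Fn κ M := by
  have h0 := hℳ.tm0
  by_contra hne
  have hsub : Wf (Fn κ M) (EE κ M U) ⊆ Fn κ M := fun x hx => (mem_sep.1 hx).1
  let F := Fn κ M
  let E := EE κ M U
  have hF : F ∈ ℳ := DT2 h0 (fun κ M => Fn κ M) hκ hM
  have hE : E ∈ ℳ := DT3 h0 (fun κ M U => EE κ M U) hκ hM hU
  let T := ZFSet.sep (fun f => f ∉ Wf F E) F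
  have hT : T ∈ ℳ := DT2 h0 (fun F E => ZFSet.sep (fun f => f ∉ Wf F E) F) hF hE
  obtain ⟨f0, hf0⟩ : ∃ f, f ∈ T := by
    by_contra hn
    push Not at hn
    apply hne
    ext f
    refine ⟨fun h => hsub h, fun h => ?_⟩
    by_contra h'
    exact hn f (mem_sep.2 ⟨h, h'⟩)
  obtain ⟨g, hg, hgf, hgp⟩ := choiceM2 hℳ (fun _ f g T E => g ∈ T ∧ pair g f ∈ E) hT hT hE (by
    intro f hf
    by_contra hn
    push Not at hn
    obtain ⟨h1, h2⟩ := mem_sep.1 hf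
    apply h2
    refine mem_sep.2 ⟨h1, ⟨f, fun g hg => ?_⟩⟩
    by_contra h3
    have hgT : g ∈ T := mem_sep.2 ⟨hg.1, fun h => h3 (mem_sep.1 h).2⟩
    exact hn g (h0.mem_of_mem hgT hT) hgT hg.2)
  let s := oRec f0 (fapp g)
  have hsM : s ∈ ℳ := DT2 h0 (fun f0 g => oRec f0 (fapp g)) (h0.mem_of_mem hf0 hT) hg
  have hsT : ∀ n ∈ omega, fapp s n ∈ T := by
    refine omega_induction ?_ ?_
    · rw [oRec_zero]; exact hf0
    · intro n hn ih
      rw [oRec_succ _ _ hn]; exact (hgp _ ih).1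
  have hsE : ∀ n ∈ omega, pair (fapp s (insert n n)) (fapp s n) ∈ E := by
    intro n hn
    rw [oRec_succ _ _ hn]; exact (hgp _ (hsT n hn)).2
  let B := lam omega (fun n => ZFSet.sep (fun ξ => fapp (fapp s (insert n n)) ξ ∈ fapp (fapp s n) ξ) κ)
  have hB : B ∈ ℳ := DT2 h0 (fun s κ => lam omega (fun n => ZFSet.sep (fun ξ =>
    fapp (fapp s (insert n n)) ξ ∈ fapp (fapp s n) ξ) κ)) hsM hκ
  obtain ⟨x, hx⟩ := ho B hB (isZFunc_lam _ _) (fun n hn => by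
    rw [fapp_lam hn]; exact (pair_mem_EE.1 (hsE n hn)).2.2)
  have key : ∀ z, ∀ n ∈ omega, fapp (fapp s n) x ≠ z := by
    intro z
    induction z using ZFSet.inductionOn with
    | _ z ih =>
      rintro n hn rfl
      have h1 := hx n hn
      rw [fapp_lam hn] at h1
      exact ih _ (mem_sep.1 h1).2 _ (omega_succ hn) rfl
  exact key _ ∅ omega_zero rfl

section ex
variable {κ M U : ZFSet.{u}} (hi : IC κ) (hM : IsTransModel M) (hκ : κ ∈ M)
  (hU : IsMUltrafilter κ M U) (hw : Wf (Fn κ M) (EE κ M U) = Fn κ M)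

def cc (κ M U f : ZFSet.{u}) : ZFSet.{u} := fapp (Col (Fn κ M) (EE κ M U)) f

theorem mem_cc (hw : Wf (Fn κ M) (EE κ M U) = Fn κ M) {f z : ZFSet.{u}} (hf : f ∈ Fn κ M) : z ∈ cc κ M U f ↔
    ∃ g ∈ Fn κ M, ZFSet.sep (fun ξ => fapp g ξ ∈ fapp f ξ) κ ∈ U ∧ z = cc κ M U g := by
  rw [cc, mem_fapp_Col (by rw [hw]; exact hf)]
  constructor
  · rintro ⟨g, hg, h, rfl⟩; exact ⟨g, hg, (pair_mem_EE.1 h).2.2, rfl⟩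
  · rintro ⟨g, hg, h, rfl⟩; exact ⟨g, hg, pair_mem_EE.2 ⟨hg, hf, h⟩, rfl⟩

theorem mem_Np (hw : Wf (Fn κ M) (EE κ M U) = Fn κ M) {z : ZFSet.{u}} : z ∈ Np κ M U ↔ ∃ f ∈ Fn κ M, z = cc κ M U f := by
  rw [Np, (isZFunc_Col _ _).mem_ran, hw]; rfl

theorem Np_trans (hw : Wf (Fn κ M) (EE κ M U) = Fn κ M) : (Np κ M U).IsTransitive := by
  intro y hy z hz
  obtain ⟨f, hf, rfl⟩ := (mem_Np hw).1 hy
  obtain ⟨g, hg, _, rfl⟩ := (mem_cc hw hf).1 hz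
  exact (mem_Np hw).2 ⟨g, hg, rfl⟩

theorem uf_mono2 (hM : IsTransModel M) (hκ : κ ∈ M) (hU : IsMUltrafilter κ M U) {Q : ZFSet.{u} → ZFSet.{u} → ZFSet.{u} → ZFSet.{u} → Prop}
    [hQ : Dfn TM0 (fun M v => Q M (v 0) (v 1) (v 2))] {a b : ZFSet.{u}}
    (ha : a ∈ M) (hb : b ∈ M) {A : ZFSet.{u}} (hA : A ∈ U)
    (h : ∀ ξ ∈ κ, ξ ∈ A → Q M ξ a b) : ZFSet.sep (fun ξ => Q M ξ a b) κ ∈ U :=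
  hU.2.2.2.2.1 _ hA _ (sepM2 hM.tm0 Q hκ ha hb) (fun x hx => (mem_sep.1 hx).1)
    fun ξ hξ => mem_sep.2 ⟨(hU.1 A hA).2 hξ, h ξ ((hU.1 A hA).2 hξ) hξ⟩

theorem cc_eq_of (hM : IsTransModel M) (hκ : κ ∈ M) (hU : IsMUltrafilter κ M U) (hw : Wf (Fn κ M) (EE κ M U) = Fn κ M) {f g : ZFSet.{u}} (hf : f ∈ Fn κ M) (hg : g ∈ Fn κ M)
    (h : ZFSet.sep (fun ξ => fapp f ξ = fapp g ξ) κ ∈ U) : cc κ M U f = cc κ M U g := by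
  ext z
  rw [mem_cc hw hf, mem_cc hw hg]
  refine exists_congr fun k => and_congr_right fun hk => and_congr_left fun _ => ?_
  have hkM := (mem_sep.1 hk).1
  constructor
  · intro h1
    refine uf_mono2 hM hκ hU (Q := fun _ ξ k g => fapp k ξ ∈ fapp g ξ) hkM (mem_sep.1 hg).1
      (hU.2.2.2.1 _ h _ h1) ?_
    intro ξ _ hξ
    obtain ⟨h2, h3⟩ := mem_inter.1 hξ
    rw [← (mem_sep.1 h2).2]; exact (mem_sep.1 h3).2
  · intro h1
    refine uf_mono2 hM hκ hU (Q := fun _ ξ k g => fapp k ξ ∈ fapp g ξ) hkM (mem_sep.1 hf).1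
      (hU.2.2.2.1 _ h _ h1) ?_
    intro ξ _ hξ
    obtain ⟨h2, h3⟩ := mem_inter.1 hξ
    rw [(mem_sep.1 h2).2]; exact (mem_sep.1 h3).2

theorem eq_of_cc (hM : IsTransModel M) (hκ : κ ∈ M) (hU : IsMUltrafilter κ M U) (hw : Wf (Fn κ M) (EE κ M U) = Fn κ M) : ∀ z : ZFSet.{u}, ∀ f ∈ Fn κ M, ∀ g ∈ Fn κ M, cc κ M U f = z → cc κ M U g = z →
    ZFSet.sep (fun ξ => fapp f ξ = fapp g ξ) κ ∈ U := by
  have h0 := hM.tm0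
  intro z
  induction z using ZFSet.inductionOn with
  | _ z ih =>
    -- one inclusion
    have key : ∀ f ∈ Fn κ M, ∀ g ∈ Fn κ M, cc κ M U f = z → cc κ M U g = z →
        ZFSet.sep (fun ξ => ∀ y ∈ fapp f ξ, y ∈ fapp g ξ) κ ∈ U := by
      intro f hf g hg e1 e2
      have hfM := (mem_sep.1 hf).1
      have hgM := (mem_sep.1 hg).1
      have hA := sepM2 h0 (fun _ ξ f g => ∀ y ∈ fapp f ξ, y ∈ fapp g ξ) hκ hfM hgM
      by_contra hn
      rw [← hU.not_iff hA (fun x hx => (mem_sep.1 hx).1)] at hn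
      obtain ⟨k, hkM, hkf, hkp⟩ := choiceM2 hM (fun _ ξ y f g => (y ∈ fapp f ξ ∧ y ∉ fapp g ξ) ∨
        ∀ y ∈ fapp f ξ, y ∈ fapp g ξ) hκ hfM hgM (by
          intro ξ hξ
          by_cases h : ∀ y ∈ fapp f ξ, y ∈ fapp g ξ
          · exact ⟨ξ, h0.mem_of_mem hξ hκ, .inr h⟩
          · push Not at h
            obtain ⟨y, hy, h'⟩ := h
            exact ⟨y, h0.mem_of_mem hy (h0.fapp_mem hfM (mem_sep.1 hf).2 hξ), .inl ⟨hy, h'⟩⟩)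
      have hk : k ∈ Fn κ M := mem_sep.2 ⟨hkM, hkf⟩
      have hc : ∀ ξ ∈ κ, ξ ∈ compl κ (ZFSet.sep (fun ξ => ∀ y ∈ fapp f ξ, y ∈ fapp g ξ) κ) →
          fapp k ξ ∈ fapp f ξ ∧ fapp k ξ ∉ fapp g ξ := by
        intro ξ hξ h
        exact (hkp ξ hξ).resolve_right fun h' => (mem_sep.1 h).2 (mem_sep.2 ⟨hξ, h'⟩)
      have h1 : cc κ M U k ∈ cc κ M U f := (mem_cc hw hf).2 ⟨k, hk, uf_mono2 hM hκ hU
        (Q := fun _ ξ k f => fapp k ξ ∈ fapp f ξ) hkM hfM hn (fun ξ hξ h => (hc ξ hξ h).1), rfl⟩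
      have h2 := h1
      rw [e1, ← e2] at h2
      obtain ⟨k', hk', h3, h4⟩ := (mem_cc hw hg).1 h2
      have h5 := ih _ (e1 ▸ h1) k hk k' hk' rfl h4.symm
      obtain ⟨ξ, hξ⟩ : ∃ ξ, ξ ∈ (compl κ (ZFSet.sep (fun ξ => ∀ y ∈ fapp f ξ, y ∈ fapp g ξ) κ) ∩
          ZFSet.sep (fun ξ => fapp k' ξ ∈ fapp g ξ) κ) ∩
          ZFSet.sep (fun ξ => fapp k ξ = fapp k' ξ) κ := by
        by_contra h6
        push Not at h6
        exact hU.2.2.1 ((eq_empty _).2 h6 ▸ hU.2.2.2.1 _ (hU.2.2.2.1 _ hn _ h3) _ h5)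
      obtain ⟨h6, h7⟩ := mem_inter.1 hξ
      obtain ⟨h8, h9⟩ := mem_inter.1 h6
      obtain ⟨hξκ, h10⟩ := mem_sep.1 h9
      apply (hc ξ hξκ h8).2
      rw [(mem_sep.1 h7).2]; exact h10
    intro f hf g hg e1 e2
    refine uf_mono2 hM hκ hU (Q := fun _ ξ k f => fapp k ξ = fapp f ξ) (mem_sep.1 hf).1
      (mem_sep.1 hg).1 (hU.2.2.2.1 _ (key f hf g hg e1 e2) _ (key g hg f hf e2 e1)) ?_
    intro ξ _ hξ
    obtain ⟨h2, h3⟩ := mem_inter.1 hξ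
    ext y
    exact ⟨fun h => (mem_sep.1 h2).2 y h, fun h => (mem_sep.1 h3).2 y h⟩

theorem dfn_fsat (φ : Fml) : Dfn TM0.{u} (fun M w => Sat M.toSet φ
    (fun n => fapp (w (n + 1)) (w 0))) :=
  Dfn.sat φ (fun n w => fapp (w (n + 1)) (w 0)) fun i => inferInstance

theorem BM (hM : IsTransModel M) (hκ : κ ∈ M) (φ : Fml) (v : ℕ → ZFSet.{u}) (hv : ∀ n, v n ∈ Fn κ M) :
    ZFSet.sep (fun ξ => Sat M.toSet φ (fun n => fapp (v n) ξ)) κ ∈ M := by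
  have := dfn_fsat.{u} φ
  exact sep_mem hM.tm0 (fun M w => Sat M.toSet φ (fun n => fapp (w (n + 1)) (w 0))) hκ v
    fun n => (mem_sep.1 (hv n)).1

theorem los_sat (hM : IsTransModel M) (hκ : κ ∈ M) (hU : IsMUltrafilter κ M U) (hw : Wf (Fn κ M) (EE κ M U) = Fn κ M) (φ : Fml) : ∀ v : ℕ → ZFSet.{u}, (∀ n, v n ∈ Fn κ M) →
    (Sat (Np κ M U).toSet φ (fun n => cc κ M U (v n)) ↔
      ZFSet.sep (fun ξ => Sat M.toSet φ (fun n => fapp (v n) ξ)) κ ∈ U) := by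
  have h0 := hM.tm0
  have hss : ∀ {p : ZFSet.{u} → Prop}, ZFSet.sep p κ ⊆ κ := fun {p} x hx => (mem_sep.1 hx).1
  induction φ with
  | mem i k =>
    intro v hv
    simp only [Sat]
    rw [mem_cc hw (hv k)]
    constructor
    · rintro ⟨g, hg, h1, h2⟩
      have h3 := eq_of_cc hM hκ hU hw _ _ (hv i) g hg rfl h2.symm
      refine uf_mono2 hM hκ hU (Q := fun _ ξ k f => fapp k ξ ∈ fapp f ξ)
        (mem_sep.1 (hv i)).1 (mem_sep.1 (hv k)).1 (hU.2.2.2.1 _ h1 _ h3) ?_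
      intro ξ _ hξ
      obtain ⟨h2, h3⟩ := mem_inter.1 hξ
      rw [(mem_sep.1 h3).2]; exact (mem_sep.1 h2).2
    · intro h; exact ⟨_, hv i, h, rfl⟩
  | eq i k =>
    intro v hv
    simp only [Sat]
    exact ⟨fun h => eq_of_cc hM hκ hU hw _ _ (hv i) _ (hv k) rfl h.symm,
      fun h => cc_eq_of hM hκ hU hw (hv i) (hv k) h⟩
  | neg φ ih =>
    intro v hv
    simp only [Sat]
    rw [ih v hv, ← hU.not_iff (BM hM hκ φ v hv) hss]
    apply Iff.of_eq; congr 1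
    ext ξ
    simp only [compl, mem_sep]
    tauto
  | impl φ ψ ih1 ih2 =>
    intro v hv
    have h1 := BM hM hκ φ v hv
    have h2 := BM hM hκ ψ v hv
    have h3 := BM hM hκ (φ.impl ψ) v hv
    simp only [Sat] at h3 ⊢
    rw [ih1 v hv, ih2 v hv]
    constructor
    · intro h
      by_contra hn
      rw [← hU.not_iff h3 hss] at hn
      have h4 := h (hU.2.2.2.2.1 _ hn _ h1 hss fun ξ hξ => by
        simp only [compl, mem_sep] at hξ ⊢; tauto)
      refine (hU.not_iff h2 hss).1 (hU.2.2.2.2.1 _ hn _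
        (DT2 h0 (fun κ B => compl κ B) hκ h2) compl_sub fun ξ hξ => ?_) h4
      simp only [compl, mem_sep] at hξ ⊢; tauto
    · intro h h'
      refine hU.2.2.2.2.1 _ (hU.2.2.2.1 _ h _ h') _ h2 hss fun ξ hξ => ?_
      simp only [mem_inter, mem_sep] at hξ ⊢; tauto
  | all k φ ih =>
    intro v hv
    have h3 := BM hM hκ (φ.all k) v hv
    have hup : ∀ g ∈ Fn κ M, ∀ n, Function.update v k g n ∈ Fn κ M := by
      intro g hg n
      by_cases h : n = k
      · subst h; simpa using hg
      · rw [Function.update_of_ne h]; exact hv n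
    have hc : ∀ g, (fun n => cc κ M U (Function.update v k g n)) =
        Function.update (fun n => cc κ M U (v n)) k (cc κ M U g) := by
      intro g; ext1 n
      by_cases h : n = k
      · subst h; simp
      · simp [Function.update_of_ne h]
    have hx : ∀ g ξ, (fun n => fapp (Function.update v k g n) ξ) =
        Function.update (fun n => fapp (v n) ξ) k (fapp g ξ) := by
      intro g ξ; ext1 n
      by_cases h : n = k
      · subst h; simp
      · simp [Function.update_of_ne h]
    simp only [Sat] at h3 ⊢
    constructor
    · intro h
      by_contra hn
      rw [← hU.not_iff h3 hss] at hn
      have hd : Dfn TM0.{u} (fun M w => Sat M.toSet φ (fun n => (fun n (w : ℕ → ZFSet.{u}) =>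
        if n = k then w 1 else fapp (w (n + 1 + 1)) (w 0)) n w)) :=
        Dfn.sat φ _ fun n => by split_ifs <;> infer_instance
      have hd2 : Dfn TM0.{u} (fun M w => ∀ x ∈ M, Sat M.toSet φ (fun n => (fun n (w : ℕ → ZFSet.{u}) =>
        if n = k then w 0 else fapp (w (n + 1 + 1 + 1)) (w 1)) n (scons x w))) := by
        have : Dfn TM0.{u} (fun M w => Sat M.toSet φ (fun n => (fun n (w : ℕ → ZFSet.{u}) =>
          if n = k then w 0 else fapp (w (n + 1 + 1 + 1)) (w 1)) n w)) :=
          Dfn.sat φ _ fun n => by split_ifs <;> infer_instance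
        refine Dfn.all (h := this.congr fun M _ v _ => ?_)
        apply Iff.of_eq; congr 1
      have e1 : ∀ ξ y, (fun n => (fun n (w : ℕ → ZFSet.{u}) =>
        if n = k then w 1 else fapp (w (n + 1 + 1)) (w 0)) n (scons ξ (scons y v))) =
          Function.update (fun n => fapp (v n) ξ) k y := by
        intro ξ y; ext1 n
        by_cases h : n = k
        · subst h; simp
        · simp [h, Function.update_of_ne h]
      have e2 : ∀ ξ y x, (fun n => (fun n (w : ℕ → ZFSet.{u}) =>
        if n = k then w 0 else fapp (w (n + 1 + 1 + 1)) (w 1)) n (scons x (scons ξ (scons y v)))) =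
          Function.update (fun n => fapp (v n) ξ) k x := by
        intro ξ y x; ext1 n
        by_cases h : n = k
        · subst h; simp
        · simp [h, Function.update_of_ne h]
      obtain ⟨g, hgM, hgf, hgp⟩ := choice_mem hM (fun M w => ¬ Sat M.toSet φ
        (fun n => (fun n (w : ℕ → ZFSet.{u}) =>
        if n = k then w 1 else fapp (w (n + 1 + 1)) (w 0)) n w) ∨ ∀ x ∈ M, Sat M.toSet φ
        (fun n => (fun n (w : ℕ → ZFSet.{u}) =>
        if n = k then w 0 else fapp (w (n + 1 + 1 + 1)) (w 1)) n (scons x w))) hκ v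
        (fun n => (mem_sep.1 (hv n)).1) (by
          intro ξ hξ
          by_cases h' : ∀ x ∈ M, Sat M.toSet φ (Function.update (fun n => fapp (v n) ξ) k x)
          · refine ⟨ξ, h0.mem_of_mem hξ hκ, .inr fun x hx => ?_⟩
            rw [e2]; exact h' x hx
          · push Not at h'
            obtain ⟨x, hx, h'⟩ := h'
            refine ⟨x, hx, .inl ?_⟩
            rw [e1]; exact h')
      have hg : g ∈ Fn κ M := mem_sep.2 ⟨hgM, hgf⟩
      have h4 := h (cc κ M U g) ((mem_Np hw).2 ⟨g, hg, rfl⟩)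
      rw [← hc, ih _ (hup g hg)] at h4
      refine (hU.not_iff h3 hss).1 hn (hU.2.2.2.2.1 _ h4 _ h3 hss fun ξ hξ => ?_)
      obtain ⟨h5, h6⟩ := mem_sep.1 hξ
      refine mem_sep.2 ⟨h5, ?_⟩
      rcases hgp ξ h5 with h7 | h7
      · rw [e1] at h7; rw [hx] at h6; exact absurd h6 h7
      · intro x hx
        have := h7 x hx
        rwa [e2] at this
    · intro h z hz
      obtain ⟨g, hg, rfl⟩ := (mem_Np hw).1 hz
      rw [← hc, ih _ (hup g hg)]
      refine hU.2.2.2.2.1 _ h _ (BM hM hκ φ _ (hup g hg)) hss fun ξ hξ => ?_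
      obtain ⟨h5, h6⟩ := mem_sep.1 hξ
      refine mem_sep.2 ⟨h5, ?_⟩
      rw [hx]
      exact h6 _ (h0.fapp_mem (mem_sep.1 hg).1 (mem_sep.1 hg).2 h5)

theorem exists_emb (hi : IC κ) (hM : IsTransModel M) (hκ : κ ∈ M) (hU : IsMUltrafilter κ M U) (hw : Wf (Fn κ M) (EE κ M U) = Fn κ M) : ∃ j, IsUltrapowerEmb κ M U (Np κ M U) j := by
  have h0 := hM.tm0
  have hss : ∀ {p : ZFSet.{u} → Prop}, ZFSet.sep p κ ⊆ κ := fun {p} x hx => (mem_sep.1 hx).1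
  have hkU := hU.all_mem hi
  have hcst : ∀ x ∈ M, lam κ (fun _ => x) ∈ Fn κ M := fun x hx =>
    mem_sep.2 ⟨DT2 h0 (fun κ x => lam κ (fun _ => x)) hκ hx, isZFunc_lam _ _⟩
  have hid : lam κ (fun ξ => ξ) ∈ Fn κ M :=
    mem_sep.2 ⟨DT1 h0 (fun κ => lam κ (fun ξ => ξ)) hκ, isZFunc_lam _ _⟩
  let j : ZFSet.{u} → ZFSet.{u} := fun x => cc κ M U (lam κ (fun _ => x))
  have hj : ∀ x ∈ M, j x ∈ Np κ M U := fun x hx => (mem_Np hw).2 ⟨_, hcst x hx, rfl⟩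
  have hel : El M (Np κ M U) j := by
    refine ⟨h0, Np_trans hw, hj, fun φ v hv => ?_⟩
    have h1 := los_sat hM hκ hU hw φ (fun n => lam κ (fun _ => v n)) (fun n => hcst _ (hv n))
    refine Iff.trans ?_ h1.symm
    have e : ZFSet.sep (fun ξ => Sat M.toSet φ (fun n => fapp (lam κ (fun _ => v n)) ξ)) κ =
        ZFSet.sep (fun ξ => Sat M.toSet φ v) κ := by
      refine sep_congr' fun ξ hξ => ?_
      simp only [fapp_lam hξ]
    rw [e]
    by_cases hs : Sat M.toSet φ v
    · have : ZFSet.sep (fun ξ => Sat M.toSet φ v) κ = κ := by ext x; simp [hs]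
      rw [this]; exact ⟨fun _ => hkU, fun _ => hs⟩
    · have : ZFSet.sep (fun ξ => Sat M.toSet φ v) κ = ∅ := by ext x; simp [hs]
      rw [this]; exact ⟨fun h => absurd h hs, fun h => absurd h hU.2.2.1⟩
  -- normality
  have hnorm : ∀ ξ, (ξ ∈ κ ∨ ξ = κ) → ∀ g ∈ Fn κ M,
      ZFSet.sep (fun η => fapp g η ∈ ξ ∧ fapp g η ∈ η) κ ∈ U →
      ∃ γ ∈ κ, γ ∈ ξ ∧ cc κ M U g = j γ := by
    intro ξ hξ g hg hA
    obtain ⟨hgM, hgf⟩ := mem_sep.1 hg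
    obtain ⟨γ, hγ, h⟩ := hU.2.2.2.2.2.2 g hgM hgf
      (hU.2.2.2.2.1 _ hA _ (sepM1 h0 (fun _ η f => fapp f η ∈ η) hκ hgM) hss fun η hη =>
        mem_sep.2 ⟨(mem_sep.1 hη).1, (mem_sep.1 hη).2.2⟩)
    refine ⟨γ, hγ, ?_, ?_⟩
    · have h1 := hU.2.2.2.1 _ hA _ h
      by_contra hn
      apply hU.2.2.1
      convert h1
      symm; rw [eq_empty]
      intro η hη
      obtain ⟨h2, h3⟩ := mem_inter.1 hη
      apply hn
      rw [← (mem_sep.1 h3).2]; exact (mem_sep.1 h2).2.1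
    · refine cc_eq_of hM hκ hU hw hg (hcst γ (h0.mem_of_mem hγ hκ)) ?_
      convert h using 1
      refine sep_congr' fun η hη => ?_
      rw [fapp_lam hη]
  have hfix : ∀ ξ ∈ κ, j ξ = ξ := by
    intro ξ
    induction ξ using ZFSet.inductionOn with
    | _ ξ ih =>
      intro hξ
      have hξM := h0.mem_of_mem hξ hκ
      ext a
      constructor
      · intro ha
        obtain ⟨g, hg, h1, rfl⟩ := (mem_cc hw (hcst ξ hξM)).1 ha
        obtain ⟨γ, hγ, h2, h3⟩ := hnorm ξ (.inl hξ) g hg (by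
          refine uf_mono2 hM hκ hU (Q := fun _ η g ξ => fapp g η ∈ ξ ∧ fapp g η ∈ η)
            (mem_sep.1 hg).1 hξM (hU.2.2.2.1 _ h1 _ (hU.2.1 ξ hξ)) ?_
          intro η hη hη'
          obtain ⟨h2, h3⟩ := mem_inter.1 hη'
          have h4 := (mem_sep.1 h2).2
          rw [fapp_lam hη] at h4
          refine ⟨h4, ?_⟩
          rcases (hi.ord.mem hξ).mem_trichotomous (hi.ord.mem hη) with h7 | h7 | h7
          · exact (hi.ord.mem hη).mem_trans h4 h7
          · exact h7 ▸ h4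
          · exact absurd h7 (mem_sep.1 h3).2)
        rw [h3, ih γ h2 hγ]; exact h2
      · intro ha
        have hak := hi.ord.mem_trans ha hξ
        rw [← ih a ha hak]
        exact (hel.mem_iff (h0.mem_of_mem hak hκ) hξM).1 ha
  have hkk : cc κ M U (lam κ (fun ξ => ξ)) = κ := by
    ext a
    rw [mem_cc hw hid]
    constructor
    · rintro ⟨g, hg, h1, rfl⟩
      obtain ⟨γ, hγ, h2, h3⟩ := hnorm κ (.inr rfl) g hg (by
        refine uf_mono2 hM hκ hU (Q := fun _ η g ξ => fapp g η ∈ ξ ∧ fapp g η ∈ η)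
            (mem_sep.1 hg).1 hκ h1 ?_
        intro η hη hη'
        have h4 := (mem_sep.1 hη').2
        rw [fapp_lam hη] at h4
        exact ⟨hi.ord.mem_trans h4 hη, h4⟩)
      rw [h3, hfix γ hγ]; exact hγ
    · intro ha
      have haM := h0.mem_of_mem ha hκ
      refine ⟨_, hcst a haM, ?_, (hfix a ha).symm⟩
      have h1 := hU.2.1 _ (hi.succ ha)
      refine hU.2.2.2.2.1 _ h1 _ (DT2 h0 (fun κ a => ZFSet.sep (fun ξ => fapp (lam κ (fun _ => a)) ξ ∈
        fapp (lam κ (fun ξ => ξ)) ξ) κ) hκ haM) hss fun η hη => ?_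
      obtain ⟨h2, h3⟩ := mem_sep.1 hη
      refine mem_sep.2 ⟨h2, ?_⟩
      rw [fapp_lam h2, fapp_lam h2]
      rw [mem_insert_iff] at h3
      push Not at h3
      rcases (hi.ord.mem ha).mem_trichotomous (hi.ord.mem h2) with h7 | h7 | h7
      · exact h7
      · exact absurd h7.symm h3.1
      · exact absurd h7 h3.2
  have hfa : ∀ f ∈ Fn κ M, fapp (j f) κ = cc κ M U f := by
    intro f hf
    have hfM := (mem_sep.1 hf).1
    obtain ⟨φ, hφ⟩ := (inferInstance : Dfn TM0.{u} (fun _ v => fapp (v 0) (v 1) = v 2)).out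
    let v : ℕ → ZFSet.{u} := scons (lam κ (fun _ => f)) (scons (lam κ (fun ξ => ξ)) (fun _ => f))
    have hv : ∀ n, v n ∈ Fn κ M := by
      rintro (_ | _ | n); exacts [hcst f hfM, hid, hf]
    have h1 := (los_sat hM hκ hU hw φ v hv).2 (by
      convert hkU
      ext ξ
      rw [mem_sep]
      refine ⟨fun h => h.1, fun h => ⟨h, ?_⟩⟩
      refine (hφ M h0 _ (fun n => h0.fapp_mem (mem_sep.1 (hv n)).1 (mem_sep.1 (hv n)).2 h)).2 ?_
      simp only [v, scons_zero, scons_succ]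
      show fapp (fapp (lam κ fun _ => f) ξ) (fapp (lam κ (fun ξ => ξ)) ξ) = fapp f ξ
      rw [fapp_lam h, fapp_lam h])
    have h2 := (hφ _ hel.tm0 _ (fun n => (mem_Np hw).2 ⟨_, hv n, rfl⟩)).1 h1
    have h3 : fapp (j f) (cc κ M U (lam κ (fun ξ => ξ))) = cc κ M U f := h2
    rwa [hkk] at h3
  refine ⟨j, Np_trans hw, hj, hel.el, ?_, ?_⟩
  · intro a ha
    obtain ⟨f, hf, rfl⟩ := (mem_Np hw).1 ha
    obtain ⟨hfM, hff⟩ := mem_sep.1 hf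
    exact ⟨f, hfM, hff, fun ξ hξ => h0.fapp_mem hfM hff hξ, hfa f hf⟩
  · intro A hA hAκ
    have h1 : κ ∈ j A ↔ ZFSet.sep (fun ξ => fapp (lam κ (fun ξ => ξ)) ξ ∈
        fapp (lam κ (fun _ => A)) ξ) κ ∈ U := by
      obtain ⟨φ, hφ⟩ := (inferInstance : Dfn TM0.{u} (fun _ v => v 0 ∈ v 1)).out
      have h2 := los_sat hM hκ hU hw (.mem 0 1) (scons (lam κ (fun ξ => ξ)) (fun _ => lam κ (fun _ => A)))
        (by rintro (_ | n); exacts [hid, hcst A hA])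
      have h3 : cc κ M U (lam κ (fun ξ => ξ)) ∈ j A ↔ _ := h2
      rw [hkk] at h3
      exact h3
    rw [h1]
    apply Iff.of_eq; congr 1
    ext ξ
    rw [mem_sep]
    refine ⟨fun h => ⟨hAκ h, ?_⟩, fun h => ?_⟩
    · rw [fapp_lam (hAκ h), fapp_lam (hAκ h)]; exact h
    · have := h.2
      rwa [fapp_lam h.1, fapp_lam h.1] at this

end ex

/-- packaged facts about Ramsey measures in a model -/
structure RM (ℳ κ U : ZFSet.{u}) : Prop where
  ic : IC κ
  mem : U ∈ ℳ
  su : IsSUMeasure κ U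
  wa : WeaklyAmenable κ (Mp κ U) U
  oo : OmegaOneIntersectingIn ℳ U
  mod : IsTransModel (Mp κ U)
  kM : κ ∈ Mp κ U
  cM : zcard (Mp κ U) = zcard κ
  vk : HasVkappa κ (Mp κ U)
  uf : IsMUltrafilter κ (Mp κ U) U
  meq : MU κ U = Mp κ U

theorem RamseyMeasureIn.rm {ℳ κ U : ZFSet.{u}} (hκ : IsCard κ) (h : RamseyMeasureIn ℳ κ U) :
    RM ℳ κ U := by
  obtain ⟨h1, h2, h3, h4⟩ := h
  have e := h2.MU_eq hκ
  have h5 := h2.isMU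
  rw [e] at h3 h5
  exact ⟨h5.1.ic hκ, h1, h2, h3, h4, h5.1.1, h5.1.2.1, h5.1.2.2, h5.2.1, h5.2.2.1, e⟩

theorem RM.ramsey {ℳ κ U : ZFSet.{u}} (h : RM ℳ κ U) : RamseyMeasureIn ℳ κ U :=
  ⟨h.mem, h.su, h.meq ▸ h.wa, h.oo⟩

theorem RM.up {ℳ κ U : ZFSet.{u}} (hℳ : IsTransModel ℳ) (hκ : κ ∈ ℳ) (h : RM ℳ κ U) :
    UP κ (Mp κ U) U (NU κ U) (jU κ U) := by
  refine ⟨h.ic, h.mod, h.kM, h.uf, ?_⟩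
  have hw := ultrapower_wf hℳ hκ (DT2 hℳ.tm0 (fun κ U => Mp κ U) hκ h.mem) h.mem h.oo h.su.2.1
  obtain ⟨j, hj⟩ := exists_emb h.ic h.mod h.kM h.uf hw
  have hex : ∃ p : ZFSet × (ZFSet → ZFSet), IsUltrapowerEmb κ (MU κ U) U p.1 p.2 :=
    ⟨(_, j), by rw [h.meq]; exact hj⟩
  have := hex.choose_spec
  rw [NU, jU, upData, dif_pos hex, ← h.meq]
  exact this

theorem RM.NU_eq {ℳ κ U : ZFSet.{u}} (hℳ : IsTransModel ℳ) (hκ : κ ∈ ℳ) (h : RM ℳ κ U) :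
    NU κ U = Np κ (Mp κ U) U := (h.up hℳ hκ).eq_Np



/-! ### coding satisfaction -/

/-- finite ordinals -/
def nat : ℕ → ZFSet.{u}
  | 0 => ∅
  | n + 1 => insert (nat n) (nat n)

theorem nat_mem (n : ℕ) : nat.{u} n ∈ omega.{u} := by
  induction n with
  | zero => exact omega_zero
  | succ n ih => exact omega_succ ih

theorem exists_nat {x : ZFSet.{u}} (hx : x ∈ omega.{u}) : ∃ n, x = nat n :=
  omega_induction (p := fun x => ∃ n, x = nat n) ⟨0, rfl⟩
    (by rintro _ _ ⟨n, rfl⟩; exact ⟨n + 1, rfl⟩) x hx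

theorem nat_lt {m n : ℕ} (h : m < n) : nat.{u} m ∈ nat.{u} n := by
  induction n with
  | zero => omega
  | succ n ih =>
    show _ ∈ insert (nat n) (nat n)
    rw [mem_insert_iff]
    rcases Nat.lt_succ_iff_lt_or_eq.1 h with h | rfl
    · exact .inr (ih h)
    · exact .inl rfl

theorem nat_inj {m n : ℕ} (h : nat.{u} m = nat.{u} n) : m = n := by
  rcases lt_trichotomy m n with h1 | h1 | h1
  · have := nat_lt.{u} h1; rw [h] at this; exact absurd this (mem_irrefl _)
  · exact h1
  · have := nat_lt.{u} h1; rw [h] at this; exact absurd this (mem_irrefl _)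

def upd (s n x : ZFSet.{u}) : ZFSet.{u} := lam omega (fun k => if k = n then x else fapp s k)

instance dt_upd {s t q : (ℕ → ZFSet.{u}) → ZFSet.{u}} [hs : DT TM0 s] [ht : DT TM0 t]
    [hq : DT TM0 q] : DT TM0 (fun v => upd (s v) (t v) (q v)) := by
  refine DT.c3 (P := upd) ?_
  unfold upd; infer_instance

def vv (s : ZFSet.{u}) : ℕ → ZFSet.{u} := fun n => fapp s (nat n)

theorem vv_upd (s x : ZFSet.{u}) (n : ℕ) : vv (upd s (nat n) x) = Function.update (vv s) n x := by
  ext1 k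
  rw [vv, upd, fapp_lam (nat_mem k)]
  by_cases h : k = n
  · subst h; simp
  · rw [if_neg (fun h1 => h (nat_inj h1)), Function.update_of_ne h]; rfl

def Sm (m : ZFSet.{u}) : ZFSet.{u} := ZFSet.sep (fun s => IsZFunc omega s) m

instance dt_Sm {s : (ℕ → ZFSet.{u}) → ZFSet.{u}} [hs : DT TM0 s] : DT TM0 (fun v => Sm (s v)) := by
  refine DT.c1 (P := Sm) ?_
  unfold Sm; infer_instance

def XF (m : ZFSet.{u}) (φ : Fml) : ZFSet.{u} := ZFSet.sep (fun s => Sat m.toSet φ (vv s)) (Sm m)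

def D0 (m : ZFSet.{u}) : ZFSet.{u} :=
  ⋃₀ (zimg omega (fun i => zimg omega (fun j => ZFSet.sep (fun s => fapp s i ∈ fapp s j) (Sm m)))) ∪
  ⋃₀ (zimg omega (fun i => zimg omega (fun j => ZFSet.sep (fun s => fapp s i = fapp s j) (Sm m))))

instance dt_D0 {s : (ℕ → ZFSet.{u}) → ZFSet.{u}} [hs : DT TM0 s] : DT TM0 (fun v => D0 (s v)) := by
  refine DT.c1 (P := D0) ?_
  unfold D0; infer_instance

def DS (m D : ZFSet.{u}) : ZFSet.{u} :=
  D ∪ (zimg D (fun X => compl (Sm m) X) ∪ (⋃₀ (zimg D (fun X => zimg D (fun Y => compl (Sm m) X ∪ Y))) ∪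
    ⋃₀ (zimg D (fun X => zimg omega (fun n => ZFSet.sep (fun s => ∀ x ∈ m, upd s n x ∈ X) (Sm m))))))

instance dt_DS {s t : (ℕ → ZFSet.{u}) → ZFSet.{u}} [hs : DT TM0 s] [ht : DT TM0 t] :
    DT TM0 (fun v => DS (s v) (t v)) := by
  refine DT.c2 (P := DS) ?_
  unfold DS; infer_instance

def DD (m : ZFSet.{u}) : ZFSet.{u} := ⋃₀ (ran (oRec (D0 m) (fun D => DS m D)))

instance dt_DD {s : (ℕ → ZFSet.{u}) → ZFSet.{u}} [hs : DT TM0 s] : DT TM0 (fun v => DD (s v)) := by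
  refine DT.c1 (P := DD) ?_
  unfold DD; infer_instance

theorem mem_D0 {m X : ZFSet.{u}} : X ∈ D0 m ↔ (∃ i j, X = XF m (.mem i j)) ∨ ∃ i j, X = XF m (.eq i j) := by
  simp only [D0, mem_union, mem_sUnion, mem_zimg]
  refine or_congr ?_ ?_
  all_goals
    constructor
    · rintro ⟨z, ⟨i, hi, rfl⟩, hX⟩
      obtain ⟨j, hj, rfl⟩ := mem_zimg.1 hX
      obtain ⟨i, rfl⟩ := exists_nat hi
      obtain ⟨j, rfl⟩ := exists_nat hj
      exact ⟨i, j, rfl⟩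
    · rintro ⟨i, j, rfl⟩
      exact ⟨_, ⟨_, nat_mem i, rfl⟩, mem_zimg.2 ⟨_, nat_mem j, rfl⟩⟩

theorem mem_DS {m D X : ZFSet.{u}} : X ∈ DS m D ↔ X ∈ D ∨ (∃ Y ∈ D, X = compl (Sm m) Y) ∨
    (∃ Y ∈ D, ∃ Z ∈ D, X = compl (Sm m) Y ∪ Z) ∨
    (∃ Y ∈ D, ∃ n, X = ZFSet.sep (fun s => ∀ x ∈ m, upd s (nat n) x ∈ Y) (Sm m)) := by
  simp only [DS, mem_union, mem_sUnion, mem_zimg]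
  refine or_congr Iff.rfl (or_congr Iff.rfl (or_congr ?_ ?_))
  · constructor
    · rintro ⟨z, ⟨Y, hY, rfl⟩, hX⟩
      obtain ⟨Z, hZ, rfl⟩ := mem_zimg.1 hX
      exact ⟨Y, hY, Z, hZ, rfl⟩
    · rintro ⟨Y, hY, Z, hZ, rfl⟩
      exact ⟨_, ⟨Y, hY, rfl⟩, mem_zimg.2 ⟨Z, hZ, rfl⟩⟩
  · constructor
    · rintro ⟨z, ⟨Y, hY, rfl⟩, hX⟩
      obtain ⟨n, hn, rfl⟩ := mem_zimg.1 hX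
      obtain ⟨n, rfl⟩ := exists_nat hn
      exact ⟨Y, hY, n, rfl⟩
    · rintro ⟨Y, hY, n, rfl⟩
      exact ⟨_, ⟨Y, hY, rfl⟩, mem_zimg.2 ⟨_, nat_mem n, rfl⟩⟩

theorem XF_neg (m : ZFSet.{u}) (φ : Fml) : XF m (.neg φ) = compl (Sm m) (XF m φ) := by
  ext s; simp only [XF, compl, mem_sep, Sat]; tauto

theorem XF_impl (m : ZFSet.{u}) (φ ψ : Fml) : XF m (.impl φ ψ) = compl (Sm m) (XF m φ) ∪ XF m ψ := by
  ext s; simp only [XF, compl, mem_sep, Sat, mem_union]; tauto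

theorem isZFunc_upd (s n x : ZFSet.{u}) : IsZFunc omega (upd s n x) := isZFunc_lam _ _

section
variable {m : ZFSet.{u}} (hupd : ∀ s ∈ m, ∀ n ∈ omega.{u}, ∀ x ∈ m, IsZFunc omega s → upd s n x ∈ m)

theorem upd_Sm {s x : ZFSet.{u}} (hupd : ∀ s ∈ m, ∀ n ∈ omega.{u}, ∀ x ∈ m, IsZFunc omega s → upd s n x ∈ m)
    (hs : s ∈ Sm m) (n : ℕ) (hx : x ∈ m) : upd s (nat n) x ∈ Sm m :=
  mem_sep.2 ⟨hupd s (mem_sep.1 hs).1 _ (nat_mem n) x hx (mem_sep.1 hs).2, isZFunc_upd _ _ _⟩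

theorem XF_all (hupd : ∀ s ∈ m, ∀ n ∈ omega.{u}, ∀ x ∈ m, IsZFunc omega s → upd s n x ∈ m) (n : ℕ) (φ : Fml) :
    XF m (.all n φ) = ZFSet.sep (fun s => ∀ x ∈ m, upd s (nat n) x ∈ XF m φ) (Sm m) := by
  ext s
  simp only [XF, mem_sep, Sat, vv_upd]
  constructor
  · rintro ⟨h1, h2⟩
    exact ⟨h1, fun x hx => ⟨upd_Sm hupd h1 n hx, h2 x hx⟩⟩
  · rintro ⟨h1, h2⟩
    exact ⟨h1, fun x hx => (h2 x hx).2⟩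

theorem mem_DD (hupd : ∀ s ∈ m, ∀ n ∈ omega.{u}, ∀ x ∈ m, IsZFunc omega s → upd s n x ∈ m) {X : ZFSet.{u}} :
    X ∈ DD m ↔ ∃ φ, X = XF m φ := by
  have h1 : X ∈ DD m ↔ ∃ n, X ∈ fapp (oRec (D0 m) (fun D => DS m D)) (nat n) := by
    rw [DD, mem_sUnion]
    constructor
    · rintro ⟨z, hz, hX⟩
      obtain ⟨n, hn, rfl⟩ := (isZFunc_oRec _ _).mem_ran.1 hz
      obtain ⟨n, rfl⟩ := exists_nat hn
      exact ⟨n, hX⟩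
    · rintro ⟨n, hX⟩
      exact ⟨_, (isZFunc_oRec _ _).mem_ran.2 ⟨_, nat_mem n, rfl⟩, hX⟩
  rw [h1]
  clear h1
  have hS : ∀ n, fapp (oRec (D0 m) (fun D => DS m D)) (nat (n + 1)) =
    DS m (fapp (oRec (D0 m) (fun D => DS m D)) (nat n)) := fun n => oRec_succ _ _ (nat_mem n)
  have hmono : ∀ a b, a ≤ b → fapp (oRec (D0 m) (fun D => DS m D)) (nat a) ⊆
      fapp (oRec (D0 m) (fun D => DS m D)) (nat b) := by
    intro a b hab
    induction b, hab using Nat.le_induction with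
    | base => exact fun _ h => h
    | succ b _ ih => intro x hx; rw [hS, mem_DS]; exact .inl (ih hx)
  constructor
  · rintro ⟨n, hn⟩
    induction n generalizing X with
    | zero =>
      have : X ∈ D0 m := by rw [← oRec_zero (D0 m) (fun D => DS m D)]; exact hn
      rcases mem_D0.1 this with ⟨i, j, h⟩ | ⟨i, j, h⟩ <;> exact ⟨_, h⟩
    | succ n ih =>
      rw [hS, mem_DS] at hn
      rcases hn with h | ⟨Y, hY, rfl⟩ | ⟨Y, hY, Z, hZ, rfl⟩ | ⟨Y, hY, k, rfl⟩
      · exact ih h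
      · obtain ⟨φ, rfl⟩ := ih hY; exact ⟨_, (XF_neg m φ).symm⟩
      · obtain ⟨φ, rfl⟩ := ih hY; obtain ⟨ψ, rfl⟩ := ih hZ; exact ⟨_, (XF_impl m φ ψ).symm⟩
      · obtain ⟨φ, rfl⟩ := ih hY; exact ⟨_, (XF_all hupd k φ).symm⟩
  · rintro ⟨φ, rfl⟩
    induction φ with
    | mem i j =>
      refine ⟨0, ?_⟩
      show _ ∈ fapp (oRec (D0 m) (fun D => DS m D)) ∅
      rw [oRec_zero]; exact mem_D0.2 (.inl ⟨i, j, rfl⟩)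
    | eq i j =>
      refine ⟨0, ?_⟩
      show _ ∈ fapp (oRec (D0 m) (fun D => DS m D)) ∅
      rw [oRec_zero]; exact mem_D0.2 (.inr ⟨i, j, rfl⟩)
    | impl φ ψ h1 h2 =>
      obtain ⟨a, ha⟩ := h1
      obtain ⟨b, hb⟩ := h2
      refine ⟨max a b + 1, ?_⟩
      rw [hS, mem_DS]
      exact .inr (.inr (.inl ⟨_, hmono a _ (le_max_left _ _) ha, _, hmono b _ (le_max_right _ _) hb,
        XF_impl m φ ψ⟩))
    | neg φ h1 =>
      obtain ⟨a, ha⟩ := h1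
      exact ⟨a + 1, by rw [hS, mem_DS]; exact .inr (.inl ⟨_, ha, XF_neg m φ⟩)⟩
    | all n φ h1 =>
      obtain ⟨a, ha⟩ := h1
      exact ⟨a + 1, by rw [hS, mem_DS]; exact .inr (.inr (.inr ⟨_, ha, n, XF_all hupd n φ⟩))⟩

end

/-- the internal version of being a transitive model -/
def GoodM (m : ZFSet.{u}) : Prop :=
  m.IsTransitive ∧ omega ∈ m ∧ (∀ x ∈ m, ∀ y ∈ m, ({x, y} : ZFSet) ∈ m) ∧ (∀ x ∈ m, (⋃₀ x : ZFSet) ∈ m) ∧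
  (∀ x ∈ m, lam omega (fun _ => x) ∈ m) ∧
  (∀ s ∈ m, ∀ n ∈ omega.{u}, ∀ x ∈ m, IsZFunc omega s → upd s n x ∈ m) ∧
  (∀ X ∈ DD m, ∀ s ∈ Sm m, ∀ a ∈ m, ZFSet.sep (fun x => upd s ∅ x ∈ X) a ∈ m) ∧
  (∀ X ∈ DD m, ∀ s ∈ Sm m, ∀ a ∈ m, (∀ x ∈ a, ∃ y ∈ m, upd (upd s ∅ x) (insert ∅ ∅) y ∈ X) →
    ∃ b ∈ m, ∀ x ∈ a, ∃ y ∈ b, upd (upd s ∅ x) (insert ∅ ∅) y ∈ X) ∧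
  (∀ x ∈ m, ∃ r ∈ m, (∀ p ∈ r, ∃ a ∈ x, ∃ b ∈ x, p = ZFSet.pair a b) ∧
    (∀ a ∈ x, ∀ b ∈ x, a = b ∨ ZFSet.pair a b ∈ r ∨ ZFSet.pair b a ∈ r) ∧
    (∀ a ∈ x, ∀ b ∈ x, ∀ c ∈ x, ZFSet.pair a b ∈ r → ZFSet.pair b c ∈ r → ZFSet.pair a c ∈ r) ∧
    (∀ a ∈ x, ZFSet.pair a a ∉ r) ∧ Wf x r = x)

instance dfn_GoodM {s : (ℕ → ZFSet.{u}) → ZFSet.{u}} [hs : DT TM0 s] :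
    Dfn TM0 (fun _ v => GoodM (s v)) := by
  refine Dfn.c1 (P := fun _ => GoodM) ?_
  unfold GoodM
  repeat' refine @Dfn.and _ _ _ ?_ ?_
  all_goals infer_instance



theorem fapp_mem_tr {m s d x : ZFSet.{u}} (hm : m.IsTransitive) (hs : s ∈ m) (hf : IsZFunc d s) (hx : x ∈ d) :
    fapp s x ∈ m := by
  have h1 := hf.pair_mem hx
  have h2 := hm.mem_trans h1 hs
  have h3 : ({x, fapp s x} : ZFSet) ∈ m := hm.mem_trans (show _ ∈ ZFSet.pair x (fapp s x) by
    simp [ZFSet.pair]) h2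
  exact hm.mem_trans (by simp) h3

theorem vv_mem {m s : ZFSet.{u}} (hm : m.IsTransitive) (hs : s ∈ Sm m) (n : ℕ) : vv s n ∈ m :=
  fapp_mem_tr hm (mem_sep.1 hs).1 (mem_sep.1 hs).2 (nat_mem n)

theorem exists_pad {m : ZFSet.{u}} (hc : ∀ x ∈ m, lam omega (fun _ => x) ∈ m)
    (hupd : ∀ s ∈ m, ∀ n ∈ omega.{u}, ∀ x ∈ m, IsZFunc omega s → upd s n x ∈ m)
    (v : ℕ → ZFSet.{u}) (hv : ∀ n, v n ∈ m) (N : ℕ) : ∃ s ∈ Sm m, ∀ i < N, vv s i = v i := by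
  induction N with
  | zero => exact ⟨_, mem_sep.2 ⟨hc _ (hv 0), isZFunc_lam _ _⟩, by simp⟩
  | succ N ih =>
    obtain ⟨s, hs, h⟩ := ih
    refine ⟨_, upd_Sm hupd hs N (hv N), fun i hi => ?_⟩
    rw [vv_upd]
    by_cases hiN : i = N
    · subst hiN; simp
    · rw [Function.update_of_ne hiN]; exact h i (by omega)

theorem isWellOrderOn_iff {x r : ZFSet.{u}} : IsWellOrderOn x r ↔
    ((∀ p ∈ r, ∃ a ∈ x, ∃ b ∈ x, p = ZFSet.pair a b) ∧
    (∀ a ∈ x, ∀ b ∈ x, a = b ∨ ZFSet.pair a b ∈ r ∨ ZFSet.pair b a ∈ r) ∧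
    (∀ a ∈ x, ∀ b ∈ x, ∀ c ∈ x, ZFSet.pair a b ∈ r → ZFSet.pair b c ∈ r → ZFSet.pair a c ∈ r) ∧
    (∀ a ∈ x, ZFSet.pair a a ∉ r) ∧ Wf x r = x) := by
  unfold IsWellOrderOn
  refine and_congr_right fun _ => and_congr_right fun _ => and_congr_right fun _ => and_congr_right fun _ => ?_
  constructor
  · intro h
    ext a
    refine ⟨fun h => (mem_sep.1 h).1, fun ha => ?_⟩
    by_contra hn
    obtain ⟨b, ⟨hb, hbn⟩, h2⟩ := h {y | y ∈ x ∧ ¬ Acc (RR x r) y} (fun y hy => hy.1)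
      ⟨a, ha, fun h => hn (mem_sep.2 ⟨ha, h⟩)⟩
    refine hbn ⟨b, fun c hc => ?_⟩
    by_contra hcn
    exact h2 c ⟨hc.1, hcn⟩ hc.2
  · intro h S hS ⟨a, ha⟩
    have h1 : Acc (RR x r) a := (mem_sep.1 (show a ∈ Wf x r by rw [h]; exact hS ha)).2
    induction h1 with
    | intro a _ ih =>
      by_cases h2 : ∃ b ∈ S, pair b a ∈ r
      · obtain ⟨b, hb, h3⟩ := h2
        exact ih b ⟨hS hb, h3⟩ hb
      · push Not at h2
        exact ⟨a, ha, h2⟩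

theorem nat_zero : nat.{u} 0 = ∅ := rfl
theorem nat_one : nat.{u} 1 = insert ∅ ∅ := rfl

theorem goodM_iff {m : ZFSet.{u}} : GoodM m ↔ IsTransModel m := by
  constructor
  · rintro ⟨h1, h2, h3, h4, hc, hupd, h5, h6, h7⟩
    refine ⟨h1, h2, h3, h4, ?_, ?_, fun x hx => ?_⟩
    · intro φ v hv a ha
      obtain ⟨s, hs, h⟩ := exists_pad hc hupd v hv φ.bd
      refine ⟨_, h5 (XF m φ) ((mem_DD hupd).2 ⟨φ, rfl⟩) s hs a ha, fun x => ?_⟩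
      rw [mem_sep]
      refine and_congr_right fun hx => ?_
      have hxm := h1.mem_trans hx ha
      rw [← nat_zero, XF, mem_sep, vv_upd]
      rw [and_iff_right (upd_Sm hupd hs 0 hxm)]
      refine Sat_congr _ φ _ _ fun i hi => ?_
      by_cases h0 : i = 0
      · subst h0; simp
      · rw [Function.update_of_ne h0, Function.update_of_ne h0, h i hi]
    · intro φ v hv a ha
      obtain ⟨s, hs, h⟩ := exists_pad hc hupd v hv φ.bd
      have key : ∀ x ∈ a, ∀ y ∈ m, (upd (upd s ∅ x) (insert ∅ ∅) y ∈ XF m φ ↔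
          Sat m.toSet φ (Function.update (Function.update v 0 x) 1 y)) := by
        intro x hx y hy
        have hxm := h1.mem_trans hx ha
        rw [← nat_one, ← nat_zero, XF, mem_sep, vv_upd, vv_upd,
          and_iff_right (upd_Sm hupd (upd_Sm hupd hs 0 hxm) 1 hy)]
        refine Sat_congr _ φ _ _ fun i hi => ?_
        by_cases h0 : i = 0
        · subst h0; simp
        · by_cases h0 : i = 1
          · subst h0; simp
          · simp only [Function.update_of_ne, ne_eq, *, not_false_eq_true]
      intro hy
      obtain ⟨b, hb, h8⟩ := h6 (XF m φ) ((mem_DD hupd).2 ⟨φ, rfl⟩) s hs a ha (fun x hx => by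
        obtain ⟨y, hy, h9⟩ := hy x hx
        exact ⟨y, hy, (key x hx y hy).2 h9⟩)
      refine ⟨b, hb, fun x hx => ?_⟩
      obtain ⟨y, hy, h9⟩ := h8 x hx
      exact ⟨y, hy, (key x hx y (h1.mem_trans hy hb)).1 h9⟩
    · obtain ⟨r, hr, h8⟩ := h7 x hx
      exact ⟨r, hr, isWellOrderOn_iff.2 h8⟩
  · intro hM
    have h0 := hM.tm0
    obtain ⟨h1, h2, h3, h4, h5, h6, h7⟩ := hM
    have hupd : ∀ s ∈ m, ∀ n ∈ omega.{u}, ∀ x ∈ m, IsZFunc omega s → upd s n x ∈ m :=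
      fun s hs n hn x hx _ => DT3 h0 (fun s n x => upd s n x) hs (h1.mem_trans hn h2) hx
    refine ⟨h1, h2, h3, h4, fun x hx => DT1 h0 (fun x => lam omega (fun _ => x)) hx, hupd, ?_, ?_, fun x hx => ?_⟩
    · intro X hX s hs a ha
      obtain ⟨φ, rfl⟩ := (mem_DD hupd).1 hX
      obtain ⟨b, hb, h8⟩ := h5 φ (vv s) (vv_mem h1 hs) a ha
      convert hb
      ext x
      rw [h8, mem_sep]
      refine and_congr_right fun hx => ?_
      have hxm := h1.mem_trans hx ha
      rw [← nat_zero, XF, mem_sep, vv_upd]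
      rw [and_iff_right (upd_Sm hupd hs 0 hxm)]
    · intro X hX s hs a ha
      obtain ⟨φ, rfl⟩ := (mem_DD hupd).1 hX
      have key : ∀ x ∈ a, ∀ y ∈ m, (upd (upd s ∅ x) (insert ∅ ∅) y ∈ XF m φ ↔
          Sat m.toSet φ (Function.update (Function.update (vv s) 0 x) 1 y)) := by
        intro x hx y hy
        have hxm := h1.mem_trans hx ha
        rw [← nat_one, ← nat_zero, XF, mem_sep, vv_upd, vv_upd,
          and_iff_right (upd_Sm hupd (upd_Sm hupd hs 0 hxm) 1 hy)]
      intro hy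
      obtain ⟨b, hb, h8⟩ := h6 φ (vv s) (vv_mem h1 hs) a ha (fun x hx => by
        obtain ⟨y, hy, h9⟩ := hy x hx
        exact ⟨y, hy, (key x hx y hy).1 h9⟩)
      refine ⟨b, hb, fun x hx => ?_⟩
      obtain ⟨y, hy, h9⟩ := h8 x hx
      exact ⟨y, hy, (key x hx y (h1.mem_trans hy hb)).2 h9⟩
    · obtain ⟨r, hr, h8⟩ := h7 x hx
      exact ⟨r, hr, isWellOrderOn_iff.1 h8⟩

instance dfn_isTransModel {s : (ℕ → ZFSet.{u}) → ZFSet.{u}} [hs : DT TM0 s] :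
    Dfn TM0 (fun _ v => IsTransModel (s v)) := by
  simp only [← goodM_iff]; infer_instance



theorem oo_iff {N U : ZFSet.{u}} : OmegaOneIntersectingIn N U ↔ ∀ f ∈ N, IsZFunc ZFSet.omega f →
    (∀ n ∈ ZFSet.omega.{u}, fapp f n ∈ U) → ∃ x ∈ fapp f ∅, ∀ n ∈ ZFSet.omega.{u}, x ∈ fapp f n := by
  unfold OmegaOneIntersectingIn
  refine forall_congr' fun f => ?_
  refine forall_congr' fun hf => forall_congr' fun h1 => forall_congr' fun h2 => ?_
  constructor
  · rintro ⟨x, h⟩; exact ⟨x, h _ omega_zero, h⟩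
  · rintro ⟨x, _, h⟩; exact ⟨x, h⟩

instance dfn_oo {s : (ℕ → ZFSet.{u}) → ZFSet.{u}} [hs : DT TM0 s] :
    Dfn TM0 (fun M v => OmegaOneIntersectingIn M (s v)) := by
  refine Dfn.c1 (P := OmegaOneIntersectingIn) ?_
  simp only [oo_iff]; infer_instance

theorem wa_iff {κ M U : ZFSet.{u}} : WeaklyAmenable κ M U ↔ ∀ X ∈ M, (∃ f ∈ M, IsZFunc κ f ∧
    ∀ y ∈ X, ∃ ξ ∈ κ, fapp f ξ = y) → X ∩ U ∈ M := Iff.rfl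

instance dfn_wa {s t q : (ℕ → ZFSet.{u}) → ZFSet.{u}} [hs : DT TM0 s] [ht : DT TM0 t] [hq : DT TM0 q] :
    Dfn TM0 (fun _ v => WeaklyAmenable (s v) (t v) (q v)) := by
  refine Dfn.c3 (P := fun _ => WeaklyAmenable) ?_
  simp only [wa_iff]; infer_instance

instance dfn_uf {s t q : (ℕ → ZFSet.{u}) → ZFSet.{u}} [hs : DT TM0 s] [ht : DT TM0 t] [hq : DT TM0 q] :
    Dfn TM0 (fun _ v => IsMUltrafilter (s v) (t v) (q v)) := by
  refine Dfn.c3 (P := fun _ => IsMUltrafilter) ?_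
  unfold IsMUltrafilter
  repeat' refine @Dfn.and _ _ _ ?_ ?_
  all_goals infer_instance

theorem rank_succ_lt {κ : ZFSet.{u}} (h : IC κ) {δ : Ordinal} (hδ : δ < rank κ) : Order.succ δ < rank κ := by
  obtain ⟨y, hy, h1⟩ := lt_rank_iff.1 hδ
  have h2 := rank_lt_of_mem (h.succ hy)
  rw [rank_insert] at h2
  exact lt_of_le_of_lt (Order.succ_le_succ h1) (lt_of_le_of_lt (le_max_left _ _) h2)

theorem rank_pair_le {a b : ZFSet.{u}} {δ : Ordinal} (ha : rank a ≤ δ) (hb : rank b ≤ δ) :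
    rank (ZFSet.pair a b) ≤ Order.succ (Order.succ δ) := by
  rw [ZFSet.pair, ZFSet.rank_pair, rank_singleton, ZFSet.rank_pair]
  have h1 := Order.succ_le_succ ha
  have h2 := Order.succ_le_succ hb
  exact max_le (Order.succ_le_succ h1) (Order.succ_le_succ (max_le h1 h2))

section lift
variable {ℳ κ W V : ZFSet.{u}} (hℳ : IsTransModel ℳ) (hκ : κ ∈ ℳ) (h : RM ℳ κ W)

theorem RM.Mp_mem (hℳ : IsTransModel ℳ) (hκ : κ ∈ ℳ) (h : RM ℳ κ W) : Mp κ W ∈ ℳ :=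
  DT2 hℳ.tm0 (fun κ U => Mp κ U) hκ h.mem

theorem Np_mem {N : ZFSet.{u}} (hN : TM0 N) (hκ : κ ∈ N) (hV : V ∈ N) : Np κ (Mp κ V) V ∈ N :=
  DT2 hN (fun κ U => Np κ (Mp κ U) U) hκ hV

theorem RM.NU_mem (hℳ : IsTransModel ℳ) (hκ : κ ∈ ℳ) (h : RM ℳ κ W) : NU κ W ∈ ℳ := by
  rw [h.NU_eq hℳ hκ]; exact Np_mem hℳ.tm0 hκ h.mem

theorem RM.NU_sub (hℳ : IsTransModel ℳ) (hκ : κ ∈ ℳ) (h : RM ℳ κ W) : NU κ W ⊆ ℳ := fun _ hx =>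
  hℳ.1.mem_trans hx (h.NU_mem hℳ hκ)

theorem RM.lift (hℳ : IsTransModel ℳ) (hκ : κ ∈ ℳ) (h : RM ℳ κ W) (hV : V ∈ NU κ W)
    (hs : ∀ A ∈ V, A ⊆ κ) : OmegaOneIntersectingIn (NU κ W) V ↔ OmegaOneIntersectingIn ℳ V := by
  have up := h.up hℳ hκ
  constructor
  · intro ho s hsM hsf hsV
    obtain ⟨f, hf, hff, hfV⟩ := up.surj hV
    have hfM : f ∈ ℳ := hℳ.1.mem_trans hf (h.Mp_mem hℳ hκ)
    have hB : ZFSet.sep (fun ξ => OmegaOneIntersectingIn (Mp κ W) (fapp f ξ)) κ ∈ W :=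
      (up.los1 (fun M ξ f => OmegaOneIntersectingIn M (fapp f ξ)) hf).2 (by rw [hfV]; exact ho)
    have hsn : ∀ n ∈ omega.{u}, fapp s n ∈ Mp κ W := fun n hn =>
      up.mem_sub h.wa (up.tn.mem_of_mem (hsV n hn) hV) (hs _ (hsV n hn))
    have hBn : ∀ n ∈ omega.{u}, ZFSet.sep (fun ξ => fapp s n ∩ ξ ∈ fapp f ξ) κ ∈ W := by
      intro n hn
      refine (up.los2 (fun M ξ A f => A ∩ ξ ∈ fapp f ξ) (hsn n hn) hf).2 ?_
      show jU κ W (fapp s n) ∩ κ ∈ fapp (jU κ W f) κ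
      rw [hfV]
      have : jU κ W (fapp s n) ∩ κ = fapp s n := by
        ext ξ
        rw [mem_inter]
        constructor
        · rintro ⟨h1, h2⟩
          rw [up.toEl.mem_iff (up.tm.mem_of_mem h2 h.kM) (hsn n hn), up.fix h2]; exact h1
        · intro h1
          have h2 := hs _ (hsV n hn) h1
          refine ⟨?_, h2⟩
          have := (up.toEl.mem_iff (up.tm.mem_of_mem h2 h.kM) (hsn n hn)).1 h1
          rwa [up.fix h2] at this
      rw [this]; exact hsV n hn
    have hBM : ZFSet.sep (fun ξ => OmegaOneIntersectingIn (Mp κ W) (fapp f ξ)) κ ∈ ℳ :=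
      hℳ.1.mem_trans hB h.mem
    obtain ⟨ξ, hξ⟩ := h.oo (lam omega (fun n => ZFSet.sep (fun ξ => fapp s n ∩ ξ ∈ fapp f ξ) κ ∩
        ZFSet.sep (fun ξ => OmegaOneIntersectingIn (Mp κ W) (fapp f ξ)) κ))
      (DT4 hℳ.tm0 (fun s f κ B => lam omega (fun n => ZFSet.sep (fun ξ => fapp s n ∩ ξ ∈ fapp f ξ) κ ∩ B))
        hsM hfM hκ hBM) (isZFunc_lam _ _) (fun n hn => by
          rw [fapp_lam hn]; exact h.uf.2.2.2.1 _ (hBn n hn) _ hB)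
    have hξ' : ∀ n ∈ omega.{u}, ξ ∈ κ ∧ fapp s n ∩ ξ ∈ fapp f ξ ∧ OmegaOneIntersectingIn (Mp κ W) (fapp f ξ) := by
      intro n hn
      have := hξ n hn
      rw [fapp_lam hn, mem_inter, mem_sep, mem_sep] at this
      exact ⟨this.1.1, this.1.2, this.2.2⟩
    obtain ⟨hξκ, -, hξo⟩ := hξ' ∅ omega_zero
    obtain ⟨vk, hvk, hvk'⟩ := h.vk
    have ht : lam omega (fun n => fapp s n ∩ ξ) ∈ Mp κ W := by
      refine up.tm.mem_of_mem ((hvk' _).2 ?_) hvk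
      have hω := omega_mem_kappa h.ic up.tm h.kM h.uf
      have hδ : max (rank omega.{u}) (rank ξ) < rank κ := max_lt (rank_lt_of_mem hω) (rank_lt_of_mem hξκ)
      refine lt_of_le_of_lt (rank_le_iff.2 fun y hy => ?_)
        (rank_succ_lt h.ic (rank_succ_lt h.ic (rank_succ_lt h.ic hδ)))
      obtain ⟨n, hn, rfl⟩ := mem_lam.1 hy
      refine Order.lt_succ_of_le (rank_pair_le ?_ ?_)
      · exact (rank_lt_of_mem hn).le.trans (le_max_left _ _)
      · exact (rank_mono fun x hx => (mem_inter.1 hx).2).trans (le_max_right _ _)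
    obtain ⟨x, hx⟩ := hξo _ ht (isZFunc_lam _ _) (fun n hn => by rw [fapp_lam hn]; exact (hξ' n hn).2.1)
    refine ⟨x, fun n hn => ?_⟩
    have := hx n hn
    rw [fapp_lam hn] at this
    exact (mem_inter.1 this).1
  · intro ho s hsN
    exact ho s (h.NU_sub hℳ hκ hsN)

/-- definable form -/
def RMd (ℳ κ vk V : ZFSet.{u}) : Prop :=
  (∀ A ∈ V, A ⊆ κ) ∧ IsTransModel (Mp κ V) ∧ κ ∈ Mp κ V ∧ vk ∈ Mp κ V ∧
    IsMUltrafilter κ (Mp κ V) V ∧ WeaklyAmenable κ (Mp κ V) V ∧ OmegaOneIntersectingIn ℳ V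

instance dfn_RMd {s t q : (ℕ → ZFSet.{u}) → ZFSet.{u}} [hs : DT TM0 s] [ht : DT TM0 t] [hq : DT TM0 q] :
    Dfn TM0 (fun M v => RMd M (s v) (t v) (q v)) := by
  refine Dfn.c3 (P := RMd) ?_
  unfold RMd; infer_instance

theorem RM.d (h : RM ℳ κ W) {vk : ZFSet.{u}} (hvk : ∀ x, x ∈ vk ↔ rank x < rank κ) : RMd ℳ κ vk W := by
  obtain ⟨v, hv, h1⟩ := h.vk
  have : vk = v := by ext x; rw [hvk, h1]
  exact ⟨h.su.2.1, h.mod, h.kM, this ▸ hv, h.uf, h.wa, h.oo⟩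

theorem RMd.rm (hℳ : IsTransModel ℳ) (hκ : κ ∈ ℳ) (h : RM ℳ κ W) {vk : ZFSet.{u}}
    (hvk : ∀ x, x ∈ vk ↔ rank x < rank κ) (hV : V ∈ NU κ W) (hd : RMd ℳ κ vk V) : RM ℳ κ V := by
  have up := h.up hℳ hκ
  obtain ⟨h1, h2, h3, h4, h5, h6, h7⟩ := hd
  have hN : zcard (NU κ W) ≤ zcard κ := up.card.trans h.cM.le
  have hsu : IsSUMeasure κ V := by
    refine ⟨le_antisymm ((zcard_mono fun x hx => up.tn.mem_of_mem hx hV).trans hN) ?_, h1, Mp κ V,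
      ⟨h2, h3, le_antisymm ((zcard_mono fun x hx => up.tn.mem_of_mem hx ?_).trans hN)
        (zcard_mono fun x hx => h2.1.mem_trans hx h3)⟩, ⟨vk, h4, hvk⟩, h5, ?_⟩
    · refine zcard_le_of_inj (fun α => tailSet κ α) (fun α hα => h5.2.1 α hα) fun a ha b hb e => ?_
      have key : ∀ a ∈ κ, ∀ b ∈ κ, tailSet κ a = tailSet κ b → ¬ a ∈ b := by
        intro a ha b hb e hab
        have : a ∈ tailSet κ a := mem_sep.2 ⟨ha, mem_irrefl _⟩
        rw [e] at this
        exact (mem_sep.1 this).2 hab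
      rcases (h.ic.ord.mem ha).mem_trichotomous (h.ic.ord.mem hb) with h8 | h8 | h8
      · exact absurd h8 (key a ha b hb e)
      · exact h8
      · exact absurd h8 (key b hb a ha e.symm)
    · exact DT2 up.tn (fun κ U => Mp κ U) up.kN hV
    · intro M' hM' hκ' hU'
      exact Mp_sub hM'.tm0 hκ' fun A hA => (hU'.1 A hA).1
  refine RamseyMeasureIn.rm h.ic.card ⟨h.NU_sub hℳ hκ hV, hsu, ?_, h7⟩
  rw [hsu.MU_eq h.ic.card]; exact h6

end lift



/-! ### the main argument -/

theorem oGEin_iff {PmIn : ZFSet.{u} → ZFSet.{u} → ZFSet.{u} → Prop} {κ : ZFSet.{u}} {α : Ordinal.{u + 1}}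
    {N : ZFSet.{u}} : oGEin PmIn κ α N ↔ ∀ A ∈ N.toSet, A ⊆ κ → ∀ β < α,
      ∃ W ∈ N.toSet, PmIn N κ W ∧ AGood κ A W ∧ oGEin PmIn κ β (NU κ W) := by
  rw [oGEin, WellFounded.fix_eq]

theorem RM.ramsey_iff {ℳ κ W V : ZFSet.{u}} (hℳ : IsTransModel ℳ) (hκ : κ ∈ ℳ) (h : RM ℳ κ W)
    (hV : V ∈ NU κ W) : RamseyMeasureIn (NU κ W) κ V ↔ RM ℳ κ V := by
  constructor
  · intro h1
    exact RamseyMeasureIn.rm h.ic.card ⟨h.NU_sub hℳ hκ hV, h1.2.1, h1.2.2.1,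
      (h.lift hℳ hκ hV h1.2.1.2.1).1 h1.2.2.2⟩
  · intro h1
    obtain ⟨h2, h3, h4, h5⟩ := h1.ramsey
    exact ⟨hV, h3, h4, (h.lift hℳ hκ hV h3.2.1).2 h5⟩

theorem RM.NU_mem_NU {ℳ κ W V : ZFSet.{u}} (hℳ : IsTransModel ℳ) (hκ : κ ∈ ℳ) (h : RM ℳ κ W)
    (hV : V ∈ NU κ W) (h1 : RM ℳ κ V) : NU κ V ∈ NU κ W := by
  have up := h.up hℳ hκ
  rw [h1.NU_eq hℳ hκ]; exact Np_mem up.tn up.kN hV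

theorem RM.agood {ℳ κ W A : ZFSet.{u}} (h : RM ℳ κ W) : AGood κ A W ↔ A ∈ Mp κ W := by
  rw [AGood, h.meq]

theorem RM.sub_iff {ℳ κ W A : ZFSet.{u}} (hℳ : IsTransModel ℳ) (hκ : κ ∈ ℳ) (h : RM ℳ κ W) (hA : A ⊆ κ) :
    A ∈ NU κ W ↔ A ∈ Mp κ W :=
  ⟨fun h1 => (h.up hℳ hκ).mem_sub h.wa h1 hA, fun h1 => (h.up hℳ hκ).sub_mem h1 hA⟩

/-- the relation on `P` -/
def rP (P κ : ZFSet.{u}) : ZFSet.{u} :=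
  ZFSet.sep (fun q => ∃ V ∈ P, ∃ W ∈ P, q = pair V W ∧ V ∈ Np κ (Mp κ W) W) (zprod P P)

instance dt_rP {s t : (ℕ → ZFSet.{u}) → ZFSet.{u}} [hs : DT TM0 s] [ht : DT TM0 t] :
    DT TM0 (fun v => rP (s v) (t v)) := by
  refine DT.c2 (P := rP) ?_
  unfold rP; infer_instance

theorem pair_mem_rP {P κ V W : ZFSet.{u}} : pair V W ∈ rP P κ ↔ V ∈ P ∧ W ∈ P ∧ V ∈ Np κ (Mp κ W) W := by
  rw [rP, mem_sep, mem_zprod]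
  constructor
  · rintro ⟨_, V', hV, W', hW, e, h⟩
    obtain ⟨rfl, rfl⟩ := pair_injective e
    exact ⟨hV, hW, h⟩
  · rintro ⟨hV, hW, h⟩
    exact ⟨⟨V, hV, W, hW, rfl⟩, V, hV, W, hW, rfl, h⟩

def GP (κ r P V g : ZFSet.{u}) : ZFSet.{u} :=
  ZFSet.sep (fun x => ∀ A ∈ Mp κ V, A ⊆ κ → ∃ W ∈ prd P r V, A ∈ Mp κ W ∧ x ∈ (insert (fapp g W) (fapp g W) : ZFSet))
    (⋃₀ (zimg (prd P r V) (fun W => insert (fapp g W) (fapp g W))))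

instance dt_GP {s t q p w : (ℕ → ZFSet.{u}) → ZFSet.{u}} [hs : DT TM0 s] [ht : DT TM0 t] [hq : DT TM0 q]
    [hp : DT TM0 p] [hw : DT TM0 w] : DT TM0 (fun v => GP (s v) (t v) (q v) (p v) (w v)) := by
  have h : DT TM0 (fun v : ℕ → ZFSet.{u} => GP (v 0) (v 1) (v 2) (v 3) (v 4)) := by
    unfold GP; infer_instance
  exact h.comp (tl [s, t, q, p, w]) (tl_cons (by simp; exact ⟨hs, ht, hq, hp, hw⟩))

def FP (P κ : ZFSet.{u}) : ZFSet.{u} := Rec P (rP P κ) (fun V g => GP κ (rP P κ) P V g)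

instance dt_FP {s t : (ℕ → ZFSet.{u}) → ZFSet.{u}} [hs : DT TM0 s] [ht : DT TM0 t] :
    DT TM0 (fun v => FP (s v) (t v)) := by
  refine DT.c2 (P := FP) ?_
  unfold FP; infer_instance

/-- a good pool of measures -/
structure Pool (ℳ κ P : ZFSet.{u}) : Prop where
  mod : IsTransModel ℳ
  kM : κ ∈ ℳ
  mem : P ∈ ℳ
  rm : ∀ V ∈ P, RM ℳ κ V
  down : ∀ V ∈ P, ∀ X ∈ NU κ V, RM ℳ κ X → X ∈ P

section pool
variable {ℳ κ P : ZFSet.{u}}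

theorem Pool.RR_iff (h : Pool ℳ κ P) {V W : ZFSet.{u}} (hW : W ∈ P) :
    RR P (rP P κ) V W ↔ V ∈ P ∧ V ∈ NU κ W := by
  rw [RR, pair_mem_rP, (h.rm W hW).NU_eq h.mod h.kM]; tauto

theorem Pool.acc (h : Pool ℳ κ P) : ∀ V ∈ P, Acc (RR P (rP P κ)) V := by
  have : ∀ δ : Ordinal.{u}, ∀ V ∈ P, rank (NU κ V) = δ → Acc (RR P (rP P κ)) V := by
    intro δ
    induction δ using WellFoundedLT.induction with
    | _ δ ih =>
      rintro V hV rfl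
      refine ⟨V, fun X hX => ?_⟩
      obtain ⟨h1, h2⟩ := (h.RR_iff hV).1 hX
      exact ih _ (rank_lt_of_mem ((h.rm V hV).NU_mem_NU h.mod h.kM h2 (h.rm X h1))) X h1 rfl
  exact fun V hV => this _ V hV rfl

theorem Pool.mem_F (h : Pool ℳ κ P) {V x : ZFSet.{u}} (hV : V ∈ P) : x ∈ fapp (FP P κ) V ↔
    ∀ A ∈ Mp κ V, A ⊆ κ → ∃ W ∈ P, W ∈ NU κ V ∧ A ∈ Mp κ W ∧
      (x = fapp (FP P κ) W ∨ x ∈ fapp (FP P κ) W) := by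
  have hw : ∀ V ∈ P, V ∈ Wf P (rP P κ) := fun V hV => mem_sep.2 ⟨hV, h.acc V hV⟩
  have e : ∀ V ∈ P, fapp (FP P κ) V = recF P (rP P κ) (fun V g => GP κ (rP P κ) P V g) V := by
    intro V hV; rw [FP, Rec, fapp_lam (hw V hV)]
  have e2 : fapp (FP P κ) V = GP κ (rP P κ) P V
      (lam (prd P (rP P κ) V) (recF P (rP P κ) (fun V g => GP κ (rP P κ) P V g))) := by
    rw [e V hV, recF_eq (h.acc V hV)]
  have e3 : ∀ W ∈ prd P (rP P κ) V,
      fapp (lam (prd P (rP P κ) V) (recF P (rP P κ) (fun V g => GP κ (rP P κ) P V g))) W =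
        fapp (FP P κ) W := by
    intro W hW
    rw [fapp_lam hW, e W (mem_prd.1 hW).1]
  rw [e2, GP, mem_sep]
  have hb : ∀ {A : ZFSet.{u}}, (∃ W ∈ prd P (rP P κ) V, A ∈ Mp κ W ∧ x ∈
      (insert (fapp (lam (prd P (rP P κ) V) (recF P (rP P κ) (fun V g => GP κ (rP P κ) P V g))) W)
      (fapp (lam (prd P (rP P κ) V) (recF P (rP P κ) (fun V g => GP κ (rP P κ) P V g))) W) : ZFSet)) ↔
      ∃ W ∈ P, W ∈ NU κ V ∧ A ∈ Mp κ W ∧ (x = fapp (FP P κ) W ∨ x ∈ fapp (FP P κ) W) := by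
    intro A
    constructor
    · rintro ⟨W, hW, h1, h2⟩
      rw [e3 W hW, mem_insert_iff] at h2
      obtain ⟨h3, h4⟩ := (h.RR_iff hV).1 (mem_prd.1 hW)
      exact ⟨W, h3, h4, h1, h2⟩
    · rintro ⟨W, h3, h4, h1, h2⟩
      have hW := mem_prd.2 ((h.RR_iff hV).2 ⟨h3, h4⟩)
      refine ⟨W, hW, h1, ?_⟩
      rw [e3 W hW, mem_insert_iff]; exact h2
  simp only [hb]
  refine ⟨fun h => h.2, fun h1 => ⟨?_, h1⟩⟩
  have h0 : (∅ : ZFSet) ∈ Mp κ V := (h.rm V hV).mod.1.mem_trans omega_zero (h.rm V hV).mod.2.1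
  obtain ⟨W, hW, hA, hx⟩ := hb.2 (h1 ∅ h0 (empty_subset _))
  exact mem_sUnion.2 ⟨_, mem_zimg.2 ⟨W, hW, rfl⟩, hx⟩

theorem Pool.ord (h : Pool ℳ κ P) : ∀ V ∈ P, (fapp (FP P κ) V).IsOrdinal := by
  intro V hV
  induction h.acc V hV with
  | intro V _ ih =>
    have h0 : (∅ : ZFSet) ∈ Mp κ V := (h.rm V hV).mod.1.mem_trans omega_zero (h.rm V hV).mod.2.1
    have hord : ∀ W ∈ P, W ∈ NU κ V → (fapp (FP P κ) W).IsOrdinal := fun W hW hW' =>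
      ih W ((h.RR_iff hV).2 ⟨hW, hW'⟩) hW
    have hel : ∀ x ∈ fapp (FP P κ) V, x.IsOrdinal := by
      intro x hx
      obtain ⟨W, hW, h1, _, h2⟩ := (h.mem_F hV).1 hx ∅ h0 (empty_subset _)
      rcases h2 with rfl | h2
      · exact hord W hW h1
      · exact (hord W hW h1).mem h2
    refine isOrdinal_iff_forall_mem_isTransitive.2 ⟨?_, fun x hx => (hel x hx).isTransitive⟩
    intro x hx y hy
    refine (h.mem_F hV).2 fun A hA hs => ?_
    obtain ⟨W, hW, h1, h3, h2⟩ := (h.mem_F hV).1 hx A hA hs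
    refine ⟨W, hW, h1, h3, .inr ?_⟩
    rcases h2 with rfl | h2
    · exact hy
    · exact (hord W hW h1).mem_trans hy h2

theorem sub_of_rank_le {a b : ZFSet.{u}} (ha : a.IsOrdinal) (hb : b.IsOrdinal) (h : rank a ≤ rank b) : a ⊆ b := by
  rcases hb.mem_or_subset ha with h1 | h1
  · exact absurd (rank_lt_of_mem h1) (not_lt.2 h)
  · exact h1

theorem Pool.oGE (h : Pool ℳ κ P) : ∀ V ∈ P, ∀ β : Ordinal.{u + 1},
    (oGEin RamseyMeasureIn κ β (NU κ V) ↔ β ≤ Ordinal.lift.{u + 1} (rank (fapp (FP P κ) V))) := by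
  intro V hV
  induction h.acc V hV with
  | intro V _ ih =>
    intro β
    have hR := h.rm V hV
    have e : oGEin RamseyMeasureIn κ β (NU κ V) ↔ ∀ γ < β, ∀ A ∈ Mp κ V, A ⊆ κ → ∃ W ∈ P, W ∈ NU κ V ∧
        A ∈ Mp κ W ∧ γ ≤ Ordinal.lift.{u + 1} (rank (fapp (FP P κ) W)) := by
      rw [oGEin_iff]
      constructor
      · intro h1 γ hγ A hA hs
        obtain ⟨W, hW, h2, h3, h4⟩ := h1 A ((hR.sub_iff h.mod h.kM hs).2 hA) hs γ hγ
        have h5 := (hR.ramsey_iff h.mod h.kM hW).1 h2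
        have h6 := h.down V hV W hW h5
        exact ⟨W, h6, hW, h5.agood.1 h3, (ih W ((h.RR_iff hV).2 ⟨h6, hW⟩) h6 γ).1 h4⟩
      · intro h1 A hA hs γ hγ
        obtain ⟨W, hW, hW', h2, h3⟩ := h1 γ hγ A ((hR.sub_iff h.mod h.kM hs).1 hA) hs
        have h5 := h.rm W hW
        exact ⟨W, hW', (hR.ramsey_iff h.mod h.kM hW').2 h5, h5.agood.2 h2,
          (ih W ((h.RR_iff hV).2 ⟨hW, hW'⟩) hW γ).2 h3⟩
    rw [e]
    constructor
    · intro h1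
      by_contra hn
      push Not at hn
      have : fapp (FP P κ) V ∈ fapp (FP P κ) V := by
        refine (h.mem_F hV).2 fun A hA hs => ?_
        obtain ⟨W, hW, hW', h2, h3⟩ := h1 _ hn A hA hs
        refine ⟨W, hW, hW', h2, ?_⟩
        have h4 := sub_of_rank_le (h.ord V hV) (h.ord W hW) (Ordinal.lift_le.1 h3)
        rcases (h.ord V hV).mem_trichotomous (h.ord W hW) with h5 | h5 | h5
        · exact .inr h5
        · exact .inl h5
        · exact absurd (h4 h5) (mem_irrefl _)
      exact mem_irrefl _ this
    · intro h1 γ hγ A hA hs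
      obtain ⟨γ', h2, rfl⟩ := Ordinal.lt_lift_iff.1 (hγ.trans_le h1)
      obtain ⟨y, hy, h3⟩ := lt_rank_iff.1 h2
      obtain ⟨W, hW, h4, h5, h6⟩ := (h.mem_F hV).1 hy A hA hs
      refine ⟨W, hW, h4, h5, Ordinal.lift_le.2 (h3.trans ?_)⟩
      rcases h6 with rfl | h6
      · exact le_rfl
      · exact (rank_lt_of_mem h6).le

theorem Pool.S_mem (h : Pool ℳ κ P) (β : Ordinal.{u + 1}) :
    ZFSet.sep (fun V => oGEin RamseyMeasureIn κ β (NU κ V)) P ∈ ℳ := by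
  have h0 := h.mod.tm0
  by_cases hne : ∃ V ∈ P, oGEin RamseyMeasureIn κ β (NU κ V)
  · obtain ⟨V, ⟨hV, hV'⟩, hmin⟩ := (InvImage.wf (fun V => rank (fapp (FP P κ) V)) (wellFounded_lt (α := Ordinal.{u}))).has_min
      {V | V ∈ P ∧ oGEin RamseyMeasureIn κ β (NU κ V)} hne
    have hF : FP P κ ∈ ℳ := DT2 h0 (fun P κ => FP P κ) h.mem h.kM
    have hFV : fapp (FP P κ) V ∈ ℳ := DT2 h0 (fun F V => fapp F V) hF (h.rm V hV).mem
    have h1 := sepM2 h0 (fun _ V F a => a ⊆ fapp F V) h.mem hF hFV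
    convert h1 using 1
    refine sep_congr' fun X hX => ?_
    constructor
    · intro h2
      exact sub_of_rank_le (h.ord V hV) (h.ord X hX) (not_lt.1 (hmin X ⟨hX, h2⟩))
    · intro h2
      exact (h.oGE X hX β).2 (((h.oGE V hV β).1 hV').trans (Ordinal.lift_le.2 (rank_mono h2)))
  · have : ZFSet.sep (fun V => oGEin RamseyMeasureIn κ β (NU κ V)) P = ∅ := by
      ext V
      rw [mem_sep]
      exact ⟨fun h => absurd ⟨V, h⟩ hne, fun h => absurd h (notMem_empty V)⟩
    rw [this]
    exact h.mod.1.mem_trans omega_zero h.mod.2.1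

end pool

theorem exists_pool {ℳ κ 𝒰 : ZFSet.{u}} (hκ : IsCard κ) (hℳ : IsTransModel ℳ) (hκM : κ ∈ ℳ)
    (h : IsWitnessIn RamseyMeasureIn ℳ κ 𝒰) :
    ∃ P, Pool ℳ κ P ∧ ∀ V, V ∈ P ↔ RM ℳ κ V ∧ ∃ W ∈ 𝒰, V ∈ NU κ W := by
  obtain ⟨U, hU, -⟩ := h.2.2 ∅ (hℳ.1.mem_trans omega_zero hℳ.2.1) (empty_subset _)
  have hR : ∀ W ∈ 𝒰, RM ℳ κ W := fun W hW => (h.2.1 W hW).rm hκ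
  obtain ⟨vk, hvk, hvk'⟩ := (hR U hU).vk
  have hvM : vk ∈ ℳ := hℳ.1.mem_trans hvk ((hR U hU).Mp_mem hℳ hκM)
  have hUn : ∀ V, V ∈ (⋃₀ (zimg 𝒰 (fun W => Np κ (Mp κ W) W)) : ZFSet) ↔ ∃ W ∈ 𝒰, V ∈ NU κ W := by
    intro V
    rw [mem_sUnion]
    constructor
    · rintro ⟨z, hz, hV⟩
      obtain ⟨W, hW, rfl⟩ := mem_zimg.1 hz
      exact ⟨W, hW, by rw [(hR W hW).NU_eq hℳ hκM]; exact hV⟩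
    · rintro ⟨W, hW, hV⟩
      exact ⟨_, mem_zimg.2 ⟨W, hW, rfl⟩, by rw [← (hR W hW).NU_eq hℳ hκM]; exact hV⟩
  have hP : ∀ V, V ∈ ZFSet.sep (fun V => RMd ℳ κ vk V) (⋃₀ (zimg 𝒰 (fun W => Np κ (Mp κ W) W)) : ZFSet) ↔
      RM ℳ κ V ∧ ∃ W ∈ 𝒰, V ∈ NU κ W := by
    intro V
    rw [mem_sep, hUn]
    constructor
    · rintro ⟨⟨W, hW, hV⟩, hd⟩
      exact ⟨hd.rm hℳ hκM (hR W hW) hvk' hV, W, hW, hV⟩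
    · rintro ⟨h1, h2⟩
      exact ⟨h2, h1.d hvk'⟩
  refine ⟨_, ⟨hℳ, hκM, ?_, fun V hV => ((hP V).1 hV).1, ?_⟩, hP⟩
  · exact sepM2 hℳ.tm0 (fun M V κ vk => RMd M κ vk V)
      (DT2 hℳ.tm0 (fun 𝒰 κ => (⋃₀ (zimg 𝒰 (fun W => Np κ (Mp κ W) W)) : ZFSet)) h.1 hκM) hκM hvM
  · intro V hV X hX hXR
    obtain ⟨h1, W, hW, h2⟩ := (hP V).1 hV
    refine (hP X).2 ⟨hXR, W, hW, ?_⟩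
    exact ((hR W hW).up hℳ hκM).tn.mem_of_mem hX ((hR W hW).NU_mem_NU hℳ hκM h2 h1)

section main
variable {ℳ κ : ZFSet.{u}}

theorem witness_ne (hℳ : IsTransModel ℳ) {𝒲 : ZFSet.{u}}
    (h : IsWitnessIn RamseyMeasureIn ℳ κ 𝒲) : ∃ W, W ∈ 𝒲 := by
  obtain ⟨U, hU, -⟩ := h.2.2 ∅ (hℳ.1.mem_trans omega_zero hℳ.2.1) (empty_subset _)
  exact ⟨U, hU⟩

theorem acc_MOrderIn (hκ : IsCard κ) (hℳ : IsTransModel ℳ) (hκM : κ ∈ ℳ) (𝒲 : ZFSet.{u})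
    (h : IsWitnessIn RamseyMeasureIn ℳ κ 𝒲) : Acc (MOrderIn RamseyMeasureIn ℳ κ) 𝒲 := by
  have : ∀ δ : Ordinal.{u}, ∀ 𝒲 : ZFSet.{u}, ∀ W ∈ 𝒲, IsWitnessIn RamseyMeasureIn ℳ κ 𝒲 →
      rank (NU κ W) = δ → Acc (MOrderIn RamseyMeasureIn ℳ κ) 𝒲 := by
    intro δ
    induction δ using WellFoundedLT.induction with
    | _ δ ih =>
      rintro 𝒲 W hW h𝒲 rfl
      refine ⟨𝒲, fun 𝒱 h𝒱 => ?_⟩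
      have hR := (h𝒲.2.1 W hW).rm hκ
      have up := hR.up hℳ hκM
      obtain ⟨V, hV, hVW, -, -⟩ := h𝒱.2.2.1 W hW ∅ (up.tn.mem_of_mem omega_zero up.tn.omega_mem) (empty_subset _)
      have hVR := (h𝒱.1.2.1 V hV).rm hκ
      exact ih _ (rank_lt_of_mem (hR.NU_mem_NU hℳ hκM hVW hVR)) 𝒱 V hV h𝒱.1 rfl
  obtain ⟨W, hW⟩ := witness_ne hℳ h
  exact this _ 𝒲 W hW h rfl

theorem relRank_lt {X : Type*} {r : X → X → Prop} {x y : X} (hy : Acc r y) (h : r x y) :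
    relRank r x < relRank r y := by
  rw [relRank, relRank, dif_pos hy, dif_pos (hy.inv h)]
  exact hy.rank_lt_of_rel h

theorem exists_of_lt_relRank {X : Type*} {r : X → X → Prop} {y : X} {β : Ordinal} (h : β < relRank r y) :
    ∃ x, r x y ∧ β ≤ relRank r x := by
  by_cases hy : Acc r y
  · rw [relRank, dif_pos hy, hy.rank_eq, Ordinal.lt_iSup_iff] at h
    obtain ⟨⟨x, hx⟩, h⟩ := h
    refine ⟨x, hx, ?_⟩
    rw [relRank, dif_pos (hy.inv hx)]
    exact Order.lt_succ_iff.1 h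
  · rw [relRank, dif_neg hy] at h
    exact absurd h (by simp)

theorem forward (α : Ordinal.{u + 1}) : ∀ 𝒰 : ZFSet.{u},
    α ≤ relRank (MOrderIn RamseyMeasureIn ℳ κ) 𝒰 → ∀ U ∈ 𝒰, oGEin RamseyMeasureIn κ α (NU κ U) := by
  induction α using WellFoundedLT.induction with
  | _ α ih =>
    intro 𝒰 hα U hU
    rw [oGEin_iff]
    intro A hA hs β hβ
    obtain ⟨𝒱, h1, h2⟩ := exists_of_lt_relRank (hβ.trans_le hα)
    obtain ⟨V, hV, hVN, h3, h4⟩ := h1.2.2.1 U hU A hA hs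
    exact ⟨V, hVN, h4, h3, ih β hβ 𝒱 h2 V hV⟩

theorem backward (hκ : IsCard κ) (hℳ : IsTransModel ℳ) (hκM : κ ∈ ℳ) (α : Ordinal.{u + 1}) : ∀ 𝒰 : ZFSet.{u},
    IsWitnessIn RamseyMeasureIn ℳ κ 𝒰 → (∀ U ∈ 𝒰, oGEin RamseyMeasureIn κ α (NU κ U)) →
    α ≤ relRank (MOrderIn RamseyMeasureIn ℳ κ) 𝒰 := by
  induction α using WellFoundedLT.induction with
  | _ α ih =>
    intro 𝒰 h𝒰 hα
    refine le_of_forall_lt fun β hβ => ?_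
    obtain ⟨P, hP, hPm⟩ := exists_pool hκ hℳ hκM h𝒰
    have hR : ∀ W ∈ 𝒰, RM ℳ κ W := fun W hW => (h𝒰.2.1 W hW).rm hκ
    have hS : ∀ V, V ∈ ZFSet.sep (fun V => oGEin RamseyMeasureIn κ β (NU κ V)) P ↔
        V ∈ P ∧ oGEin RamseyMeasureIn κ β (NU κ V) := fun V => mem_sep
    have key : ∀ W ∈ 𝒰, ∀ A ∈ NU κ W, A ⊆ κ →
        ∃ V ∈ ZFSet.sep (fun V => oGEin RamseyMeasureIn κ β (NU κ V)) P, V ∈ NU κ W ∧ AGood κ A V ∧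
          RamseyMeasureIn (NU κ W) κ V := by
      intro W hW A hA hs
      obtain ⟨V, hV, h1, h2, h3⟩ := oGEin_iff.1 (hα W hW) A hA hs β hβ
      exact ⟨V, (hS V).2 ⟨(hPm V).2 ⟨((hR W hW).ramsey_iff hℳ hκM hV).1 h1, W, hW, hV⟩, h3⟩, hV, h2, h1⟩
    have hwit : IsWitnessIn RamseyMeasureIn ℳ κ (ZFSet.sep (fun V => oGEin RamseyMeasureIn κ β (NU κ V)) P) := by
      refine ⟨hP.S_mem β, fun V hV => (hP.rm V ((hS V).1 hV).1).ramsey, fun A hA hs => ?_⟩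
      obtain ⟨U, hU, h1⟩ := h𝒰.2.2 A hA hs
      obtain ⟨V, hV, _, h2, _⟩ := key U hU A (((hR U hU).sub_iff hℳ hκM hs).2 ((hR U hU).agood.1 h1)) hs
      exact ⟨V, hV, h2⟩
    have hlt : MOrderIn RamseyMeasureIn ℳ κ (ZFSet.sep (fun V => oGEin RamseyMeasureIn κ β (NU κ V)) P) 𝒰 := by
      refine ⟨hwit, h𝒰, fun W hW A hA hs => ?_, fun V hV => ?_⟩
      · exact key W hW A hA hs
      · exact ((hPm V).1 ((hS V).1 hV).1).2
    exact (ih β hβ _ hwit fun V hV => ((hS V).1 hV).2).trans_lt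
      (relRank_lt (acc_MOrderIn hκ hℳ hκM 𝒰 h𝒰) hlt)

end main


/-- Let `α` be an ordinal and let `ℳ` be practical for `κ`. Then, in `ℳ`,
a witness collection `𝒰` of Ramsey measures on `κ` satisfies `o_Ram(𝒰) ≥ α` if and only if
`N_U ⊨ o_Ram(κ) ≥ α` for every `U ∈ 𝒰`. -/
theorem ramsey_rank_ge_iff (κ ℳ : ZFSet) (hκ : IsCard κ) (hℳ : Practical κ ℳ)
    (α : Ordinal) (𝒰 : ZFSet)
    (h𝒰 : IsWitnessIn RamseyMeasureIn ℳ κ 𝒰) :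
    α ≤ relRank (MOrderIn RamseyMeasureIn ℳ κ) 𝒰 ↔
      ∀ U ∈ 𝒰.toSet, oGEin RamseyMeasureIn κ α (NU κ U) := by
  exact ⟨fun h U hU => forward α 𝒰 h U hU, fun h => backward hκ hℳ.1 hℳ.2.1 α 𝒰 h𝒰 h⟩

end MPaper
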